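/- arXiv:2111.04423 — 4 statements merged into one kernel-verified Lean document; each statement's English description precedes it below -/
import Mathlib

section
/- Let $\ell, s, n_1, \dots, n_\ell, k_1, \dots, k_\ell$ be positive integers with $n_i \geq 4\ell^2 k_i^2 s$ for all $i$. If $\mathcal{F} \subseteq \sqcup_{i=1}^\ell \binom{V_i}{k_i}$ has matching number at most $s$, then $|\mathcal{F}| \leq \prod_{i=1}^\ell \binom{n_i}{k_i} - \min_{x_1 + \dots + x_\ell = s} \prod_{i=1}^\ell \binom{n_i - x_i}{k_i}$, where the minimum is over nonnegative integers $x_i$ summing to $s$. -/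
namespace EMP
open Finset

/-- number of elements of `S` below `t` -/
def cnt (S : Finset ℕ) (t : ℕ) : ℕ := (S.filter (fun x => x < t)).card

def Good (a s : ℕ) (W B : Finset ℕ) : Prop :=
  ∀ t, cnt B t = 0 ∨ a + cnt B t * (s + 1) ≤ cnt W t

lemma cnt_mono {S T : Finset ℕ} (h : S ⊆ T) (t : ℕ) : cnt S t ≤ cnt T t :=
  card_le_card (filter_subset_filter _ h)

lemma cnt_le_card (S : Finset ℕ) (t : ℕ) : cnt S t ≤ S.card := card_filter_le _ _

lemma cnt_of_lt {S : Finset ℕ} {t : ℕ} (h : ∀ x ∈ S, x < t) : cnt S t = S.card := by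
  unfold cnt
  rw [filter_true_of_mem h]

lemma cnt_insert_of_le {S : Finset ℕ} {m t : ℕ} (h : t ≤ m) : cnt (insert m S) t = cnt S t := by
  unfold cnt
  rw [filter_insert, if_neg (by omega)]

lemma choose_bad {a s n k : ℕ} (h : n < a + (k + 1) * (s + 1)) :
    n.choose (k + 1) ≤ (a + s) * n.choose k := by
  have h1 := Nat.choose_succ_right_eq n k
  have h2 : n - k ≤ (k + 1) * (a + s) := by
    have : n ≤ k + (a + (k+1) * s) := by nlinarith
    have : a ≤ (k + 1) * a := by nlinarith
    rw [mul_add]; omega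
  have h3 : n.choose (k + 1) * (k + 1) ≤ ((a + s) * n.choose k) * (k + 1) := by
    rw [h1]
    calc n.choose k * (n - k) ≤ n.choose k * ((k + 1) * (a + s)) := Nat.mul_le_mul_left _ h2
      _ = _ := by ring
  exact Nat.le_of_mul_le_mul_right h3 (Nat.succ_pos k)

open Classical in
lemma bad_card (a s : ℕ) (W : Finset ℕ) : ∀ k,
    ((W.powersetCard (k + 1)).filter (fun B => ¬ Good a s W B)).card
      ≤ (a + s) * W.card.choose k := by
  induction W using Finset.induction_on_max with
  | empty =>
    intro k
    simp [powersetCard_eq_empty.2 (show (∅ : Finset ℕ).card < k + 1 by simp)]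
  | insert m W hm ih =>
    intro k
    have hmW : m ∉ W := fun h => lt_irrefl _ (hm m h)
    by_cases h : W.card + 1 < a + (k + 1) * (s + 1)
    · refine (card_filter_le _ _).trans ?_
      rw [card_powersetCard, card_insert_of_notMem hmW]
      exact choose_bad h
    · push Not at h
      have hsub : ((insert m W).powersetCard (k + 1)).filter (fun B => ¬ Good a s (insert m W) B)
          ⊆ ((W.powersetCard (k + 1)).filter (fun B => ¬ Good a s W B)) ∪
            ((W.powersetCard k).filter (fun B => ¬ Good a s W B)).image (insert m) := by
        intro B hB
        rw [mem_filter, powersetCard_succ_insert hmW, mem_union] at hB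
        obtain ⟨hB1, hB2⟩ := hB
        rw [mem_union]
        rcases hB1 with hB1 | hB1
        · left
          rw [mem_filter]
          refine ⟨hB1, fun hg => hB2 fun t => ?_⟩
          exact (hg t).imp id (fun h => h.trans (cnt_mono (subset_insert _ _) t))
        · right
          rw [mem_image] at hB1 ⊢
          obtain ⟨C, hC, rfl⟩ := hB1
          refine ⟨C, mem_filter.2 ⟨hC, fun hg => hB2 fun t => ?_⟩, rfl⟩
          rw [mem_powersetCard] at hC
          rcases le_or_gt t m with ht | ht
          · rw [cnt_insert_of_le ht, cnt_insert_of_le ht]; exact hg t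
          · right
            have e1 : cnt (insert m C) t ≤ k + 1 := by
              refine (cnt_le_card _ _).trans ((card_insert_le _ _).trans ?_)
              omega
            have e2 : cnt (insert m W) t = W.card + 1 := by
              rw [cnt_of_lt, card_insert_of_notMem hmW]
              intro x hx
              rcases mem_insert.1 hx with rfl | hx
              · exact ht
              · exact (hm x hx).trans ht
            rw [e2]
            refine le_trans ?_ h
            gcongr
      refine (card_le_card hsub).trans ((card_union_le _ _).trans ?_)
      refine (Nat.add_le_add (ih k) card_image_le).trans ?_
      rw [card_insert_of_notMem hmW]
      cases k with
      | zero =>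
        have : (W.powersetCard 0).filter (fun B => ¬ Good a s W B) = ∅ := by
          rw [filter_eq_empty_iff]
          intro B hB
          rw [powersetCard_zero, mem_singleton] at hB
          subst hB
          simp [Good, cnt]
        rw [this]; simp
      | succ k =>
        refine (Nat.add_le_add_left (ih k) _).trans ?_
        rw [Nat.choose_succ_succ' W.card k]
        exact le_of_eq (by ring)

/-! single-part estimates -/

lemma choose_one {n k : ℕ} (hn : 0 < n) (hk : 0 < k) :
    ((n - 1).choose (k - 1) : ℝ) = (k / n : ℝ) * n.choose k := by
  obtain ⟨n, rfl⟩ := Nat.exists_eq_succ_of_ne_zero hn.ne'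
  obtain ⟨k, rfl⟩ := Nat.exists_eq_succ_of_ne_zero hk.ne'
  have := Nat.add_one_mul_choose_eq n k
  have h2 : ((n : ℝ) + 1) * n.choose k = (n + 1).choose (k + 1) * (k + 1) := by exact_mod_cast this
  have : (n : ℝ) + 1 ≠ 0 := by positivity
  simp only [Nat.succ_eq_add_one, Nat.add_sub_cancel]
  push_cast
  field_simp
  linarith

lemma choose_bad_real {n k : ℕ} (hk : 0 < k) (hn : 4 * k ^ 2 ≤ n) :
    (n.choose (k - 1) : ℝ) ≤ (11 / 10 * (k / n) : ℝ) * n.choose k := by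
  obtain ⟨k, rfl⟩ := Nat.exists_eq_succ_of_ne_zero hk.ne'
  simp only [Nat.succ_eq_add_one, Nat.add_sub_cancel] at *
  have h1 := Nat.choose_succ_right_eq n k
  have hkn : k ≤ n := by nlinarith
  have h2 : (n.choose (k+1) : ℝ) * (k + 1) = n.choose k * (n - k) := by
    rw [← Nat.cast_sub hkn]; exact_mod_cast h1
  have h3 : (4 * (k + 1) ^ 2 : ℝ) ≤ n := by exact_mod_cast hn
  have hn0 : (0:ℝ) < n := by nlinarith [(Nat.cast_nonneg k : (0:ℝ) ≤ k)]
  have : (11 / 10 * (((k + 1 : ℕ) : ℝ) / n) : ℝ) * n.choose (k+1) =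
      n.choose k * (11 / 10 * (n - k) / n) := by
    push_cast
    field_simp
    linarith
  rw [this]
  refine le_mul_of_one_le_right (by positivity) ?_
  rw [le_div_iff₀ hn0]
  nlinarith [(Nat.cast_nonneg k : (0:ℝ) ≤ k), sq_nonneg ((k:ℝ) - 1)]

lemma choose_bad_real' {n k : ℕ} (hk : 2 ≤ k) (hn : 4 * k ^ 2 ≤ n) :
    ((n - 1).choose (k - 2) : ℝ) ≤ (k / n : ℝ) * (n - 1).choose (k - 1) := by
  obtain ⟨k, rfl⟩ := Nat.exists_eq_add_of_le' hk
  obtain ⟨n, rfl⟩ : ∃ m, n = m + 1 := ⟨n - 1, by have : 0 < (k+2)^2 := by positivity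
                                                 omega⟩
  simp only [Nat.add_sub_cancel] at *
  have e : k + 2 - 1 = k + 1 := by omega
  rw [e]
  have h1 := Nat.choose_succ_right_eq n k
  have hkn : k ≤ n := by nlinarith
  have h2 : (n.choose (k+1) : ℝ) * (k + 1) = n.choose k * (n - k) := by
    rw [← Nat.cast_sub hkn]; exact_mod_cast h1
  have h3 : (4 * (k + 2) ^ 2 : ℝ) ≤ n + 1 := by exact_mod_cast hn
  have hk0 := (Nat.cast_nonneg k : (0:ℝ) ≤ k)
  have : (((k + 2 : ℕ) : ℝ) / (n + 1 : ℕ)) * n.choose (k+1) =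
      n.choose k * ((k + 2) * (n - k) / ((k + 1) * (n + 1))) := by
    push_cast
    field_simp
    linear_combination h2
  rw [this]
  refine le_mul_of_one_le_right (by positivity) ?_
  rw [le_div_iff₀ (by positivity)]
  nlinarith

lemma choose_two {n k : ℕ} (hk : 2 ≤ k) (hn : 4 * k ^ 2 ≤ n) :
    ((n - 2).choose (k - 2) : ℝ) ≤ (k / n : ℝ) * (n - 1).choose (k - 1) := by
  refine le_trans ?_ (choose_bad_real' hk hn)
  exact_mod_cast Nat.choose_le_choose _ (by omega)

lemma card_mem {W : Finset ℕ} {k v : ℕ} (_hv : v ∈ W) (p : Finset ℕ → Prop) [DecidablePred p] :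
    ((W.powersetCard k).filter (fun B => v ∈ B ∧ p (B.erase v))).card
      ≤ (((W.erase v).powersetCard (k - 1)).filter p).card := by
  refine card_le_card_of_injOn (fun B => B.erase v) ?_ ?_
  · intro B hB
    simp only [coe_filter, mem_powersetCard, Set.mem_ofPred_eq] at hB ⊢
    refine ⟨⟨erase_subset_erase _ hB.1.1, ?_⟩, hB.2.2⟩
    rw [card_erase_of_mem hB.2.1, hB.1.2]
  · intro B hB C hC h
    simp only [coe_filter, mem_powersetCard, Set.mem_ofPred_eq] at hB hC h
    rw [← insert_erase hB.2.1, h, insert_erase hC.2.1]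

lemma part_a {W : Finset ℕ} {k v : ℕ} (hk : 0 < k) (hv : v ∈ W) :
    (((W.powersetCard k).filter (fun B => v ∈ B)).card : ℝ)
      ≤ (k / W.card : ℝ) * W.card.choose k := by
  rw [← choose_one (card_pos.2 ⟨v, hv⟩) hk]
  have := card_mem (k := k) hv (fun _ => True)
  simp only [and_true, filter_true, card_powersetCard, card_erase_of_mem hv] at this
  exact_mod_cast this

lemma part_b {W : Finset ℕ} {k v u : ℕ} (hk : 0 < k) (hn : 4 * k ^ 2 ≤ W.card)
    (hv : v ∈ W) (hu : u ∈ W) (huv : u ≠ v) :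
    (((W.powersetCard k).filter (fun B => v ∈ B ∧ u ∈ B)).card : ℝ)
      ≤ (k / W.card : ℝ) * (k / W.card) * W.card.choose k := by
  rw [mul_comm (k / W.card : ℝ), mul_assoc, ← choose_one (card_pos.2 ⟨v, hv⟩) hk]
  have h1 := card_mem (k := k) hv (fun B => u ∈ B)
  simp only [mem_erase, ne_eq, huv, not_false_eq_true, true_and] at h1
  have huW : u ∈ W.erase v := mem_erase.2 ⟨huv, hu⟩
  rcases Nat.lt_or_ge k 2 with h | h
  · obtain rfl : k = 1 := by omega
    have h0 : (((W.erase v).powersetCard (1 - 1)).filter (fun B => u ∈ B)).card = 0 := by simp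
    have : ((W.powersetCard 1).filter (fun B => v ∈ B ∧ u ∈ B)).card = 0 := by omega
    rw [this]; simp only [Nat.cast_zero]; positivity
  · refine le_trans ?_ (choose_two h hn)
    have h2 := card_mem (k := k - 1) huW (fun _ => True)
    simp only [and_true, filter_true, card_powersetCard, card_erase_of_mem huW,
      card_erase_of_mem hv] at h2
    have := h1.trans h2
    simp only [Nat.sub_sub] at this
    exact_mod_cast this

open Classical in
lemma part_c {W : Finset ℕ} {k v s : ℕ} (hk : 0 < k) (hn : 4 * k ^ 2 ≤ W.card)
    (hv : v ∈ W) :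
    (((W.powersetCard k).filter (fun B => v ∈ B ∧ ¬ Good s s (W.erase v) (B.erase v))).card : ℝ)
      ≤ (k / W.card : ℝ) * (11 / 5 * s * (k / W.card)) * W.card.choose k := by
  have e : (k / W.card : ℝ) * (11 / 5 * s * (k / W.card)) * W.card.choose k =
    (11 / 5 * s * (k / W.card)) * ((k / W.card : ℝ) * W.card.choose k) := by ring
  rw [e, ← choose_one (card_pos.2 ⟨v, hv⟩) hk]
  have h1 := card_mem (k := k) hv (fun B => ¬ Good s s (W.erase v) B)
  rcases Nat.lt_or_ge k 2 with h | h
  · obtain rfl : k = 1 := by omega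
    have h0 : ((W.erase v).powersetCard (1 - 1)).filter
      (fun B => ¬ Good s s (W.erase v) B) = ∅ := by
      rw [filter_eq_empty_iff]
      intro B hB
      rw [powersetCard_zero, mem_singleton] at hB
      subst hB
      simp [Good, cnt]
    rw [h0, card_empty] at h1
    have h2 := Nat.le_zero.1 h1
    rw [h2]; simp only [Nat.cast_zero]; positivity
  · have h2 := bad_card s s (W.erase v) (k - 2)
    rw [show k - 2 + 1 = k - 1 by omega, card_erase_of_mem hv] at h2
    have h3 : (_ : ℝ) ≤ _ := Nat.cast_le.2 (h1.trans h2)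
    refine h3.trans ?_
    push_cast
    have := choose_bad_real' h hn
    calc ((s : ℝ) + s) * ((W.card - 1).choose (k - 2))
        ≤ ((s : ℝ) + s) * ((k / W.card : ℝ) * (W.card - 1).choose (k - 1)) := by gcongr
      _ = 2 * s * (k / W.card : ℝ) * (W.card - 1).choose (k - 1) := by ring
      _ ≤ _ := by gcongr; norm_num

open Classical in
lemma part_d {W : Finset ℕ} {k s : ℕ} (hk : 0 < k) (hn : 4 * k ^ 2 ≤ W.card) :
    (((W.powersetCard k).filter (fun B => ¬ Good s s W B)).card : ℝ)
      ≤ (11 / 5 * s * (k / W.card)) * W.card.choose k := by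
  have h2 := bad_card s s W (k - 1)
  rw [show k - 1 + 1 = k by omega] at h2
  have h3 : (_ : ℝ) ≤ _ := Nat.cast_le.2 h2
  refine h3.trans ?_
  push_cast
  have := choose_bad_real hk hn
  calc ((s : ℝ) + s) * (W.card.choose (k - 1))
        ≤ ((s : ℝ) + s) * ((11 / 10 * (k / W.card) : ℝ) * W.card.choose k) := by gcongr
    _ = _ := by ring

/-! enumeration -/

lemma exists_enum (W : Finset ℕ) : ∃ f : ℕ → ℕ, (∀ m < W.card, f m ∈ W) ∧
    (∀ m < W.card, ∀ m' < W.card, f m = f m' → m = m') ∧ ∀ m t, m < cnt W t → f m < t := by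
  have hfin : (Set.ofPred (fun x => x ∈ W)).Finite := W.finite_toSet
  have hcard : hfin.toFinset.card = W.card := by
    congr 1
    ext x; simp
  refine ⟨Nat.nth (fun x => x ∈ W), ?_, ?_, ?_⟩
  · intro m hm
    exact Nat.nth_mem_of_lt_card hfin (by omega)
  · intro m hm m' hm' h
    exact Nat.nth_injOn hfin (by simp only [Set.mem_Iio]; omega)
      (by simp only [Set.mem_Iio]; omega) h
  · intro m t h
    apply Nat.nth_lt_of_lt_count
    rw [Nat.count_eq_card_filter_range]
    refine h.trans_le (le_of_eq ?_)
    unfold cnt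
    congr 1
    ext x; simp [and_comm]

lemma exists_index (Y : Finset ℕ) : ∃ e : ℕ → ℕ, (∀ v ∈ Y, e v < Y.card) ∧
    ∀ u ∈ Y, ∀ v ∈ Y, e u = e v → u = v := by
  refine ⟨fun v => cnt Y v, ?_, ?_⟩
  · intro v hv
    refine card_lt_card ((ssubset_iff_of_subset (filter_subset _ _)).2 ⟨v, hv, by simp⟩)
  · have key : ∀ u ∈ Y, ∀ v ∈ Y, u < v → cnt Y u < cnt Y v := by
      intro u hu v hv huv
      refine card_lt_card ((ssubset_iff_of_subset ?_).2 ⟨u, by simp [hu, huv], by simp⟩)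
      intro x hx
      simp only [mem_filter] at hx ⊢
      exact ⟨hx.1, hx.2.trans huv⟩
    intro u hu v hv h
    rcases lt_trichotomy u v with h1 | h1 | h1
    · have := key u hu v hv h1; simp only at h; omega
    · exact h1
    · have := key v hv u hu h1; simp only at h; omega

/-! shifting -/

variable {ι : Type} [Fintype ι] [DecidableEq ι]

def Uni (V : ι → Finset ℕ) (k : ι → ℕ) (A : Finset ℕ) : Prop :=
  A ⊆ univ.biUnion V ∧ ∀ i, (A ∩ V i).card = k i

def Mat (s : ℕ) (F : Finset (Finset ℕ)) : Prop :=
  ∀ M : Finset (Finset ℕ), M ⊆ F → (↑M : Set (Finset ℕ)).Pairwise Disjoint → M.card ≤ s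

def Dsj (V : ι → Finset ℕ) : Prop := ∀ i j, i ≠ j → Disjoint (V i) (V j)

abbrev sw (x y : ℕ) (A : Finset ℕ) : Finset ℕ := A.map (Equiv.swap x y).toEmbedding

def Shifted (V : ι → Finset ℕ) (F : Finset (Finset ℕ)) : Prop :=
  ∀ i, ∀ x ∈ V i, ∀ y ∈ V i, x < y → ∀ A ∈ F, y ∈ A → x ∉ A → sw x y A ∈ F

lemma mem_sw {x y z : ℕ} {A : Finset ℕ} : z ∈ sw x y A ↔ Equiv.swap x y z ∈ A := by
  simp [sw, mem_map_equiv]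

lemma sw_sw (x y : ℕ) (A : Finset ℕ) : sw x y (sw x y A) = A := by
  ext z; simp [mem_sw]

lemma sw_inj {x y : ℕ} {A B : Finset ℕ} (h : sw x y A = sw x y B) : A = B := by
  rw [← sw_sw x y A, h, sw_sw]

lemma swap_mem {V : ι → Finset ℕ} (hV : Dsj V) {i : ι} {x y : ℕ} (hx : x ∈ V i) (hy : y ∈ V i)
    (j : ι) (z : ℕ) : Equiv.swap x y z ∈ V j ↔ z ∈ V j := by
  by_cases hij : i = j
  · subst hij
    by_cases h1 : z = x
    · subst h1; simp [hx, hy]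
    · by_cases h2 : z = y
      · subst h2; simp [hx, hy]
      · rw [Equiv.swap_apply_of_ne_of_ne h1 h2]
  · have hxj : x ∉ V j := disjoint_left.1 (hV i j hij) hx
    have hyj : y ∉ V j := disjoint_left.1 (hV i j hij) hy
    by_cases h1 : z = x
    · subst h1; simp [hxj, hyj]
    · by_cases h2 : z = y
      · subst h2; simp [hxj, hyj]
      · rw [Equiv.swap_apply_of_ne_of_ne h1 h2]

lemma uni_sw {V : ι → Finset ℕ} {k : ι → ℕ} (hV : Dsj V) {i : ι} {x y : ℕ} (hx : x ∈ V i)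
    (hy : y ∈ V i) {A : Finset ℕ} (hA : Uni V k A) : Uni V k (sw x y A) := by
  constructor
  · intro z hz
    rw [mem_sw] at hz
    have := hA.1 hz
    simp only [mem_biUnion, mem_univ, true_and] at this ⊢
    obtain ⟨j, hj⟩ := this
    exact ⟨j, (swap_mem hV hx hy j z).1 hj⟩
  · intro j
    have : sw x y A ∩ V j = sw x y (A ∩ V j) := by
      ext z; simp only [mem_inter, mem_sw, swap_mem hV hx hy]
    rw [this, card_map, hA.2 j]

def wt (A : Finset ℕ) : ℕ := ∑ a ∈ A, a

lemma wt_sw {x y : ℕ} (hxy : x < y) {A : Finset ℕ} (hy : y ∈ A) (hx : x ∉ A) :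
    wt (sw x y A) < wt A := by
  unfold wt sw
  rw [sum_map]
  apply sum_lt_sum
  · intro a ha
    by_cases h2 : a = y
    · subst h2; simp [hxy.le]
    · have : a ≠ x := fun h => hx (h ▸ ha)
      simp [Equiv.swap_apply_of_ne_of_ne this h2]
  · exact ⟨y, hy, by simp [hxy]⟩

open Classical in
lemma shift_step {V : ι → Finset ℕ} {k : ι → ℕ} {s : ℕ} (hV : Dsj V)
    {F : Finset (Finset ℕ)} (hF : ∀ A ∈ F, Uni V k A) (hM : Mat s F) (hns : ¬ Shifted V F) :
    ∃ F' : Finset (Finset ℕ), (∀ A ∈ F', Uni V k A) ∧ Mat s F' ∧ F'.card = F.card ∧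
      ∑ A ∈ F', wt A < ∑ A ∈ F, wt A := by
  unfold Shifted at hns
  push Not at hns
  obtain ⟨i, x, hx, y, hy, hxy, A₀, hA₀, hyA, hxA, hA₀'⟩ := hns
  let g : Finset ℕ → Finset ℕ := fun A => if y ∈ A ∧ x ∉ A ∧ sw x y A ∉ F then sw x y A else A
  have hg1 : ∀ A, (y ∈ A ∧ x ∉ A ∧ sw x y A ∉ F) → g A = sw x y A := fun A h => if_pos h
  have hg2 : ∀ A, ¬ (y ∈ A ∧ x ∉ A ∧ sw x y A ∉ F) → g A = A := fun A h => if_neg h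
  have hinj : ∀ A ∈ F, ∀ B ∈ F, g A = g B → A = B := by
    intro A hA B hB h
    by_cases h1 : (y ∈ A ∧ x ∉ A ∧ sw x y A ∉ F)
    · by_cases h2 : (y ∈ B ∧ x ∉ B ∧ sw x y B ∉ F)
      · rw [hg1 A h1, hg1 B h2] at h
        exact sw_inj h
      · rw [hg1 A h1, hg2 B h2] at h
        exact absurd (h ▸ hB) h1.2.2
    · by_cases h2 : (y ∈ B ∧ x ∉ B ∧ sw x y B ∉ F)
      · rw [hg2 A h1, hg1 B h2] at h
        exact absurd (h ▸ hA) h2.2.2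
      · rwa [hg2 A h1, hg2 B h2] at h
  have hinj' : Set.InjOn g F := fun A hA B hB h => hinj A hA B hB h
  refine ⟨F.image g, ?_, ?_, card_image_of_injOn hinj', ?_⟩
  · intro A hA
    obtain ⟨B, hB, rfl⟩ := mem_image.1 hA
    by_cases h1 : (y ∈ B ∧ x ∉ B ∧ sw x y B ∉ F)
    · rw [hg1 B h1]; exact uni_sw hV hx hy (hF B hB)
    · rw [hg2 B h1]; exact hF B hB
  · intro M hMF hdis
    by_cases hall : M ⊆ F
    · exact hM M hall hdis
    · rw [not_subset] at hall
      obtain ⟨N, hNM, hNF⟩ := hall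
      have hN : x ∈ N ∧ sw x y N ∈ F := by
        obtain ⟨B, hB, hBN⟩ := mem_image.1 (hMF hNM)
        by_cases h1 : (y ∈ B ∧ x ∉ B ∧ sw x y B ∉ F)
        · rw [hg1 B h1] at hBN
          subst hBN
          rw [sw_sw, mem_sw]
          simp [h1.1, hB]
        · rw [hg2 B h1] at hBN
          exact absurd (hBN ▸ hB) hNF
      have hsub : M.image (sw x y) ⊆ F := by
        intro C hC
        obtain ⟨B, hB, rfl⟩ := mem_image.1 hC
        by_cases hBN : B = N
        · subst hBN; exact hN.2
        · have hd : Disjoint B N := hdis hB hNM hBN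
          have hxB : x ∉ B := fun h => disjoint_left.1 hd h hN.1
          obtain ⟨D, hD, hDB⟩ := mem_image.1 (hMF hB)
          by_cases h1 : (y ∈ D ∧ x ∉ D ∧ sw x y D ∉ F)
          · rw [hg1 D h1] at hDB
            exfalso
            apply hxB
            rw [← hDB, mem_sw]
            simp [h1.1]
          · rw [hg2 D h1] at hDB
            subst hDB
            by_cases hyD : y ∈ D
            · by_contra h
              exact h1 ⟨hyD, hxB, h⟩
            · have : sw x y D = D := by
                ext z
                rw [mem_sw]
                by_cases h1 : z = x
                · subst h1; simp [hxB, hyD]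
                · by_cases h2 : z = y
                  · subst h2; simp [hxB, hyD]
                  · rw [Equiv.swap_apply_of_ne_of_ne h1 h2]
              rw [this]; exact hD
      have hc : (M.image (sw x y)).card = M.card :=
        card_image_of_injective _ (fun A B h => sw_inj h)
      rw [← hc]
      apply hM _ hsub
      intro A hA B hB hAB
      obtain ⟨A', hA', rfl⟩ := mem_image.1 (mem_coe.1 hA)
      obtain ⟨B', hB', rfl⟩ := mem_image.1 (mem_coe.1 hB)
      have : Disjoint A' B' := hdis hA' hB' (fun h => hAB (h ▸ rfl))
      exact (disjoint_map _).2 this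
  · rw [sum_image hinj']
    apply sum_lt_sum
    · intro A hA
      by_cases h1 : (y ∈ A ∧ x ∉ A ∧ sw x y A ∉ F)
      · rw [hg1 A h1]; exact (wt_sw hxy h1.1 h1.2.1).le
      · rw [hg2 A h1]
    · refine ⟨A₀, hA₀, ?_⟩
      rw [hg1 A₀ ⟨hyA, hxA, hA₀'⟩]
      exact wt_sw hxy hyA hxA

lemma exists_shifted {V : ι → Finset ℕ} {k : ι → ℕ} {s : ℕ} (hV : Dsj V) :
    ∀ (w : ℕ) (F : Finset (Finset ℕ)), ∑ A ∈ F, wt A = w → (∀ A ∈ F, Uni V k A) → Mat s F →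
    ∃ F' : Finset (Finset ℕ), (∀ A ∈ F', Uni V k A) ∧ Mat s F' ∧ F'.card = F.card ∧
      Shifted V F' := by
  intro w
  induction w using Nat.strong_induction_on with
  | _ w ih =>
    intro F hw hF hM
    by_cases hs : Shifted V F
    · exact ⟨F, hF, hM, rfl, hs⟩
    · obtain ⟨F', h1, h2, h3, h4⟩ := shift_step hV hF hM hs
      obtain ⟨F'', h5, h6, h7, h8⟩ := ih _ (hw ▸ h4) F' rfl h1 h2
      exact ⟨F'', h5, h6, h7.trans h3, h8⟩

lemma dominate {V : ι → Finset ℕ} {k : ι → ℕ} (hV : Dsj V) {F : Finset (Finset ℕ)}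
    (hF : ∀ A ∈ F, Uni V k A) (hs : Shifted V F) {B : Finset ℕ} (hB : Uni V k B) :
    ∀ (d : ℕ) (A : Finset ℕ), (A \ B).card = d → A ∈ F →
      (∀ j t, cnt (A ∩ V j) t ≤ cnt (B ∩ V j) t) → B ∈ F := by
  intro d
  induction d using Nat.strong_induction_on with
  | _ d ih =>
    intro A hd hA hcnt
    by_cases hAB : A ⊆ B
    · have : A = B := by
        refine Subset.antisymm hAB fun z hz => ?_
        have := hB.1 hz
        simp only [mem_biUnion, mem_univ, true_and] at this
        obtain ⟨j, hj⟩ := this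
        have e : A ∩ V j = B ∩ V j :=
          eq_of_subset_of_card_le (inter_subset_inter_right hAB)
            (by rw [(hF A hA).2 j, hB.2 j])
        have : z ∈ A ∩ V j := e ▸ mem_inter.2 ⟨hz, hj⟩
        exact (mem_inter.1 this).1
      exact this ▸ hA
    · rw [not_subset] at hAB
      obtain ⟨a₀, ha₀, ha₀B⟩ := hAB
      have := (hF A hA).1 ha₀
      simp only [mem_biUnion, mem_univ, true_and] at this
      obtain ⟨j, hj⟩ := this
      have hne : ((A \ B) ∩ V j).Nonempty := ⟨a₀, by simp [ha₀, ha₀B, hj]⟩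
      obtain ⟨a, haM, hmin⟩ := exists_min_image _ id hne
      simp only [mem_inter, mem_sdiff, id] at haM hmin
      obtain ⟨⟨haA, haB⟩, haj⟩ := haM
      have hb : ∃ b ∈ B, b ∈ V j ∧ b < a ∧ b ∉ A := by
        by_contra hcon
        push Not at hcon
        have h1 := hcnt j (a + 1)
        have h2 : cnt (B ∩ V j) (a + 1) < cnt (A ∩ V j) (a + 1) := by
          refine card_lt_card ((ssubset_iff_of_subset ?_).2 ⟨a, by simp [haA, haj], by simp [haB]⟩)
          intro z hz
          simp only [mem_filter, mem_inter] at hz ⊢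
          refine ⟨⟨?_, hz.1.2⟩, hz.2⟩
          have : z ≠ a := fun h => haB (h ▸ hz.1.1)
          exact hcon z hz.1.1 hz.1.2 (by omega)
        omega
      obtain ⟨b, hbB, hbj, hba, hbA⟩ := hb
      have hA' := hs j b hbj a haj hba A hA haA hbA
      refine ih _ ?_ (sw b a A) rfl hA' ?_
      · rw [← hd]
        refine card_lt_card ((ssubset_iff_of_subset ?_).2 ⟨a, by simp [haA, haB], ?_⟩)
        · intro z hz
          simp only [mem_sdiff, mem_sw] at hz ⊢
          refine ⟨?_, hz.2⟩
          have h1 : z ≠ b := fun h => hz.2 (h ▸ hbB)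
          by_cases h2 : z = a
          · exact h2 ▸ haA
          · rw [Equiv.swap_apply_of_ne_of_ne h1 h2] at hz; exact hz.1
        · simp [mem_sw, hbA]
      · intro j' t
        by_cases hcase : j' = j ∧ t ≤ a
        · obtain ⟨rfl, ht⟩ := hcase
          apply card_le_card
          intro z hz
          simp only [mem_filter, mem_inter, mem_sw] at hz ⊢
          refine ⟨⟨?_, hz.1.2⟩, hz.2⟩
          by_cases h1 : z = b
          · exact h1 ▸ hbB
          · rw [Equiv.swap_apply_of_ne_of_ne h1 (by omega)] at hz
            by_contra hzB
            have := hmin z ⟨⟨hz.1.1, hzB⟩, hz.1.2⟩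
            omega
        · refine le_trans (le_of_eq ?_) (hcnt j' t)
          unfold cnt
          have : filter (fun z => z < t) (sw b a A ∩ V j') =
              sw b a (filter (fun z => z < t) (A ∩ V j')) := by
            ext z
            simp only [mem_filter, mem_inter, mem_sw, swap_mem hV hbj haj]
            by_cases hj' : j' = j
            · have ht : a < t := by
                by_contra h
                exact hcase ⟨hj', by omega⟩
              by_cases h1 : z = b
              · subst h1; simp only [Equiv.swap_apply_left]
                constructor <;> rintro ⟨h1, h2⟩ <;> exact ⟨h1, by omega⟩
              · by_cases h2 : z = a
                · subst h2; simp only [Equiv.swap_apply_right]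
                  constructor <;> rintro ⟨h1, h2⟩ <;> exact ⟨h1, by omega⟩
                · rw [Equiv.swap_apply_of_ne_of_ne h1 h2]
            · have hd := hV j' j hj'
              by_cases h0 : z ∈ V j'
              · have h3 := disjoint_left.1 hd h0
                have hzb : z ≠ b := by rintro rfl; exact h3 hbj
                have hza : z ≠ a := by rintro rfl; exact h3 haj
                rw [Equiv.swap_apply_of_ne_of_ne hzb hza]
              · simp [h0]
          rw [this, card_map]

/-! rich vertices -/

def Rich (V : ι → Finset ℕ) (s : ℕ) (F : Finset (Finset ℕ)) (v : ℕ) : Prop :=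
  ∃ A ∈ F, v ∈ A ∧ ∀ j, Good s s ((V j).erase v) ((A ∩ V j).erase v)

lemma rich_card {V : ι → Finset ℕ} {k : ι → ℕ} {s : ℕ} (hs : 0 < s) (hk : ∀ i, 0 < k i)
    (hn : ∀ i, 4 * k i ^ 2 * s ≤ (V i).card) (hV : Dsj V)
    {F : Finset (Finset ℕ)} (hF : ∀ A ∈ F, Uni V k A) (hM : Mat s F) (hsh : Shifted V F)
    (Y : Finset ℕ) (hYV : Y ⊆ univ.biUnion V) (hY : ∀ v ∈ Y, Rich V s F v) : Y.card ≤ s := by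
  by_contra hcon
  push Not at hcon
  obtain ⟨Y', hY'Y, hY'c⟩ := exists_subset_card_eq (show s + 1 ≤ Y.card from hcon)
  clear hcon
  replace hYV := hY'Y.trans hYV
  replace hY : ∀ v ∈ Y', Rich V s F v := fun v hv => hY v (hY'Y hv)
  clear hY'Y
  generalize Y' = Y at *
  obtain ⟨e, he1, he2⟩ := exists_index Y
  rw [hY'c] at he1
  choose f hf1 hf2 hf3 using fun j => exists_enum (V j \ Y)
  have hWc : ∀ j, k j * (s + 1) ≤ (V j \ Y).card := by
    intro j
    have h1 : (V j).card ≤ (V j \ Y).card + Y.card := by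
      have := le_card_sdiff Y (V j); omega
    have h2 := hn j
    have h3 := hk j
    have h4 : (k j + 1) * (s + 1) ≤ 4 * k j ^ 2 * s := by
      calc (k j + 1) * (s + 1) ≤ (2 * k j) * (2 * s) := Nat.mul_le_mul (by omega) (by omega)
        _ = 4 * k j * s := by ring
        _ ≤ 4 * k j ^ 2 * s := by gcongr; nlinarith
    rw [hY'c] at h1
    rw [add_mul] at h4
    omega
  let k' : ℕ → ι → ℕ := fun v j => k j - if v ∈ V j then 1 else 0
  have hk' : ∀ v j, k' v j ≤ k j := fun v j => Nat.sub_le _ _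
  let B : ℕ → Finset ℕ := fun v =>
    insert v (univ.biUnion fun j => (range (k' v j)).image (fun r => f j (r * (s + 1) + e v)))
  have hidx : ∀ v ∈ Y, ∀ j, ∀ r < k j, r * (s + 1) + e v < (V j \ Y).card := by
    intro v hv j r hr
    have h1 := he1 v hv
    have h2 := hWc j
    have : (r + 1) * (s + 1) ≤ k j * (s + 1) := Nat.mul_le_mul_right _ hr
    rw [add_mul] at this
    omega
  have hfW : ∀ v ∈ Y, ∀ j, ∀ r < k j, f j (r * (s + 1) + e v) ∈ V j \ Y :=
    fun v hv j r hr => hf1 j _ (hidx v hv j r hr)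
  have hBV : ∀ v ∈ Y, ∀ j, B v ∩ V j = ({v} ∩ V j) ∪
      (range (k' v j)).image (fun r => f j (r * (s + 1) + e v)) := by
    intro v hv j
    ext z
    simp only [B, mem_inter, mem_insert, mem_biUnion, mem_univ, true_and, mem_union,
      mem_singleton, mem_image, mem_range]
    constructor
    · rintro ⟨h | ⟨i, r, hr, h⟩, hz⟩
      · exact Or.inl ⟨h, hz⟩
      · right
        have h1 := hfW v hv i r (hr.trans_le (hk' v i))
        rw [h, mem_sdiff] at h1
        have : i = j := by
          by_contra hij
          exact disjoint_left.1 (hV i j hij) h1.1 hz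
        subst this
        exact ⟨r, hr, h⟩
    · rintro (⟨h, hz⟩ | ⟨r, hr, h⟩)
      · exact ⟨Or.inl h, hz⟩
      · refine ⟨Or.inr ⟨j, r, hr, h⟩, ?_⟩
        have h1 := hfW v hv j r (hr.trans_le (hk' v j))
        rw [h, mem_sdiff] at h1
        exact h1.1
  have himg : ∀ v ∈ Y, ∀ j, ∀ c ≤ k j,
      ((range c).image (fun r => f j (r * (s + 1) + e v))).card = c := by
    intro v hv j c hc
    rw [card_image_of_injOn, card_range]
    intro r hr r' hr' h
    simp only [coe_range, Set.mem_Iio] at hr hr'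
    have := hf2 j _ (hidx v hv j r (by omega)) _ (hidx v hv j r' (by omega)) h
    have h2 : r * (s + 1) = r' * (s + 1) := by omega
    exact Nat.eq_of_mul_eq_mul_right (Nat.succ_pos s) h2
  have hdj : ∀ v ∈ Y, ∀ j, ∀ c ≤ k j, Disjoint ({v} ∩ V j)
      ((range c).image (fun r => f j (r * (s + 1) + e v))) := by
    intro v hv j c hc
    rw [disjoint_left]
    intro z hz hz'
    simp only [mem_inter, mem_singleton] at hz
    simp only [mem_image, mem_range] at hz'
    obtain ⟨r, hr, h⟩ := hz'
    have h1 := hfW v hv j r (by omega)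
    rw [h, mem_sdiff] at h1
    exact h1.2 (hz.1 ▸ hv)
  have hsing : ∀ v j, k' v j + ({v} ∩ V j).card = k j := by
    intro v j
    have := hk j
    by_cases h : v ∈ V j
    · simp only [k', h, if_true, singleton_inter_of_mem, card_singleton]; omega
    · simp only [k', h, if_false, singleton_inter_of_notMem, not_false_eq_true, card_empty]; omega
  have hBU : ∀ v ∈ Y, Uni V k (B v) := by
    intro v hv
    constructor
    · intro z hz
      simp only [B, mem_insert, mem_biUnion, mem_univ, true_and, mem_image, mem_range] at hz
      rcases hz with rfl | ⟨j, r, hr, h⟩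
      · exact hYV hv
      · have h1 := hfW v hv j r (hr.trans_le (hk' v j))
        rw [h, mem_sdiff] at h1
        exact mem_biUnion.2 ⟨j, mem_univ _, h1.1⟩
    · intro j
      rw [hBV v hv j, card_union_of_disjoint (hdj v hv j _ (hk' v j)), himg v hv j _ (hk' v j)]
      have := hsing v j; omega
  have hBF : ∀ v ∈ Y, B v ∈ F := by
    intro v hv
    obtain ⟨A, hA, hvA, hg⟩ := hY v hv
    refine dominate hV hF hsh (hBU v hv) _ A rfl hA ?_
    intro j t
    set c := cnt ((A ∩ V j).erase v) t with hc
    have hcA : cnt (A ∩ V j) t ≤ cnt ({v} ∩ V j) t + c := by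
      rw [hc]; unfold cnt
      refine le_trans (card_le_card ?_) (card_union_le _ _)
      intro z hz
      simp only [mem_filter, mem_inter, mem_union, mem_singleton, mem_erase] at hz ⊢
      by_cases h : z = v
      · left; exact ⟨⟨h, hz.1.2⟩, hz.2⟩
      · right; exact ⟨⟨h, hz.1⟩, hz.2⟩
    have hck : c ≤ k' v j := by
      have h1 : c ≤ ((A ∩ V j).erase v).card := cnt_le_card _ _
      have h2 := (hF A hA).2 j
      by_cases h : v ∈ V j
      · rw [card_erase_of_mem (mem_inter.2 ⟨hvA, h⟩), h2] at h1
        simp only [k', h, if_true]; exact h1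
      · simp only [k', h, if_false]
        exact h1.trans ((card_erase_le).trans (le_of_eq h2))
    refine hcA.trans ?_
    have hsub : filter (fun z => z < t) ({v} ∩ V j) ∪
        (range c).image (fun r => f j (r * (s + 1) + e v)) ⊆
        filter (fun z => z < t) (B v ∩ V j) := by
      intro z hz
      rw [mem_filter, hBV v hv j, mem_union]
      rcases mem_union.1 hz with hz | hz
      · rw [mem_filter] at hz
        exact ⟨Or.inl hz.1, hz.2⟩
      · obtain ⟨r, hr, h⟩ := mem_image.1 hz
        rw [mem_range] at hr
        refine ⟨Or.inr (mem_image.2 ⟨r, mem_range.2 (by omega), h⟩), ?_⟩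
        rw [← h]
        apply hf3
        have hgt := hg j t
        rw [← hc] at hgt
        have hcs : s + c * (s + 1) ≤ cnt ((V j).erase v) t := by
          rcases hgt with h | h
          · omega
          · exact h
        have hle : cnt ((V j).erase v) t ≤ cnt (V j \ Y) t + (Y.erase v).card := by
          unfold cnt
          refine le_trans (card_le_card ?_) (card_union_le _ _)
          intro z hz
          simp only [mem_filter, mem_union, mem_sdiff, mem_erase] at hz ⊢
          by_cases h : z ∈ Y
          · right; exact ⟨hz.1.1, h⟩
          · left; exact ⟨⟨hz.1.2, h⟩, hz.2⟩
        rw [card_erase_of_mem hv, hY'c] at hle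
        have h1 := he1 v hv
        have : (r + 1) * (s + 1) ≤ c * (s + 1) := Nat.mul_le_mul_right _ hr
        rw [add_mul] at this
        omega
    unfold cnt at *
    refine le_trans (le_of_eq ?_) (card_le_card hsub)
    rw [card_union_of_disjoint, himg v hv j c (hck.trans (hk' v j))]
    exact disjoint_of_subset_left (filter_subset _ _) (hdj v hv j c (hck.trans (hk' v j)))
  have hBdis : ∀ u ∈ Y, ∀ v ∈ Y, u ≠ v → Disjoint (B u) (B v) := by
    intro u hu v hv huv
    rw [disjoint_left]
    intro z hzu hzv
    simp only [B, mem_insert, mem_biUnion, mem_univ, true_and, mem_image, mem_range] at hzu hzv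
    rcases hzu with rfl | ⟨j, r, hr, h⟩
    · rcases hzv with h | ⟨j, r, hr, h⟩
      · exact huv h
      · have h1 := hfW v hv j r (hr.trans_le (hk' v j))
        rw [h, mem_sdiff] at h1
        exact h1.2 hu
    · have h1 := hfW u hu j r (hr.trans_le (hk' u j))
      rw [h, mem_sdiff] at h1
      rcases hzv with rfl | ⟨j', r', hr', h'⟩
      · exact h1.2 hv
      · have h2 := hfW v hv j' r' (hr'.trans_le (hk' v j'))
        rw [h', mem_sdiff] at h2
        have : j = j' := by
          by_contra hij
          exact disjoint_left.1 (hV j j' hij) h1.1 h2.1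
        subst this
        have h3 := hf2 j _ (hidx u hu j r (hr.trans_le (hk' u j))) _
          (hidx v hv j r' (hr'.trans_le (hk' v j))) (h.trans h'.symm)
        have h4 : (r * (s + 1) + e u) % (s + 1) = (r' * (s + 1) + e v) % (s + 1) := by rw [h3]
        rw [Nat.mul_add_mod', Nat.mul_add_mod', Nat.mod_eq_of_lt (he1 u hu),
          Nat.mod_eq_of_lt (he1 v hv)] at h4
        exact huv (he2 u hu v hv h4)
  have hBinj : Set.InjOn B Y := by
    intro u hu v hv h
    by_contra huv
    have := hBdis u hu v hv huv
    rw [← h, disjoint_self] at this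
    exact (insert_ne_empty _ _) this
  have := hM (Y.image B) (by
    intro C hC
    obtain ⟨v, hv, rfl⟩ := mem_image.1 hC
    exact hBF v hv) (by
    intro C hC D hD hCD
    obtain ⟨u, hu, rfl⟩ := mem_image.1 (mem_coe.1 hC)
    obtain ⟨v, hv, rfl⟩ := mem_image.1 (mem_coe.1 hD)
    exact hBdis u hu v hv (fun h => hCD (h ▸ rfl)))
  rw [card_image_of_injOn hBinj, hY'c] at this
  omega

/-! counting in products -/

lemma card_le_prod {V : ι → Finset ℕ} {G : Finset (Finset ℕ)} {S : ι → Finset (Finset ℕ)}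
    (hG : ∀ A ∈ G, A ⊆ univ.biUnion V) (hS : ∀ A ∈ G, ∀ l, A ∩ V l ∈ S l) :
    G.card ≤ ∏ l, (S l).card := by
  rw [← Fintype.card_piFinset]
  refine card_le_card_of_injOn (fun A l => A ∩ V l) ?_ ?_
  · intro A hA
    simp only [mem_coe, Fintype.mem_piFinset]
    exact hS A hA
  · intro A hA B hB h
    have key : ∀ C D : Finset ℕ, C ⊆ univ.biUnion V → (∀ l, C ∩ V l = D ∩ V l) → C ⊆ D := by
      intro C D hC hCD z hz
      obtain ⟨l, -, hl⟩ := mem_biUnion.1 (hC hz)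
      have : z ∈ D ∩ V l := hCD l ▸ mem_inter.2 ⟨hz, hl⟩
      exact (mem_inter.1 this).1
    exact Subset.antisymm (key A B (hG A hA) (fun l => congrFun h l))
      (key B A (hG B hB) (fun l => (congrFun h l).symm))

/-- total number of sets in the product, as a real -/
noncomputable def tot (V : ι → Finset ℕ) (k : ι → ℕ) : ℝ := ∏ l, ((V l).card.choose (k l) : ℝ)

noncomputable def rat (V : ι → Finset ℕ) (k : ι → ℕ) (l : ι) : ℝ := (k l : ℝ) / (V l).card

lemma tot_nonneg (V : ι → Finset ℕ) (k : ι → ℕ) : 0 ≤ tot V k :=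
  prod_nonneg fun _ _ => Nat.cast_nonneg _

lemma rat_nonneg (V : ι → Finset ℕ) (k : ι → ℕ) (l : ι) : 0 ≤ rat V k l := by
  unfold rat; positivity

lemma card_le_real {V : ι → Finset ℕ} {k : ι → ℕ} {G : Finset (Finset ℕ)}
    {S : ι → Finset (Finset ℕ)} {i j : ι} {x y : ℝ}
    (hG : ∀ A ∈ G, A ⊆ univ.biUnion V) (hS : ∀ A ∈ G, ∀ l, A ∩ V l ∈ S l)
    (hc : ∀ l, ((S l).card : ℝ) ≤ (if l = i then x else 1) * (if l = j then y else 1) *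
      (V l).card.choose (k l)) : (G.card : ℝ) ≤ x * y * tot V k := by
  have h1 : (G.card : ℝ) ≤ ∏ l, ((S l).card : ℝ) := by exact_mod_cast card_le_prod hG hS
  refine h1.trans ((prod_le_prod (fun _ _ => Nat.cast_nonneg _) (fun l _ => hc l)).trans ?_)
  rw [prod_mul_distrib, prod_mul_distrib]
  simp [tot]

lemma codeg {V : ι → Finset ℕ} {k : ι → ℕ} (hk : ∀ i, 0 < k i)
    (hn : ∀ i, 4 * k i ^ 2 ≤ (V i).card) (hV : Dsj V)
    {F : Finset (Finset ℕ)} (hF : ∀ A ∈ F, Uni V k A) {i j : ι} {u v : ℕ} (hv : v ∈ V i)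
    (hu : u ∈ V j) (huv : u ≠ v) :
    ((F.filter (fun A => v ∈ A ∧ u ∈ A)).card : ℝ) ≤ rat V k i * rat V k j * tot V k := by
  refine card_le_real (i := i) (j := j) (S := fun l => ((V l).powersetCard (k l)).filter
    (fun B => (l = i → v ∈ B) ∧ (l = j → u ∈ B))) ?_ ?_ ?_
  · intro A hA
    exact (hF A (mem_filter.1 hA).1).1
  · intro A hA l
    rw [mem_filter] at hA
    rw [mem_filter, mem_powersetCard]
    refine ⟨⟨inter_subset_right, (hF A hA.1).2 l⟩, ?_, ?_⟩
    · rintro rfl; exact mem_inter.2 ⟨hA.2.1, hv⟩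
    · rintro rfl; exact mem_inter.2 ⟨hA.2.2, hu⟩
  · intro l
    by_cases h1 : l = i
    · subst h1
      by_cases h2 : l = j
      · subst h2
        simp only [if_true, forall_const]
        exact part_b (hk l) (hn l) hv hu huv
      · simp only [h2, if_true, if_false, forall_const, false_imp_iff, and_true, mul_one]
        exact part_a (hk l) hv
    · by_cases h2 : l = j
      · subst h2
        simp only [h1, if_true, if_false, forall_const, false_imp_iff, true_and, one_mul]
        exact part_a (hk l) hu
      · simp [h1, h2]

open Classical in
lemma nonrich {V : ι → Finset ℕ} {k : ι → ℕ} {s : ℕ} (hk : ∀ i, 0 < k i)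
    (hn : ∀ i, 4 * k i ^ 2 ≤ (V i).card) (hV : Dsj V)
    {F : Finset (Finset ℕ)} (hF : ∀ A ∈ F, Uni V k A) {i : ι} {v : ℕ} (hv : v ∈ V i)
    (hr : ¬ Rich V s F v) :
    ((F.filter (fun A => v ∈ A)).card : ℝ) ≤
      ∑ j, rat V k i * (11 / 5 * s * rat V k j) * tot V k := by
  have hsub : F.filter (fun A => v ∈ A) ⊆ univ.biUnion fun j => F.filter (fun A => v ∈ A ∧
      ¬ Good s s ((V j).erase v) ((A ∩ V j).erase v)) := by
    intro A hA
    rw [mem_filter] at hA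
    simp only [mem_biUnion, mem_univ, true_and, mem_filter]
    by_contra hcon
    push Not at hcon
    exact hr ⟨A, hA.1, hA.2, fun j => hcon j hA.1 hA.2⟩
  have h1 : ((F.filter (fun A => v ∈ A)).card : ℝ) ≤ ∑ j, ((F.filter (fun A => v ∈ A ∧
      ¬ Good s s ((V j).erase v) ((A ∩ V j).erase v))).card : ℝ) := by
    exact_mod_cast (card_le_card hsub).trans card_biUnion_le
  refine h1.trans (sum_le_sum fun j _ => ?_)
  refine card_le_real (i := i) (j := j) (S := fun l => ((V l).powersetCard (k l)).filter
    (fun B => (l = i → v ∈ B) ∧ (l = j → ¬ Good s s ((V l).erase v) (B.erase v)))) ?_ ?_ ?_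
  · intro A hA
    exact (hF A (mem_filter.1 hA).1).1
  · intro A hA l
    rw [mem_filter] at hA
    rw [mem_filter, mem_powersetCard]
    refine ⟨⟨inter_subset_right, (hF A hA.1).2 l⟩, ?_, ?_⟩
    · rintro rfl; exact mem_inter.2 ⟨hA.2.1, hv⟩
    · rintro rfl; exact hA.2.2
  · intro l
    by_cases h1 : l = i
    · subst h1
      by_cases h2 : l = j
      · subst h2
        simp only [if_true, forall_const]
        exact part_c (hk l) (hn l) hv
      · simp only [h2, if_true, if_false, forall_const, false_imp_iff, and_true, mul_one]
        exact part_a (hk l) hv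
    · by_cases h2 : l = j
      · subst h2
        simp only [h1, if_true, if_false, forall_const, false_imp_iff, true_and, one_mul]
        have hvl : v ∉ V l := disjoint_left.1 (hV i l (Ne.symm h1)) hv
        refine le_trans ?_ (part_d (s := s) (hk l) (hn l))
        have : (filter (fun B => ¬ Good s s ((V l).erase v) (B.erase v))
            ((V l).powersetCard (k l))) ⊆
            filter (fun B => ¬ Good s s (V l) B) ((V l).powersetCard (k l)) := by
          intro B hB
          rw [mem_filter] at hB ⊢
          refine ⟨hB.1, ?_⟩
          have hvB : v ∉ B := fun h => hvl ((mem_powersetCard.1 hB.1).1 h)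
          have := hB.2
          rwa [erase_eq_of_notMem hvl, erase_eq_of_notMem hvB] at this
        exact_mod_cast card_le_card this
      · simp [h1, h2]

/-- summing over a small cover -/
lemma cover_sum {V : ι → Finset ℕ} {k : ι → ℕ} {s : ℕ} (hs : 0 < s) (hk : ∀ i, 0 < k i)
    (hl : 0 < Fintype.card ι)
    (hn : ∀ i, 4 * Fintype.card ι ^ 2 * k i ^ 2 * s ≤ (V i).card)
    {U : Finset ℕ} (hU : U ⊆ univ.biUnion V) (hUc : ∀ j, (U ∩ V j).card ≤ s * k j)
    (g : ℕ → ℝ) (t : ℝ) (ht : 0 ≤ t) (hg : ∀ j, ∀ v ∈ U, v ∈ V j → g v ≤ t * rat V k j) :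
    ∑ v ∈ U, g v ≤ t / (4 * Fintype.card ι) := by
  have h1 : ∀ v ∈ U, g v ≤ ∑ j, if v ∈ V j then t * rat V k j else 0 := by
    intro v hv
    obtain ⟨j, -, hj⟩ := mem_biUnion.1 (hU hv)
    refine (hg j v hv hj).trans ?_
    have := single_le_sum (f := fun j => if v ∈ V j then t * rat V k j else 0) (s := univ)
      (fun l _ => by
        have := rat_nonneg V k l
        by_cases h : v ∈ V l <;> simp [h]; positivity) (mem_univ j)
    simpa [hj] using this
  refine (sum_le_sum h1).trans ?_
  rw [sum_comm]
  have hl' : (0 : ℝ) < Fintype.card ι := by exact_mod_cast hl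
  have h2 : ∀ j, ∑ v ∈ U, (if v ∈ V j then t * rat V k j else 0) ≤
      t / (4 * (Fintype.card ι : ℝ) ^ 2) := by
    intro j
    rw [← sum_filter, sum_const, nsmul_eq_mul, filter_mem_eq_inter]
    have hr := rat_nonneg V k j
    have h3 : ((U ∩ V j).card : ℝ) ≤ s * k j := by exact_mod_cast hUc j
    calc ((U ∩ V j).card : ℝ) * (t * rat V k j) ≤ (s * k j) * (t * rat V k j) := by gcongr
      _ = t * (s * k j * rat V k j) := by ring
      _ ≤ t * (1 / (4 * (Fintype.card ι : ℝ) ^ 2)) := by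
        gcongr
        have h4 : (4 * (Fintype.card ι : ℝ) ^ 2 * k j ^ 2 * s) ≤ (V j).card := by
          exact_mod_cast hn j
        have hkj : (0:ℝ) < k j := by exact_mod_cast hk j
        have hs' : (0:ℝ) < s := by exact_mod_cast hs
        have h5 : (0:ℝ) < (V j).card := lt_of_lt_of_le (by positivity) h4
        unfold rat
        rw [← mul_div_assoc, div_le_div_iff₀ h5 (by positivity)]
        linarith
      _ = _ := by ring
  refine (sum_le_sum fun j _ => h2 j).trans (le_of_eq ?_)
  rw [sum_const, nsmul_eq_mul, card_univ]
  field_simp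

lemma union_card {V : ι → Finset ℕ} {k : ι → ℕ} {s : ℕ}
    {M : Finset (Finset ℕ)} (hM : ∀ A ∈ M, Uni V k A) (hMs : M.card ≤ s) (j : ι) :
    (M.biUnion id ∩ V j).card ≤ s * k j := by
  rw [biUnion_inter]
  refine (card_biUnion_le_card_mul M (fun A => id A ∩ V j) (k j) ?_).trans
    (Nat.mul_le_mul_right _ hMs)
  intro A hA
  exact ((hM A hA).2 j).le

lemma union_sub {V : ι → Finset ℕ} {k : ι → ℕ}
    {M : Finset (Finset ℕ)} (hM : ∀ A ∈ M, Uni V k A) : M.biUnion id ⊆ univ.biUnion V := by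
  rw [biUnion_subset]
  intro A hA
  exact (hM A hA).1

lemma pairwise_insert {M : Finset (Finset ℕ)} {A : Finset ℕ}
    (hM : (↑M : Set (Finset ℕ)).Pairwise Disjoint) (hA : Disjoint A (M.biUnion id)) :
    (↑(insert A M) : Set (Finset ℕ)).Pairwise Disjoint := by
  have hA' : ∀ B ∈ M, Disjoint A B := fun B hB =>
    disjoint_of_subset_right (subset_biUnion_of_mem id hB) hA
  rw [coe_insert]
  refine hM.insert ?_
  intro B hB _
  exact ⟨hA' B hB, (hA' B hB).symm⟩

open Classical in
lemma low_case {V : ι → Finset ℕ} {k : ι → ℕ} {s : ℕ} (hs : 0 < s) (hk : ∀ i, 0 < k i)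
    (hl : 0 < Fintype.card ι)
    (hn : ∀ i, 4 * Fintype.card ι ^ 2 * k i ^ 2 * s ≤ (V i).card) (hV : Dsj V)
    {F : Finset (Finset ℕ)} (hF : ∀ A ∈ F, Uni V k A) (hM : Mat s F) (hsh : Shifted V F)
    (p : ℝ) (hp : ∀ i, rat V k i ≤ p)
    (hlow : ∀ i, ∀ v ∈ V i, ((F.filter (fun A => v ∈ A)).card : ℝ) ≤
      rat V k i * tot V k / (4 * Fintype.card ι)) :
    (F.card : ℝ) ≤ 4 / 5 * (s * p) * tot V k := by
  have hn1 : ∀ i, 4 * k i ^ 2 * s ≤ (V i).card := by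
    intro i
    refine le_trans ?_ (hn i)
    have : 1 ≤ Fintype.card ι ^ 2 := Nat.one_le_pow _ _ hl
    nlinarith [Nat.zero_le (k i ^ 2 * s)]
  have hn2 : ∀ i, 4 * k i ^ 2 ≤ (V i).card := fun i =>
    le_trans (Nat.le_mul_of_pos_right _ hs) (hn1 i)
  obtain ⟨i₀⟩ := Fintype.card_pos_iff.1 hl
  have hp0 : 0 ≤ p := (rat_nonneg V k i₀).trans (hp i₀)
  have hP := tot_nonneg V k
  have hl' : (0 : ℝ) < Fintype.card ι := by exact_mod_cast hl
  have hl1 : (1 : ℝ) ≤ Fintype.card ι := by exact_mod_cast hl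
  -- maximal matching
  obtain ⟨M, hMmem, hMmax⟩ := exists_max_image
    (F.powerset.filter (fun M : Finset (Finset ℕ) => (↑M : Set (Finset ℕ)).Pairwise Disjoint)) card
    ⟨∅, by simp⟩
  rw [mem_filter, mem_powerset] at hMmem
  have hMc := hM M hMmem.1 hMmem.2
  have hMU : ∀ A ∈ M, Uni V k A := fun A hA => hF A (hMmem.1 hA)
  set U := M.biUnion id with hUdef
  have hUV := union_sub hMU
  have hUc := union_card hMU hMc
  have hcov : F ⊆ U.biUnion (fun v => F.filter (fun A => v ∈ A)) := by
    intro A hA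
    simp only [mem_biUnion, mem_filter]
    by_contra hcon
    push Not at hcon
    have hdis : Disjoint A U := disjoint_left.2 fun z hz hzU => hcon z hzU hA hz
    have hAM : A ∉ M := by
      intro h
      have hne : A.Nonempty := by
        have := (hF A hA).2 i₀
        have h2 := hk i₀
        rw [← this, card_pos] at h2
        exact h2.mono inter_subset_left
      obtain ⟨z, hz⟩ := hne
      exact hcon z (mem_biUnion.2 ⟨A, h, hz⟩) hA hz
    have := hMmax (insert A M) (by
      rw [mem_filter, mem_powerset]
      exact ⟨insert_subset hA hMmem.1, pairwise_insert hMmem.2 hdis⟩)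
    rw [card_insert_of_notMem hAM] at this
    omega
  have h1 : (F.card : ℝ) ≤ ∑ v ∈ U, ((F.filter (fun A => v ∈ A)).card : ℝ) := by
    exact_mod_cast (card_le_card hcov).trans card_biUnion_le
  set R : ℝ := p * tot V k / (4 * Fintype.card ι) with hR
  have hR0 : 0 ≤ R := by positivity
  have hrich : (((U.filter (fun v => Rich V s F v)).card : ℕ) : ℝ) ≤ s := by
    exact_mod_cast rich_card hs hk hn1 hV hF hM hsh (U.filter (fun v => Rich V s F v))
      ((filter_subset _ _).trans hUV) (fun v hv => (mem_filter.1 hv).2)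
  have h2 := cover_sum hs hk hl hn hUV hUc
    (fun v => ((F.filter (fun A => v ∈ A)).card : ℝ) - if Rich V s F v then R else 0)
    (11 / 5 * s * (Fintype.card ι * p) * tot V k) (by positivity) (by
      intro j v hv hvj
      have hr := rat_nonneg V k j
      by_cases h : Rich V s F v
      · simp only [h, if_true]
        have h3 := hlow j v hvj
        have h4 : rat V k j * tot V k / (4 * Fintype.card ι) ≤ R := by
          rw [hR]; gcongr; exact hp j
        have : 0 ≤ (11 / 5 * s * (Fintype.card ι * p) * tot V k) * rat V k j := by positivity
        linarith
      · simp only [h, if_false, sub_zero]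
        refine (nonrich hk hn2 hV hF hvj h).trans ?_
        have : ∀ l ∈ univ, rat V k j * (11 / 5 * s * rat V k l) * tot V k ≤
            rat V k j * (11 / 5 * s * p) * tot V k := by
          intro l _
          gcongr
          exact hp l
        refine (sum_le_sum this).trans (le_of_eq ?_)
        rw [sum_const, nsmul_eq_mul, card_univ]
        ring)
  rw [sum_sub_distrib, ← sum_filter, sum_const, nsmul_eq_mul] at h2
  have h5 : (11 / 5 * s * (Fintype.card ι * p) * tot V k) / (4 * Fintype.card ι) =
      11 / 20 * (s * p) * tot V k := by
    rw [div_eq_iff (by positivity)]; ring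
  rw [h5] at h2
  have h6 : ((U.filter (fun v => Rich V s F v)).card : ℝ) * R ≤ s * R := by gcongr
  have h7 : s * R ≤ 1 / 4 * (s * p) * tot V k := by
    rw [hR]
    have : p * tot V k / (4 * Fintype.card ι) ≤ p * tot V k / 4 := by
      apply div_le_div_of_nonneg_left (by positivity) (by norm_num)
      linarith
    calc s * (p * tot V k / (4 * Fintype.card ι)) ≤ s * (p * tot V k / 4) := by gcongr
      _ = _ := by ring
  linarith

lemma choose_shift (n k : ℕ) (hk : 0 < k) (s : ℕ) :
    (n - s).choose k * (n + s * k) ≤ n * n.choose k := by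
  induction s with
  | zero => simp [mul_comm]
  | succ s ih =>
    refine le_trans ?_ ih
    rcases Nat.eq_zero_or_pos (n - s) with h | h
    · rw [show n - (s + 1) = 0 by omega, Nat.choose_eq_zero_of_lt hk]; simp
    · obtain ⟨m, hm⟩ : ∃ m, n - s = m + 1 := ⟨n - s - 1, by omega⟩
      rw [show n - (s + 1) = m by omega, hm]
      rcases Nat.lt_or_ge m k with hmk | hmk
      · rw [Nat.choose_eq_zero_of_lt hmk]; simp
      · have h1 := Nat.choose_mul_succ_eq m k
        obtain ⟨d, rfl⟩ := Nat.exists_eq_add_of_le hmk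
        rw [show k + d + 1 - k = d + 1 by omega] at h1
        have h2 : k + d + 1 ≤ n := by omega
        have h3 : (d + 1) * (n + (s + 1) * k) ≤ (k + d + 1) * (n + s * k) := by
          have h5 : (d + 1) * k ≤ n * k := Nat.mul_le_mul_right _ (by omega)
          nlinarith [Nat.zero_le (k * s * k)]
        have h4 : (k + d).choose k * (n + (s + 1) * k) * ((k + d + 1) * (d + 1)) ≤
            (k + d + 1).choose k * (n + s * k) * ((k + d + 1) * (d + 1)) := by
          calc (k + d).choose k * (n + (s + 1) * k) * ((k + d + 1) * (d + 1))
              = ((k + d).choose k * (k + d + 1)) * ((d + 1) * (n + (s + 1) * k)) := by ring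
            _ ≤ ((k + d).choose k * (k + d + 1)) * ((k + d + 1) * (n + s * k)) := by gcongr
            _ = _ := by rw [h1]; ring
        exact Nat.le_of_mul_le_mul_right h4 (by positivity)

open Classical in
theorem core (k : ι → ℕ) (hk : ∀ i, 0 < k i) (hl : 0 < Fintype.card ι) : ∀ (s : ℕ)
    (V : ι → Finset ℕ) (F : Finset (Finset ℕ)), Dsj V →
    (∀ i, 4 * Fintype.card ι ^ 2 * k i ^ 2 * s ≤ (V i).card) →
    (∀ A ∈ F, Uni V k A) → Mat s F →
    ∃ x : ι → ℕ, ∑ i, x i = s ∧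
      F.card + ∏ i, ((V i).card - x i).choose (k i) ≤ ∏ i, (V i).card.choose (k i) := by
  intro s
  induction s with
  | zero =>
    intro V F hV hn hF hM
    refine ⟨fun _ => 0, by simp, ?_⟩
    have : F = ∅ := by
      by_contra hne
      obtain ⟨A, hA⟩ := nonempty_iff_ne_empty.2 hne
      have := hM {A} (by simpa using hA) (by simp)
      simp at this
    simp [this]
  | succ s ih =>
    intro V F₀ hV hn hF₀ hM₀
    obtain ⟨F, hF, hM, hc, hsh⟩ := exists_shifted hV _ F₀ rfl hF₀ hM₀
    rw [← hc]
    clear hc hF₀ hM₀ F₀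
    have hn2 : ∀ i, 4 * k i ^ 2 ≤ (V i).card := by
      intro i
      refine le_trans ?_ (hn i)
      have : 1 ≤ Fintype.card ι ^ 2 := Nat.one_le_pow _ _ hl
      calc 4 * k i ^ 2 = 4 * 1 * k i ^ 2 * 1 := by ring
        _ ≤ 4 * Fintype.card ι ^ 2 * k i ^ 2 * (s + 1) := by gcongr; omega
    by_cases hlow : ∀ i, ∀ v ∈ V i, ((F.filter (fun A => v ∈ A)).card : ℝ) ≤
      rat V k i * tot V k / (4 * Fintype.card ι)
    · have : Nonempty ι := Fintype.card_pos_iff.1 hl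
      obtain ⟨i₀, hi₀⟩ := Finite.exists_max (rat V k)
      have h1 := low_case (Nat.succ_pos s) hk hl hn hV hF hM hsh (rat V k i₀) hi₀ hlow
      refine ⟨fun i => if i = i₀ then s + 1 else 0, by simp, ?_⟩
      have h2 := choose_shift (V i₀).card (k i₀) (hk i₀) (s + 1)
      have hk0 : (0:ℝ) < k i₀ := by exact_mod_cast hk i₀
      have hV0 : (0:ℝ) < (V i₀).card := by
        have := hn2 i₀
        have h3 : 0 < k i₀ ^ 2 := pow_pos (hk i₀) 2
        exact_mod_cast (by omega : 0 < (V i₀).card)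
      have h3 : (((V i₀).card - (s + 1)).choose (k i₀) : ℝ) * (1 + (s + 1) * rat V k i₀) ≤
          (V i₀).card.choose (k i₀) := by
        have : (((V i₀).card - (s + 1)).choose (k i₀) : ℝ) * ((V i₀).card + (s + 1) * k i₀) ≤
          (V i₀).card * (V i₀).card.choose (k i₀) := by exact_mod_cast h2
        have e : (1 + (s + 1) * rat V k i₀ : ℝ) =
          ((V i₀).card + (s + 1) * k i₀) / (V i₀).card := by
          unfold rat; field_simp
        rw [e, ← mul_div_assoc, div_le_iff₀ hV0]
        linarith
      have hq : ((s + 1 : ℝ)) * rat V k i₀ ≤ 1 / 4 := by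
        have h4 : (4 * Fintype.card ι ^ 2 * k i₀ ^ 2 * (s + 1) : ℝ) ≤ (V i₀).card := by
          exact_mod_cast hn i₀
        have h5 : (4 * k i₀ * (s + 1) : ℝ) ≤ 4 * Fintype.card ι ^ 2 * k i₀ ^ 2 * (s + 1) := by
          have a1 : (1:ℝ) ≤ (Fintype.card ι : ℝ) ^ 2 := one_le_pow₀ (by exact_mod_cast hl)
          have a2 : (1:ℝ) ≤ k i₀ := by exact_mod_cast hk i₀
          have a3 : (k i₀ : ℝ) ≤ Fintype.card ι ^ 2 * k i₀ ^ 2 := by nlinarith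
          have : (0:ℝ) ≤ s := Nat.cast_nonneg _
          nlinarith
        unfold rat
        rw [← mul_div_assoc, div_le_iff₀ hV0]
        linarith
      have hq0 := rat_nonneg V k i₀
      set q := rat V k i₀ with hqdef
      have hT := tot_nonneg V k
      set R : ℝ := ∏ l ∈ univ.erase i₀, ((V l).card.choose (k l) : ℝ) with hRdef
      have hR0 : 0 ≤ R := prod_nonneg fun _ _ => Nat.cast_nonneg _
      have e1 : tot V k = (V i₀).card.choose (k i₀) * R := by
        unfold tot; rw [← mul_prod_erase univ _ (mem_univ i₀)]
      have e2 : (∏ i, (((V i).card - if i = i₀ then s + 1 else 0).choose (k i) : ℝ)) =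
          ((V i₀).card - (s + 1)).choose (k i₀) * R := by
        rw [← mul_prod_erase univ _ (mem_univ i₀)]
        simp only [if_true]
        congr 1
        apply prod_congr rfl
        intro l hl
        simp [(mem_erase.1 hl).1]
      have goal : (F.card : ℝ) +
          (∏ i, (((V i).card - if i = i₀ then s + 1 else 0).choose (k i) : ℝ)) ≤ tot V k := by
        rw [e2]
        have h4 : ((V i₀).card - (s + 1)).choose (k i₀) * R * (1 + (s + 1) * q) ≤ tot V k := by
          rw [e1]
          calc _ = (((V i₀).card - (s + 1)).choose (k i₀) : ℝ) * (1 + (s + 1) * q) * R := by ring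
            _ ≤ _ := by gcongr
        set X : ℝ := ((V i₀).card - (s + 1)).choose (k i₀) * R with hX
        push_cast at h1
        set y : ℝ := (s + 1) * q with hy
        have hy0 : 0 ≤ y := by positivity
        have h5 : X ≤ tot V k * (1 - 4 / 5 * y) := by
          have h6 : X * (1 + y) ≤ tot V k * (1 - 4 / 5 * y) * (1 + y) := by
            refine h4.trans ?_
            have : 0 ≤ tot V k * (y * (1 / 5 - 4 / 5 * y)) := by
              apply mul_nonneg hT (mul_nonneg hy0 (by linarith))
            nlinarith
          exact le_of_mul_le_mul_right h6 (by linarith)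
        nlinarith
      unfold tot at goal
      exact_mod_cast goal
    · push Not at hlow
      obtain ⟨i, v, hv, hdeg⟩ := hlow
      have hMat : Mat s (F.filter (fun A => v ∉ A)) := by
        intro M hMF hdis
        by_contra hcon
        push Not at hcon
        have hMF' : M ⊆ F := hMF.trans (filter_subset _ _)
        have hMc := hM M hMF' hdis
        have hMU : ∀ A ∈ M, Uni V k A := fun A hA => hF A (hMF' hA)
        have hvU : v ∉ M.biUnion id := by
          simp only [mem_biUnion, id, not_exists, not_and]
          intro A hA
          exact (mem_filter.1 (hMF hA)).2
        have hex : ∃ A ∈ F, v ∈ A ∧ Disjoint A (M.biUnion id) := by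
          by_contra hno
          push Not at hno
          have hsub : F.filter (fun A => v ∈ A) ⊆
              (M.biUnion id).biUnion (fun u => F.filter (fun A => v ∈ A ∧ u ∈ A)) := by
            intro A hA
            rw [mem_filter] at hA
            have := hno A hA.1 hA.2
            rw [not_disjoint_iff] at this
            obtain ⟨u, huA, huU⟩ := this
            exact mem_biUnion.2 ⟨u, huU, mem_filter.2 ⟨hA.1, hA.2, huA⟩⟩
          have h1 : ((F.filter (fun A => v ∈ A)).card : ℝ) ≤
              ∑ u ∈ M.biUnion id, ((F.filter (fun A => v ∈ A ∧ u ∈ A)).card : ℝ) := by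
            exact_mod_cast (card_le_card hsub).trans card_biUnion_le
          have h2 := cover_sum (Nat.succ_pos s) hk hl hn (union_sub hMU) (union_card hMU hMc)
            (fun u => ((F.filter (fun A => v ∈ A ∧ u ∈ A)).card : ℝ)) (rat V k i * tot V k)
            (mul_nonneg (rat_nonneg V k i) (tot_nonneg V k)) (by
              intro j u hu huj
              have huv : u ≠ v := by rintro rfl; exact hvU hu
              have := codeg hk hn2 hV hF hv huj huv
              linarith)
          linarith
        obtain ⟨A, hA, hvA, hAd⟩ := hex
        have hAM : A ∉ M := fun h => (mem_filter.1 (hMF h)).2 hvA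
        have := hM (insert A M) (insert_subset hA hMF') (pairwise_insert hdis hAd)
        rw [card_insert_of_notMem hAM] at this
        omega
      let V' : ι → Finset ℕ := fun j => (V j).erase v
      have hV'c : ∀ j, (V' j).card = (V j).card - if j = i then 1 else 0 := by
        intro j
        by_cases h : j = i
        · subst h; simp [V', card_erase_of_mem hv]
        · have : v ∉ V j := disjoint_left.1 (hV i j (Ne.symm h)) hv
          simp [V', h, erase_eq_of_notMem this]
      obtain ⟨x, hx, hxc⟩ := ih V' (F.filter (fun A => v ∉ A))
        (fun a b hab => disjoint_of_subset_left (erase_subset _ _)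
          (disjoint_of_subset_right (erase_subset _ _) (hV a b hab)))
        (by
          intro j
          have h1 := hn j
          have h2 : 1 ≤ 4 * Fintype.card ι ^ 2 * k j ^ 2 := by
            have := pow_pos (hk j) 2
            have := pow_pos hl 2
            exact Nat.succ_le_of_lt (by positivity)
          rw [mul_add, mul_one] at h1
          rw [hV'c]
          split_ifs <;> omega)
        (by
          intro A hA
          rw [mem_filter] at hA
          constructor
          · intro z hz
            obtain ⟨j, -, hj⟩ := mem_biUnion.1 ((hF A hA.1).1 hz)
            exact mem_biUnion.2 ⟨j, mem_univ _, mem_erase.2 ⟨fun h => hA.2 (h ▸ hz), hj⟩⟩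
          · intro j
            rw [← (hF A hA.1).2 j]
            congr 1
            ext z
            simp only [V', mem_inter, mem_erase]
            constructor
            · rintro ⟨h1, h2, h3⟩; exact ⟨h1, h3⟩
            · rintro ⟨h1, h2⟩; exact ⟨h1, fun h => hA.2 (h ▸ h1), h2⟩) hMat
      refine ⟨fun j => x j + if j = i then 1 else 0, by simp [sum_add_distrib, hx], ?_⟩
      have e1 : ∏ j, ((V j).card - (x j + if j = i then 1 else 0)).choose (k j) =
          ∏ j, ((V' j).card - x j).choose (k j) := by
        apply prod_congr rfl
        intro j _
        rw [hV'c]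
        congr 1
        omega
      rw [e1]
      have hsplit : F.card = (F.filter (fun A => v ∈ A)).card +
          (F.filter (fun A => v ∉ A)).card := (card_filter_add_card_filter_not _).symm
      have hd : (F.filter (fun A => v ∈ A)).card + ∏ j, (V' j).card.choose (k j) ≤
          ∏ j, (V j).card.choose (k j) := by
        have h1 := card_le_prod (V := V) (G := F.filter (fun A => v ∈ A))
          (S := fun l => ((V l).powersetCard (k l)).filter (fun B => l = i → v ∈ B))
          (fun A hA => (hF A (mem_filter.1 hA).1).1) (by
            intro A hA l
            rw [mem_filter] at hA
            rw [mem_filter, mem_powersetCard]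
            refine ⟨⟨inter_subset_right, (hF A hA.1).2 l⟩, ?_⟩
            rintro rfl; exact mem_inter.2 ⟨hA.2, hv⟩)
        rw [← mul_prod_erase univ _ (mem_univ i)] at h1 ⊢
        rw [← mul_prod_erase univ (fun j => (V j).card.choose (k j)) (mem_univ i)]
        have e2 : ∏ l ∈ univ.erase i, (((V l).powersetCard (k l)).filter
            (fun B => l = i → v ∈ B)).card = ∏ l ∈ univ.erase i, (V l).card.choose (k l) := by
          apply prod_congr rfl
          intro l hl
          simp [(mem_erase.1 hl).1]
        have e3 : ∏ l ∈ univ.erase i, (V' l).card.choose (k l) =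
            ∏ l ∈ univ.erase i, (V l).card.choose (k l) := by
          apply prod_congr rfl
          intro l hl
          rw [hV'c]
          simp [(mem_erase.1 hl).1]
        rw [e2] at h1
        rw [e3, hV'c]
        simp only [if_true, forall_const] at h1 ⊢
        have h2 := card_mem (k := k i) hv (fun _ => True)
        simp only [and_true, filter_true, card_powersetCard, card_erase_of_mem hv] at h2
        have h3 : (V i).card.choose (k i) =
            ((V i).card - 1).choose (k i - 1) + ((V i).card - 1).choose (k i) := by
          have hc0 : 0 < (V i).card := card_pos.2 ⟨v, hv⟩
          obtain ⟨m, hm⟩ := Nat.exists_eq_succ_of_ne_zero hc0.ne'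
          obtain ⟨r, hr⟩ := Nat.exists_eq_succ_of_ne_zero (hk i).ne'
          rw [hm, hr]
          exact Nat.choose_succ_succ' m r
        rw [h3, add_mul]
        exact Nat.add_le_add_right (h1.trans (Nat.mul_le_mul_right _ h2)) _
      omega

end EMP

theorem stmt3 {α : Type*} [DecidableEq α] (ℓ s : ℕ) (hl : 0 < ℓ) (hs : 0 < s)
    (n k : Fin ℓ → ℕ) (hk : ∀ i, 0 < k i)
    (hn : ∀ i, 4 * ℓ ^ 2 * (k i) ^ 2 * s ≤ n i)
    (V : Fin ℓ → Finset α)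
    (hV : ∀ i j, i ≠ j → Disjoint (V i) (V j))
    (hVcard : ∀ i, (V i).card = n i)
    (F : Finset (Finset α))
    (hF : ∀ A ∈ F, A ⊆ Finset.univ.biUnion V ∧ ∀ i, (A ∩ V i).card = k i)
    (hmatch : ∀ M : Finset (Finset α), M ⊆ F →
      (↑M : Set (Finset α)).Pairwise Disjoint → M.card ≤ s) :
    F.card ≤ ∏ i, (n i).choose (k i)
      - sInf {v : ℕ | ∃ x : Fin ℓ → ℕ, (∑ i, x i = s) ∧
          v = ∏ i, (n i - x i).choose (k i)} := by
  classical
  set U := Finset.univ.biUnion V with hU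
  have hVU : ∀ i, V i ⊆ U := fun i => Finset.subset_biUnion_of_mem V (Finset.mem_univ i)
  obtain ⟨φ, hφ⟩ : ∃ φ : α → ℕ, Set.InjOn φ (U : Set α) := by
    refine ⟨fun a => if h : a ∈ U then (U.equivFin ⟨a, h⟩ : ℕ) else 0, ?_⟩
    intro a ha b hb h
    rw [Finset.mem_coe] at ha hb
    simp only [ha, hb, dif_pos] at h
    have := U.equivFin.injective (Fin.ext h)
    exact congrArg Subtype.val this
  have himg : ∀ A B : Finset α, A ⊆ U → B ⊆ U → A.image φ ⊆ B.image φ → A ⊆ B := by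
    intro A B hA hB h z hz
    obtain ⟨w, hw, hwz⟩ := Finset.mem_image.1 (h (Finset.mem_image_of_mem φ hz))
    have := hφ (Finset.mem_coe.2 (hB hw)) (Finset.mem_coe.2 (hA hz)) hwz
    exact this ▸ hw
  have himg' : ∀ A B : Finset α, A ⊆ U → B ⊆ U → A.image φ = B.image φ → A = B :=
    fun A B hA hB h => Finset.Subset.antisymm (himg A B hA hB h.subset)
      (himg B A hB hA h.symm.subset)
  have hcardφ : ∀ A : Finset α, A ⊆ U → (A.image φ).card = A.card := fun A hA =>
    Finset.card_image_of_injOn (hφ.mono (Finset.coe_subset.2 hA))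
  have hinter : ∀ A B : Finset α, A ⊆ U → B ⊆ U → A.image φ ∩ B.image φ = (A ∩ B).image φ := by
    intro A B hA hB
    refine (Finset.image_inter_of_injOn A B (hφ.mono ?_)).symm
    intro z hz
    rcases hz with hz | hz
    · exact hA hz
    · exact hB hz
  have hdisj : ∀ A B : Finset α, A ⊆ U → B ⊆ U → (Disjoint (A.image φ) (B.image φ) ↔
      Disjoint A B) := by
    intro A B hA hB
    rw [Finset.disjoint_iff_inter_eq_empty, hinter A B hA hB, Finset.image_eq_empty,
      Finset.disjoint_iff_inter_eq_empty]
  obtain ⟨x, hx, hxc⟩ := EMP.core k hk (by simpa using hl) s (fun i => (V i).image φ)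
    (F.image (fun A => A.image φ))
    (fun i j hij => (hdisj _ _ (hVU i) (hVU j)).2 (hV i j hij))
    (by
      intro i
      rw [hcardφ _ (hVU i), hVcard, Fintype.card_fin]
      exact hn i)
    (by
      intro A' hA'
      obtain ⟨A, hA, rfl⟩ := Finset.mem_image.1 hA'
      refine ⟨?_, ?_⟩
      · intro z hz
        obtain ⟨a, ha, rfl⟩ := Finset.mem_image.1 hz
        obtain ⟨i, -, hi⟩ := Finset.mem_biUnion.1 ((hF A hA).1 ha)
        exact Finset.mem_biUnion.2 ⟨i, Finset.mem_univ _, Finset.mem_image_of_mem φ hi⟩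
      · intro i
        rw [hinter A _ (hF A hA).1 (hVU i),
          hcardφ _ (Finset.inter_subset_left.trans (hF A hA).1)]
        exact (hF A hA).2 i)
    (by
      intro M' hM' hd
      have h1 := hmatch (F.filter (fun A => A.image φ ∈ M')) (Finset.filter_subset _ _) (by
        intro A hA B hB hAB
        rw [Finset.mem_coe, Finset.mem_filter] at hA hB
        rw [← hdisj A B (hF A hA.1).1 (hF B hB.1).1]
        exact hd hA.2 hB.2 (fun h => hAB (himg' A B (hF A hA.1).1 (hF B hB.1).1 h)))
      refine le_trans ?_ h1
      refine le_trans (Finset.card_le_card ?_) (Finset.card_image_le (f := fun A => A.image φ))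
      intro C hC
      obtain ⟨A, hA, rfl⟩ := Finset.mem_image.1 (hM' hC)
      exact Finset.mem_image.2 ⟨A, Finset.mem_filter.2 ⟨hA, hC⟩, rfl⟩)
  have hFc : (F.image (fun A => A.image φ)).card = F.card :=
    Finset.card_image_of_injOn (fun A hA B hB h => himg' A B (hF A hA).1 (hF B hB).1 h)
  have hVc : ∀ i, ((V i).image φ).card = n i := fun i => by rw [hcardφ _ (hVU i), hVcard]
  simp only [hFc, hVc] at hxc
  have hinf : sInf {v : ℕ | ∃ x : Fin ℓ → ℕ, (∑ i, x i = s) ∧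
          v = ∏ i, (n i - x i).choose (k i)} ≤ ∏ i, (n i - x i).choose (k i) :=
    Nat.sInf_le ⟨x, hx, rfl⟩
  omega
end

section
/- Let $\ell, s, n_1, \dots, n_\ell, k_1, \dots, k_\ell$ be positive integers with $\ell \geq 2$ and $3s \leq n_1/k_1 \leq \dots \leq n_\ell/k_\ell$. Let $\mathcal{F}_1, \dots, \mathcal{F}_s \subseteq \sqcup_{i=1}^\ell \binom{V_i}{k_i}$ with $|V_i| = n_i$. If $\mathcal{F}_1, \dots, \mathcal{F}_s$ are rainbow matching free, then there exists $t \in [s]$ such that $|\mathcal{F}_t| < \frac{6sk_1}{n_1} \prod_{j=1}^\ell \binom{n_j}{k_j}$. -/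
namespace RM
open Finset

section kneser
set_option linter.unusedSectionVars false
variable {V : Type} [Fintype V] [DecidableEq V]

def up (f : Finset V → ℝ) (C : Finset V) : ℝ := ∑ c ∈ C, f (C.erase c)
def dn (f : Finset V → ℝ) (E : Finset V) : ℝ := ∑ v ∈ Eᶜ, f (insert v E)
def ip (j : ℕ) (f g : Finset V → ℝ) : ℝ := ∑ A ∈ powersetCard j (univ : Finset V), f A * g A

lemma adj (j : ℕ) (f g : Finset V → ℝ) : ip (j+1) (up f) g = ip j f (dn g) := by
  unfold ip up dn
  simp only [Finset.sum_mul, Finset.mul_sum]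
  rw [Finset.sum_sigma', Finset.sum_sigma']
  refine Finset.sum_bij' (fun p _ => ⟨p.1.erase p.2, p.2⟩) (fun p _ => ⟨insert p.2 p.1, p.2⟩)
    ?_ ?_ ?_ ?_ ?_
  · rintro ⟨C, c⟩ h
    simp only [mem_sigma, mem_powersetCard, subset_univ, true_and] at h
    simp [mem_sigma, mem_powersetCard, card_erase_of_mem h.2, h.1]
  · rintro ⟨C, c⟩ h
    simp only [mem_sigma, mem_powersetCard, subset_univ, true_and, mem_compl] at h
    simp [mem_sigma, mem_powersetCard, card_insert_of_notMem h.2, h.1]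
  · rintro ⟨C, c⟩ h
    simp only [mem_sigma, mem_powersetCard, subset_univ, true_and] at h
    simp [insert_erase h.2]
  · rintro ⟨C, c⟩ h
    simp only [mem_sigma, mem_powersetCard, subset_univ, true_and, mem_compl] at h
    simp [erase_insert h.2]
  · rintro ⟨C, c⟩ h
    simp only [mem_sigma, mem_powersetCard, subset_univ, true_and] at h
    simp [insert_erase h.2]

lemma comm_rel (f : Finset V → ℝ) (A : Finset V) :
    dn (up f) A = up (dn f) A + ((Fintype.card V : ℝ) - 2 * A.card) * f A := by
  unfold up dn
  have h1 : ∀ v ∈ Aᶜ, ∑ c ∈ insert v A, f ((insert v A).erase c)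
      = f A + ∑ a ∈ A, f (insert v (A.erase a)) := by
    intro v hv
    rw [mem_compl] at hv
    rw [sum_insert hv, erase_insert hv]
    congr 1
    refine sum_congr rfl fun a ha => ?_
    rw [erase_insert_of_ne]
    rintro rfl; exact hv ha
  have h2 : ∀ a ∈ A, ∑ v ∈ (A.erase a)ᶜ, f (insert v (A.erase a))
      = f A + ∑ v ∈ Aᶜ, f (insert v (A.erase a)) := by
    intro a ha
    rw [compl_erase, sum_insert (by simpa using ha), insert_erase ha]
  rw [sum_congr rfl h1, sum_congr rfl h2, sum_add_distrib, sum_add_distrib,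
    sum_comm (s := Aᶜ)]
  simp only [sum_const, card_compl, nsmul_eq_mul]
  rw [Nat.cast_sub (card_le_univ A)]
  ring

lemma ip_comm (j : ℕ) (f g : Finset V → ℝ) : ip j f g = ip j g f := by
  unfold ip; exact sum_congr rfl fun _ _ => mul_comm _ _

lemma ip_nonneg (j : ℕ) (f : Finset V → ℝ) : 0 ≤ ip j f f :=
  sum_nonneg fun _ _ => mul_self_nonneg _

lemma ip_cs (j : ℕ) (f g : Finset V → ℝ) : (ip j f g)^2 ≤ ip j f f * ip j g g := by
  unfold ip
  simpa [sq] using sum_mul_sq_le_sq_mul_sq (powersetCard j (univ : Finset V)) f g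

lemma norm_up (j : ℕ) (f : Finset V → ℝ) :
    ip (j+2) (up f) (up f) = ip j (dn f) (dn f)
      + ((Fintype.card V : ℝ) - 2 * (j+1)) * ip (j+1) f f := by
  rw [adj (j+1), ← adj j (dn f) f]
  unfold ip
  rw [mul_sum, ← sum_add_distrib]
  refine sum_congr rfl fun A hA => ?_
  rw [mem_powersetCard] at hA
  rw [comm_rel, hA.2]; push_cast; ring

lemma sum_up (j : ℕ) (f : Finset V → ℝ) : ip (j+1) (up f) 1 =
    ((Fintype.card V : ℝ) - j) * ip j f 1 := by
  rw [adj]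
  unfold ip
  rw [mul_sum]
  refine sum_congr rfl fun A hA => ?_
  rw [mem_powersetCard] at hA
  simp only [dn, Pi.one_apply, sum_const, card_compl, nsmul_eq_mul]
  rw [Nat.cast_sub (card_le_univ A), hA.2]; ring

lemma sum_dn (j : ℕ) (f : Finset V → ℝ) : ip j (dn f) 1 = ((j:ℝ)+1) * ip (j+1) f 1 := by
  rw [ip_comm, ← adj, ip_comm]
  unfold ip
  rw [mul_sum]
  refine sum_congr rfl fun A hA => ?_
  rw [mem_powersetCard] at hA
  simp only [up, Pi.one_apply, sum_const, nsmul_eq_mul]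
  rw [hA.2]; push_cast; ring

lemma up_bound (j : ℕ) (hj : j + 1 ≤ Fintype.card V) (f : Finset V → ℝ) (hf : ip j f 1 = 0) :
    ip (j+1) (up f) (up f) ≤ j * ((Fintype.card V : ℝ) - j - 1) * ip j f f := by
  induction j generalizing f with
  | zero =>
    have h0 : f ∅ = 0 := by simpa [ip] using hf
    have : ip (0+1) (up f) (up f) = 0 := by
      unfold ip
      refine sum_eq_zero fun A hA => ?_
      rw [mem_powersetCard] at hA
      obtain ⟨a, rfl⟩ := card_eq_one.1 hA.2
      simp [up, h0]
    rw [this]; simp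
  | succ j ih =>
    rw [norm_up]
    have hd := ih (by omega) (dn f) (by rw [sum_dn, hf, mul_zero])
    have hcs := ip_cs (j+1) (up (dn f)) f
    rw [adj] at hcs
    have hN := ip_nonneg (j+1) f
    have hD := ip_nonneg j (dn f)
    have hc : (j:ℝ) + 1 + 1 ≤ Fintype.card V := by exact_mod_cast hj
    have key : ip j (dn f) (dn f) ≤ j * ((Fintype.card V : ℝ) - j - 1) * ip (j+1) f f := by
      rcases hD.eq_or_lt with h | h
      · rw [← h]
        have : 0 ≤ (Fintype.card V : ℝ) - j - 1 := by linarith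
        positivity
      · have h2 := hcs.trans (mul_le_mul_of_nonneg_right hd hN)
        have : ip j (dn f) (dn f) * ip j (dn f) (dn f)
          ≤ ip j (dn f) (dn f) * (j * ((Fintype.card V : ℝ) - j - 1) * ip (j+1) f f) := by
          nlinarith
        exact le_of_mul_le_mul_left this h
    push_cast
    nlinarith

def T (k : ℕ) (f : Finset V → ℝ) (C : Finset V) : ℝ := ∑ A ∈ powersetCard k C, f A

lemma up_T (k : ℕ) (f : Finset V → ℝ) (C : Finset V) (r : ℕ) (hC : C.card = k + r) :
    up (T k f) C = r * T k f C := by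
  unfold up T
  rw [mul_sum]
  rw [Finset.sum_comm' (t' := powersetCard k C) (s' := fun A => C \ A)]
  · refine sum_congr rfl fun A hA => ?_
    rw [mem_powersetCard] at hA
    rw [sum_const, card_sdiff_of_subset hA.1, hA.2, hC]; simp
  · intro c A
    simp only [mem_powersetCard, mem_sdiff, subset_erase]
    tauto

lemma T_bound (K r : ℕ) (f : Finset V → ℝ) (hf : ip (K+1) f 1 = 0)
    (hr : K + 1 + r ≤ Fintype.card V) :
    ip (K+1+r) (T (K+1) f) 1 = 0 ∧
    ip (K+1+r) (T (K+1) f) (T (K+1) f) ≤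
      ((K+r).choose r : ℝ) * ((Fintype.card V - K - 2).choose r : ℝ) * ip (K+1) f f := by
  induction r with
  | zero =>
    have : ∀ A ∈ powersetCard (K+1) (univ : Finset V), T (K+1) f A = f A := by
      intro A hA
      rw [mem_powersetCard] at hA
      unfold T
      rw [← hA.2, powersetCard_self]; simp
    constructor
    · rw [← hf]; exact sum_congr rfl fun A hA => by rw [this A hA]
    · simp only [Nat.choose_zero_right, Nat.cast_one, one_mul]
      exact le_of_eq <| sum_congr rfl fun A hA => by rw [this A hA]
  | succ r ih =>
    obtain ⟨h0, hb⟩ := ih (by omega)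
    have hup : ∀ A ∈ powersetCard (K+1+r+1) (univ : Finset V),
        up (T (K+1) f) A = (r+1) * T (K+1) f A := by
      intro A hA
      rw [mem_powersetCard] at hA
      rw [up_T (K+1) f A (r+1) (by omega)]; push_cast; ring
    have hs : ip (K+1+r+1) (up (T (K+1) f)) 1 = (r+1) * ip (K+1+(r+1)) (T (K+1) f) 1 := by
      unfold ip
      rw [mul_sum]
      exact sum_congr rfl fun A hA => by rw [hup A hA]; ring
    have hn : ip (K+1+r+1) (up (T (K+1) f)) (up (T (K+1) f)) =
        (r+1)^2 * ip (K+1+(r+1)) (T (K+1) f) (T (K+1) f) := by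
      unfold ip
      rw [mul_sum]
      exact sum_congr rfl fun A hA => by rw [hup A hA]; ring
    have hr1 : (0:ℝ) < r + 1 := by positivity
    constructor
    · rw [sum_up, h0, mul_zero] at hs
      rcases mul_eq_zero.1 hs.symm with h | h
      · linarith
      · exact h
    · have hub := up_bound (K+1+r) (by omega) _ h0
      rw [hn] at hub
      obtain ⟨d, hd⟩ : ∃ d, Fintype.card V = K + 1 + r + 1 + d := ⟨_, (Nat.add_sub_of_le hr).symm⟩
      have e1 : ((K+(r+1)).choose (r+1) : ℝ) * (r+1) = (K+1+r) * ((K+r).choose r) := by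
        have := Nat.add_one_mul_choose_eq (K+r) r
        have h' : (((K+r+1) * (K+r).choose r : ℕ):ℝ) = (((K+r+1).choose (r+1) * (r+1) : ℕ) : ℝ) := by
          exact_mod_cast this
        push_cast at h'
        rw [← add_assoc]; linarith
      have e2 : ((Fintype.card V - K - 2).choose (r+1) : ℝ) * (r+1)
          = (Fintype.card V - (K+1+r) - 1) * ((Fintype.card V - K - 2).choose r) := by
        have := Nat.choose_succ_right_eq (Fintype.card V - K - 2) r
        have h' : (((Fintype.card V - K - 2).choose (r+1) * (r+1) : ℕ):ℝ)
          = (((Fintype.card V - K - 2).choose r * (Fintype.card V - K - 2 - r) : ℕ) : ℝ) := by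
          exact_mod_cast this
        have h3 : Fintype.card V - K - 2 - r = d := by omega
        have h4 : (Fintype.card V : ℝ) = K + 1 + r + 1 + d := by exact_mod_cast hd
        rw [h3] at h'
        push_cast at h'
        rw [h', h4]; ring
      have hpos : 0 ≤ ((K+1+r : ℕ):ℝ) * ((Fintype.card V : ℝ) - ((K+1+r : ℕ):ℝ) - 1) := by
        have h4 : (Fintype.card V : ℝ) = K + 1 + r + 1 + d := by exact_mod_cast hd
        rw [h4]; push_cast
        have : (K + 1 + r + 1 + d - (K+1+r) - 1 : ℝ) = d := by ring
        rw [this]; positivity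
      have h5 := hub.trans (mul_le_mul_of_nonneg_left hb hpos)
      have h6 : (r+1:ℝ)^2 * ip (K+1+(r+1)) (T (K+1) f) (T (K+1) f) ≤
         (r+1:ℝ)^2 * (((K+(r+1)).choose (r+1) : ℝ) * ((Fintype.card V - K - 2).choose (r+1) : ℝ) * ip (K+1) f f) := by
        refine h5.trans (le_of_eq ?_)
        have : (r+1:ℝ)^2 * (((K+(r+1)).choose (r+1) : ℝ) * ((Fintype.card V - K - 2).choose (r+1) : ℝ) * ip (K+1) f f) = (((K+(r+1)).choose (r+1) : ℝ) * (r+1)) * (((Fintype.card V - K - 2).choose (r+1) : ℝ) * (r+1)) * ip (K+1) f f := by ring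
        rw [this, e1, e2]; push_cast; ring
      exact le_of_mul_le_mul_left h6 (by positivity)

lemma kneser_bound (k : ℕ) (hk : 0 < k) (hn : 2 * k ≤ Fintype.card V) (f : Finset V → ℝ)
    (hf : ∑ A ∈ powersetCard k (univ : Finset V), f A = 0) :
    ((Fintype.card V : ℝ) - k)^2 *
      ∑ B ∈ powersetCard k (univ : Finset V), (∑ A ∈ powersetCard k Bᶜ, f A)^2
      ≤ (k:ℝ)^2 * ((Fintype.card V - k).choose k : ℝ)^2
        * ∑ A ∈ powersetCard k (univ : Finset V), (f A)^2 := by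
  obtain ⟨K, rfl⟩ : ∃ K, k = K + 1 := ⟨k-1, by omega⟩
  obtain ⟨r, hr⟩ : ∃ r, Fintype.card V = 2 * (K+1) + r := ⟨_, (Nat.add_sub_of_le hn).symm⟩
  have hb := (T_bound K r f (by simpa [ip] using hf) (by omega)).2
  have hcomp : ip (K+1+r) (T (K+1) f) (T (K+1) f)
      = ∑ B ∈ powersetCard (K+1) (univ : Finset V), (∑ A ∈ powersetCard (K+1) Bᶜ, f A)^2 := by
    unfold ip T
    refine Finset.sum_bij' (fun B _ => Bᶜ) (fun B _ => Bᶜ) ?_ ?_ ?_ ?_ ?_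
    · intro B hB
      rw [mem_powersetCard] at hB ⊢
      rw [card_compl]; exact ⟨subset_univ _, by omega⟩
    · intro B hB
      rw [mem_powersetCard] at hB ⊢
      rw [card_compl]; exact ⟨subset_univ _, by omega⟩
    · intro B _; simp
    · intro B _; simp
    · intro B _; rw [compl_compl, sq]
  rw [hcomp] at hb
  have h1 : Fintype.card V - K - 2 = K + r := by omega
  have h2 : (Fintype.card V : ℝ) - ((K+1 : ℕ):ℝ) = K + r + 1 := by rw [hr]; push_cast; ring
  have h3 : Fintype.card V - (K+1) = K + r + 1 := by omega
  rw [h1] at hb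
  rw [h2, h3]
  have e : (K + r + 1 : ℝ) * ((K+r).choose r) = ((K+r+1).choose (K+1)) * (K+1) := by
    have := Nat.add_one_mul_choose_eq (K+r) K
    rw [show (K+r).choose K = (K+r).choose r from Nat.choose_symm_add] at this
    exact_mod_cast this
  calc _ ≤ (K + r + 1 : ℝ)^2 * (((K+r).choose r : ℝ) * ((K+r).choose r : ℝ) * ip (K+1) f f) := by
        gcongr
    _ = ((K + r + 1 : ℝ) * ((K+r).choose r))^2 * ip (K+1) f f := by ring
    _ = _ := by
      rw [e]; unfold ip
      simp only [← sq]; push_cast; ring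
end kneser


structure Mix {X : Type} [Fintype X] (w : X → X → ℝ) (ρ : ℝ) : Prop where
  nonneg : ∀ x y, 0 ≤ w x y
  symm : ∀ x y, w x y = w y x
  row : ∀ x, ∑ y, w x y = 1
  gap : ∀ f : X → ℝ, ∑ x, f x = 0 → ∑ x, (∑ y, w x y * f y)^2 ≤ ρ^2 * ∑ x, (f x)^2

lemma Mix.mono {X : Type} [Fintype X] {w : X → X → ℝ} {ρ ρ' : ℝ} (h : Mix w ρ)
    (h0 : 0 ≤ ρ) (hρ : ρ ≤ ρ') : Mix w ρ' where
  nonneg := h.nonneg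
  symm := h.symm
  row := h.row
  gap f hf := (h.gap f hf).trans (by gcongr)

lemma Mix.sum_op {X : Type} [Fintype X] {w : X → X → ℝ} {ρ : ℝ} (h : Mix w ρ) (f : X → ℝ) :
    ∑ x, ∑ y, w x y * f y = ∑ y, f y := by
  rw [sum_comm]
  refine sum_congr rfl fun y _ => ?_
  rw [← sum_mul, sum_congr rfl (fun x _ => h.symm x y), h.row, one_mul]

lemma Mix.contr {X : Type} [Fintype X] {w : X → X → ℝ} {ρ : ℝ} (h : Mix w ρ) (f : X → ℝ) :
    ∑ x, (∑ y, w x y * f y)^2 ≤ ∑ x, (f x)^2 := by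
  rw [← h.sum_op (fun x => (f x)^2)]
  refine sum_le_sum fun x _ => ?_
  have := sum_sq_le_sum_mul_sum_of_sq_le_mul univ (r := fun y => w x y * f y)
    (f := fun y => w x y) (g := fun y => w x y * f y ^ 2) (fun y _ => h.nonneg x y)
    (fun y _ => mul_nonneg (h.nonneg x y) (sq_nonneg _)) (fun y _ => le_of_eq (by ring))
  rwa [h.row, one_mul] at this

lemma Mix.prod {X Y : Type} [Fintype X] [Fintype Y] [Nonempty X] {w : X → X → ℝ} {v : Y → Y → ℝ}
    {ρ : ℝ} (hw : Mix w ρ) (hv : Mix v ρ) :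
    Mix (fun p q : X × Y => w p.1 q.1 * v p.2 q.2) ρ where
  nonneg p q := mul_nonneg (hw.nonneg _ _) (hv.nonneg _ _)
  symm p q := by rw [hw.symm, hv.symm]
  row p := by
    rw [Fintype.sum_prod_type]
    simp only [← mul_sum, hv.row, mul_one, hw.row]
  gap f hf := by
    have hX : (Fintype.card X : ℝ) ≠ 0 := by exact_mod_cast Fintype.card_ne_zero
    set a : Y → ℝ := fun y => (∑ x, f (x, y)) / Fintype.card X with ha
    set g : X → Y → ℝ := fun x y => f (x, y) - a y with hg
    have hg0 : ∀ y, ∑ x, g x y = 0 := by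
      intro y
      simp only [hg, ha, sum_sub_distrib, sum_const, card_univ, nsmul_eq_mul]
      field_simp; ring
    have ha0 : ∑ y, a y = 0 := by
      rw [Fintype.sum_prod_type_right] at hf
      simp only [ha, ← sum_div, hf, zero_div]
    -- v applied to g
    set u : X → Y → ℝ := fun x y => ∑ y', v y y' * g x y' with hu
    have hu0 : ∀ y, ∑ x, u x y = 0 := by
      intro y
      simp only [hu]
      rw [sum_comm]
      simp only [← mul_sum, hg0, mul_zero, sum_const_zero]
    set z : X → Y → ℝ := fun x y => ∑ x', w x x' * u x' y with hz
    have hz0 : ∀ y, ∑ x, z x y = 0 := fun y => by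
      simp only [hz]; rw [hw.sum_op (fun x => u x y), hu0]
    set b : Y → ℝ := fun y => ∑ y', v y y' * a y' with hb
    have hsplit : ∀ x y, ∑ q : X × Y, w x q.1 * v y q.2 * f q = z x y + b y := by
      intro x y
      rw [Fintype.sum_prod_type]
      have : ∀ x', ∑ y', w x x' * v y y' * f (x', y') = w x x' * u x' y + w x x' * b y := by
        intro x'
        simp only [hu, hb, mul_sum, ← sum_add_distrib, hg]
        exact sum_congr rfl fun _ _ => by ring
      simp only [this, sum_add_distrib, ← sum_mul, hw.row, one_mul, hz]
    have orth : ∀ (p : X → Y → ℝ) (c : Y → ℝ), (∀ y, ∑ x, p x y = 0) →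
        ∑ q : X × Y, (p q.1 q.2 + c q.2)^2 = ∑ y, ∑ x, (p x y)^2 + Fintype.card X * ∑ y, (c y)^2 := by
      intro p c hp
      rw [Fintype.sum_prod_type_right, mul_sum, ← sum_add_distrib]
      refine sum_congr rfl fun y _ => ?_
      have : ∀ x, (p x y + c y)^2 = (p x y)^2 + 2 * c y * p x y + (c y)^2 := fun x => by ring
      simp only [this, sum_add_distrib, ← mul_sum, hp, sum_const, card_univ, nsmul_eq_mul]
      ring
    have hL : ∑ p : X × Y, (∑ q : X × Y, w p.1 q.1 * v p.2 q.2 * f q)^2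
        = ∑ y, ∑ x, (z x y)^2 + Fintype.card X * ∑ y, (b y)^2 := by
      rw [← orth z b hz0]
      exact sum_congr rfl fun p _ => by rw [hsplit]
    have hR : ∑ p : X × Y, (f p)^2
        = ∑ y, ∑ x, (g x y)^2 + Fintype.card X * ∑ y, (a y)^2 := by
      rw [← orth g a hg0]
      exact sum_congr rfl fun p _ => by simp [hg]
    rw [hL, hR, mul_add]
    refine add_le_add ?_ ?_
    · calc ∑ y, ∑ x, (z x y)^2 ≤ ∑ y, ρ^2 * ∑ x, (u x y)^2 :=
            sum_le_sum fun y _ => hw.gap (fun x => u x y) (hu0 y)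
        _ = ρ^2 * ∑ x, ∑ y, (u x y)^2 := by rw [← mul_sum, sum_comm]
        _ ≤ ρ^2 * ∑ x, ∑ y, (g x y)^2 := by
            exact mul_le_mul_of_nonneg_left (sum_le_sum fun x _ => hv.contr (g x)) (sq_nonneg _)
        _ = _ := by rw [sum_comm]
    · have := hv.gap a ha0
      calc _ ≤ (Fintype.card X : ℝ) * (ρ^2 * ∑ y, (a y)^2) := by gcongr
        _ = _ := by ring

lemma Mix.transfer {X Y : Type} [Fintype X] [Fintype Y] (e : X ≃ Y) {w : X → X → ℝ} {v : Y → Y → ℝ}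
    {ρ : ℝ} (hv : Mix v ρ) (h : ∀ x x', w x x' = v (e x) (e x')) : Mix w ρ where
  nonneg x y := by rw [h]; exact hv.nonneg _ _
  symm x y := by rw [h, h]; exact hv.symm _ _
  row x := by
    simp only [h]
    rw [e.sum_comp (fun y => v (e x) y), hv.row]
  gap f hf := by
    have h1 := hv.gap (fun y => f (e.symm y)) (by rw [e.symm.sum_comp, hf])
    rw [← e.sum_comp, ← e.sum_comp (fun y => f (e.symm y) ^ 2)] at h1
    simp only [Equiv.symm_apply_apply] at h1
    convert h1 using 4 with x
    rw [← e.sum_comp]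
    simp [h]

lemma Mix.pi : ∀ (l : ℕ) (X : Fin l → Type) [∀ i, Fintype (X i)] [∀ i, Nonempty (X i)]
    (w : ∀ i, X i → X i → ℝ) (ρ : ℝ) (_ : ∀ i, Mix (w i) ρ),
    Mix (fun x y : (∀ i, X i) => ∏ i, w i (x i) (y i)) ρ
  | 0, X, _, _, w, ρ, h =>
    { nonneg := fun x y => by simp
      symm := fun x y => by simp
      row := fun x => by simp
      gap := fun f hf => by
        have : ∀ x, f x = 0 := fun x => by
          rw [Fintype.sum_unique] at hf
          rwa [Subsingleton.elim x default]
        simp [this] }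
  | l+1, X, _, _, w, ρ, h => by
    refine Mix.transfer (Fin.consEquiv X).symm
      ((h 0).prod (Mix.pi l (fun i => X i.succ) (fun i => w i.succ) ρ (fun i => h i.succ))) ?_
    intro x y
    rw [Fin.prod_univ_succ]
    rfl

lemma Mix.quad {X : Type} [Fintype X] {w : X → X → ℝ} {ρ : ℝ} (h : Mix w ρ) (h0 : 0 ≤ ρ)
    (f : X → ℝ) (hf : ∑ x, f x = 0) :
    ∑ x, ∑ y, w x y * f x * f y ≤ ρ * ∑ x, (f x)^2 := by
  have h1 : ∑ x, ∑ y, w x y * f x * f y = ∑ x, f x * (∑ y, w x y * f y) :=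
    sum_congr rfl fun x _ => by
      rw [mul_sum]; exact sum_congr rfl fun y _ => by ring
  have h2 := sum_mul_sq_le_sq_mul_sq univ f (fun x => ∑ y, w x y * f y)
  have hN : 0 ≤ ∑ x, (f x)^2 := sum_nonneg fun _ _ => sq_nonneg _
  rw [h1]
  refine abs_le_of_sq_le_sq' ?_ (by positivity) |>.2
  calc _ ≤ _ := h2
    _ ≤ (∑ x, (f x)^2) * (ρ^2 * ∑ x, (f x)^2) := by
      gcongr; exact h.gap f hf
    _ = _ := by ring

lemma second_moment {X Ω : Type} [Fintype X] [DecidableEq X] [Nonempty X] [Fintype Ω] (m : ℕ) (Y : Ω → Fin m → X)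
    {w : X → X → ℝ} {ρ : ℝ} (h : Mix w ρ) (h0 : 0 ≤ ρ)
    (h1 : ∀ j (φ : X → ℝ), (∑ ω, φ (Y ω j)) * Fintype.card X = Fintype.card Ω * ∑ x, φ x)
    (h2 : ∀ j j' (φ : X → ℝ), j ≠ j' → (∑ ω, φ (Y ω j) * φ (Y ω j')) * Fintype.card X
      = Fintype.card Ω * ∑ x, ∑ y, w x y * φ x * φ y)
    (S : Finset X) (p : ℝ) (hp : p * Fintype.card X = S.card) :
    ∑ ω, (((univ.filter fun j => Y ω j ∈ S).card : ℝ) - m * p)^2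
      ≤ Fintype.card Ω * (m * p + m * (m - 1) * ρ * p) := by
  have hX : (0:ℝ) < Fintype.card X := by exact_mod_cast Fintype.card_pos
  set φ : X → ℝ := fun x => (if x ∈ S then 1 else 0) - p with hφ
  have hφ0 : ∑ x, φ x = 0 := by
    simp [hφ, sum_sub_distrib]; linarith
  have hφ2 : ∑ x, (φ x)^2 ≤ p * Fintype.card X := by
    have : ∀ x, (φ x)^2 = (1 - 2 * p) * (if x ∈ S then 1 else 0) + p^2 := by
      intro x; simp only [hφ]; split_ifs <;> ring
    simp only [this, sum_add_distrib, ← mul_sum]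
    simp only [sum_ite_mem, univ_inter, sum_const, nsmul_eq_mul, mul_one, card_univ, ← hp]
    nlinarith [mul_nonneg (sq_nonneg p) hX.le]
  have hsum : ∀ ω, (((univ.filter fun j => Y ω j ∈ S).card : ℝ) - m * p) = ∑ j, φ (Y ω j) := by
    intro ω
    simp [hφ, sum_sub_distrib]
  have hj : ∀ j j', (∑ ω, φ (Y ω j) * φ (Y ω j')) ≤ if j = j' then Fintype.card Ω * p else Fintype.card Ω * (ρ * p) := by
    intro j j'
    refine le_of_mul_le_mul_right ?_ hX
    split_ifs with hjj
    · subst hjj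
      have := h1 j (fun x => φ x * φ x)
      rw [this]
      simp only [← sq, mul_assoc]
      gcongr
    · rw [h2 j j' φ hjj, mul_assoc, mul_assoc]
      gcongr
      refine (h.quad h0 φ hφ0).trans ?_
      gcongr
  calc _ = ∑ ω, ∑ j, ∑ j', φ (Y ω j) * φ (Y ω j') := by
        refine sum_congr rfl fun ω _ => ?_
        rw [hsum, sq, sum_mul_sum]
    _ = ∑ j, ∑ j', ∑ ω, φ (Y ω j) * φ (Y ω j') := by
        rw [sum_comm]
        exact sum_congr rfl fun j _ => sum_comm
    _ ≤ ∑ j : Fin m, ∑ j' : Fin m, (if j = j' then Fintype.card Ω * p else Fintype.card Ω * (ρ * p)) :=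
        sum_le_sum fun j _ => sum_le_sum fun j' _ => hj j j'
    _ = ∑ j : Fin m, ∑ j' : Fin m, ((if j = j' then Fintype.card Ω * p - Fintype.card Ω * (ρ * p) else 0) + Fintype.card Ω * (ρ * p)) := by
        refine sum_congr rfl fun j _ => sum_congr rfl fun j' _ => ?_
        split_ifs <;> ring
    _ = _ := by
        simp [sum_add_distrib]
        ring

lemma choose_matching {X Ω : Type} [Fintype X] [DecidableEq X] [Nonempty X] [Fintype Ω] [Nonempty Ω]
    (m s : ℕ) (hs : 0 < s) (hm : 6 * s ≤ m) (Y : Ω → Fin m → X)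
    {w : X → X → ℝ} (h : Mix w (1 / ((m:ℝ) - 1)))
    (h1 : ∀ j (φ : X → ℝ), (∑ ω, φ (Y ω j)) * Fintype.card X = Fintype.card Ω * ∑ x, φ x)
    (h2 : ∀ j j' (φ : X → ℝ), j ≠ j' → (∑ ω, φ (Y ω j) * φ (Y ω j')) * Fintype.card X
      = Fintype.card Ω * ∑ x, ∑ y, w x y * φ x * φ y)
    (S : Fin s → Finset X) (hS : ∀ t, (6 * s - 1 : ℝ) * Fintype.card X ≤ m * (S t).card) :
    ∃ ω, ∃ τ : Fin s → Fin m, Function.Injective τ ∧ ∀ t, Y ω (τ t) ∈ S t := by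
  classical
  have hX : (0:ℝ) < Fintype.card X := by exact_mod_cast Fintype.card_pos
  have hΩ : (0:ℝ) < Fintype.card Ω := by exact_mod_cast Fintype.card_pos
  have hs1 : (1:ℝ) ≤ s := by exact_mod_cast hs
  have hm1 : (6:ℝ) * s ≤ m := by exact_mod_cast hm
  set B : Fin s → Finset Ω := fun t => univ.filter fun ω => (univ.filter fun j => Y ω j ∈ S t).card < s with hB
  have hBt : ∀ t, (s:ℝ) * (B t).card < Fintype.card Ω := by
    intro t
    set p : ℝ := (S t).card / Fintype.card X with hp
    have hpX : p * Fintype.card X = (S t).card := by rw [hp]; field_simp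
    have hsm := second_moment m Y h (by apply div_nonneg <;> linarith) h1 h2 (S t) p hpX
    set μ : ℝ := m * p with hμ
    have hμ1 : 6 * s - 1 ≤ μ := by
      have := hS t
      rw [← hpX, ← mul_assoc] at this
      exact le_of_mul_le_mul_right this hX
    have e : (m:ℝ) * p + m * (m-1) * (1 / ((m:ℝ) - 1)) * p = 2 * μ := by
      have : (m:ℝ) - 1 ≠ 0 := by linarith
      field_simp; rw [hμ]; ring
    rw [e] at hsm
    have hlow : ((B t).card : ℝ) * (μ - (s - 1))^2 ≤ ∑ ω, (((univ.filter fun j => Y ω j ∈ S t).card : ℝ) - μ)^2 := by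
      rw [← nsmul_eq_mul, ← sum_const]
      refine (sum_le_sum fun ω hω => ?_).trans (sum_le_sum_of_subset_of_nonneg (subset_univ (B t)) fun _ _ _ => sq_nonneg _)
      simp only [hB, mem_filter, mem_univ, true_and] at hω
      have : ((univ.filter fun j => Y ω j ∈ S t).card : ℝ) + 1 ≤ s := by exact_mod_cast hω
      nlinarith
    have hcomb := hlow.trans hsm
    have hsq : 2 * μ * s < (μ - (s-1))^2 := by nlinarith
    have hμ0 : 0 < μ := by linarith
    by_contra hcon
    push Not at hcon
    have hb : 0 < ((B t).card : ℝ) := by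
      by_contra hb
      nlinarith
    nlinarith
  have hex : ∃ ω, ∀ t, ω ∉ B t := by
    by_contra hcon
    push Not at hcon
    have hsub : (univ : Finset Ω) ⊆ univ.biUnion B := fun ω _ => by
      obtain ⟨t, ht⟩ := hcon ω
      exact mem_biUnion.2 ⟨t, mem_univ _, ht⟩
    have hc : Fintype.card Ω ≤ ∑ t, (B t).card := (card_le_card hsub).trans card_biUnion_le
    have hc' : (Fintype.card Ω : ℝ) ≤ ∑ t, ((B t).card : ℝ) := by exact_mod_cast hc
    have : (s:ℝ) * ∑ t, ((B t).card : ℝ) < s * Fintype.card Ω := by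
      rw [mul_sum]
      have : Nonempty (Fin s) := ⟨⟨0, hs⟩⟩
      calc _ < ∑ t : Fin s, (Fintype.card Ω : ℝ) := sum_lt_sum_of_nonempty univ_nonempty fun t _ => hBt t
        _ = _ := by simp
    nlinarith
  obtain ⟨ω, hω⟩ := hex
  refine ⟨ω, ?_⟩
  have hall := (Finset.all_card_le_biUnion_card_iff_exists_injective
    (fun t : Fin s => univ.filter fun j => Y ω j ∈ S t)).1 ?_
  · obtain ⟨τ, hτ, hmem⟩ := hall
    exact ⟨τ, hτ, fun t => by simpa using hmem t⟩
  · intro A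
    rcases A.eq_empty_or_nonempty with rfl | ⟨t, ht⟩
    · simp
    · have h3 := hω t
      simp only [hB, mem_filter, mem_univ, true_and, not_lt] at h3
      calc A.card ≤ s := by simpa using card_le_univ A
        _ ≤ _ := h3
        _ ≤ _ := card_le_card (subset_biUnion_of_mem (fun t : Fin s => univ.filter fun j => Y ω j ∈ S t) ht)

lemma orbit_avg {G Z : Type} [Group G] [Fintype G] [MulAction G Z] [DecidableEq Z] (z0 : Z)
    (S : Finset Z) (hS : ∀ z, z ∈ S ↔ ∃ g : G, g • z0 = z) (φ : Z → ℝ) :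
    (∑ g : G, φ (g • z0)) * S.card = Fintype.card G * ∑ z ∈ S, φ z := by
  have hfib : ∀ z ∈ S, (univ.filter fun g : G => g • z0 = z).card
      = (univ.filter fun g : G => g • z0 = z0).card := by
    intro z hz
    obtain ⟨h, rfl⟩ := (hS z).1 hz
    refine card_bij' (fun g _ => h⁻¹ * g) (fun g _ => h * g) ?_ ?_ ?_ ?_
    · intro g hg
      simp only [mem_filter, mem_univ, true_and] at hg ⊢
      rw [mul_smul, hg, inv_smul_smul]
    · intro g hg
      simp only [mem_filter, mem_univ, true_and] at hg ⊢
      rw [mul_smul, hg]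
    · intro g _; simp
    · intro g _; simp
  set c := (univ.filter fun g : G => g • z0 = z0).card with hc
  have key : ∀ ψ : Z → ℝ, ∑ g : G, ψ (g • z0) = c * ∑ z ∈ S, ψ z := by
    intro ψ
    rw [← sum_fiberwise_of_maps_to (s := univ) (t := S) (g := fun g : G => g • z0)
      (fun g _ => (hS _).2 ⟨g, rfl⟩), mul_sum]
    refine sum_congr rfl fun z hz => ?_
    rw [← hfib z hz, ← nsmul_eq_mul, ← sum_const]
    refine sum_congr rfl fun g hg => ?_
    rw [(mem_filter.1 hg).2]
  have h1 := key (fun _ => 1)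
  simp only [sum_const, card_univ, nsmul_eq_mul, mul_one] at h1
  rw [key, h1]; ring

abbrev KS (n k : ℕ) : Type := {A : Finset (Fin n) // A.card = k}

instance KS.act (n k : ℕ) : MulAction (Equiv.Perm (Fin n)) (KS n k) where
  smul g A := ⟨A.1.map g.toEmbedding, by rw [card_map, A.2]⟩
  one_smul A := Subtype.ext (by
    change A.1.map _ = A.1
    exact map_refl)
  mul_smul g h A := Subtype.ext (by
    change A.1.map _ = (A.1.map _).map _
    rw [map_map]; rfl)

lemma KS.smul_val {n k : ℕ} (g : Equiv.Perm (Fin n)) (A : KS n k) :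
    (g • A).1 = A.1.map g.toEmbedding := rfl

lemma exists_perm {n : ℕ} (A B A' B' : Finset (Fin n)) (hA : A.card = A'.card)
    (hB : B.card = B'.card) (hd : Disjoint A B) (hd' : Disjoint A' B') :
    ∃ g : Equiv.Perm (Fin n), A.map g.toEmbedding = A' ∧ B.map g.toEmbedding = B' := by
  set f : Finset (Fin n) → Finset (Fin n) → Fin n → Bool × Bool :=
    fun A B v => (decide (v ∈ A), decide (v ∈ B)) with hf
  have hcnt : ∀ A B : Finset (Fin n), Disjoint A B → ∀ c : Bool × Bool,
      (univ.filter fun v => f A B v = c).card =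
        match c with
        | (true, true) => 0
        | (true, false) => A.card
        | (false, true) => B.card
        | (false, false) => n - (A.card + B.card) := by
    intro A B hd c
    rw [disjoint_left] at hd
    rcases c with ⟨_ | _, _ | _⟩
    · have : (univ.filter fun v => f A B v = (false, false)) = (A ∪ B)ᶜ := by
        ext v; simp [hf]
      rw [this, card_compl, card_union_of_disjoint (disjoint_left.2 hd), Fintype.card_fin]
    · have : (univ.filter fun v => f A B v = (false, true)) = B := by
        ext v; simp [hf]; exact fun h h' => hd h' h
      rw [this]
    · have : (univ.filter fun v => f A B v = (true, false)) = A := by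
        ext v; simp [hf]; exact fun h => hd h
      rw [this]
    · have : (univ.filter fun v => f A B v = (true, true)) = ∅ := by
        ext v; simp [hf]; exact fun h => hd h
      rw [this]; rfl
  have he : ∀ c, Nonempty ({v // f A B v = c} ≃ {v // f A' B' v = c}) := by
    intro c
    refine ⟨Fintype.equivOfCardEq ?_⟩
    rw [Fintype.card_subtype, Fintype.card_subtype, hcnt A B hd, hcnt A' B' hd', hA, hB]
  let e := fun c => (he c).some
  refine ⟨Equiv.ofFiberEquiv e, ?_⟩
  have hm : ∀ v, f A' B' (Equiv.ofFiberEquiv e v) = f A B v := Equiv.ofFiberEquiv_map e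
  constructor
  · refine eq_of_subset_of_card_le ?_ (by rw [card_map, hA])
    intro y hy
    obtain ⟨v, hv, rfl⟩ := mem_map.1 hy
    have := congrArg Prod.fst (hm v)
    simpa [hf, hv] using this
  · refine eq_of_subset_of_card_le ?_ (by rw [card_map, hB])
    intro y hy
    obtain ⟨v, hv, rfl⟩ := mem_map.1 hy
    have := congrArg Prod.snd (hm v)
    simpa [hf, hv] using this

noncomputable def kw (n k : ℕ) (A B : KS n k) : ℝ :=
  if Disjoint A.1 B.1 then 1 / ((n - k).choose k : ℝ) else 0

lemma sum_KS (n k : ℕ) (f : Finset (Fin n) → ℝ) :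
    ∑ A : KS n k, f A.1 = ∑ A ∈ powersetCard k univ, f A := by
  rw [← Finset.sum_subtype (powersetCard k (univ : Finset (Fin n))) (p := fun A => A.card = k)]
  intro A; simp [mem_powersetCard]

lemma sum_kw (n k : ℕ) (f : Finset (Fin n) → ℝ) (B : KS n k) :
    ∑ A : KS n k, kw n k B A * f A.1
      = (∑ A ∈ powersetCard k B.1ᶜ, f A) / ((n - k).choose k : ℝ) := by
  unfold kw
  rw [sum_KS n k (fun A => (if Disjoint B.1 A then 1 / ((n - k).choose k : ℝ) else 0) * f A),
    sum_div]
  simp only [ite_mul, zero_mul]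
  rw [← sum_filter]
  refine sum_congr ?_ fun A _ => by ring
  ext A
  simp only [mem_filter, mem_powersetCard, subset_univ, true_and, subset_compl_iff_disjoint_left]
  tauto

lemma kw_mix (n k : ℕ) (hk : 0 < k) (hn : 2 * k ≤ n) : Mix (kw n k) ((k:ℝ) / ((n:ℝ) - k)) where
  nonneg A B := by unfold kw; split_ifs <;> positivity
  symm A B := by unfold kw; simp only [disjoint_comm]
  row B := by
    have := sum_kw n k (fun _ => 1) B
    simp only [mul_one] at this
    rw [this]
    simp only [sum_const, card_powersetCard, card_compl, Fintype.card_fin, B.2, nsmul_eq_mul, mul_one]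
    refine div_self ?_
    exact_mod_cast (Nat.choose_pos (by omega)).ne'
  gap f hf := by
    have hc : (0:ℝ) < ((n-k).choose k : ℝ) := by exact_mod_cast Nat.choose_pos (by omega)
    have hnk : (0:ℝ) < (n:ℝ) - k := by
      have : (k:ℝ) + 1 ≤ n := by exact_mod_cast (by omega : k + 1 ≤ n)
      linarith
    set F : Finset (Fin n) → ℝ := fun A => if h : A.card = k then f ⟨A, h⟩ else 0 with hF
    have hfF : ∀ A : KS n k, f A = F A.1 := fun A => by simp [hF, A.2]
    simp only [hfF] at hf ⊢
    simp only [sum_kw]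
    rw [sum_KS n k F] at hf
    rw [sum_KS n k (fun A => F A ^ 2),
      sum_KS n k (fun B => ((∑ A ∈ powersetCard k Bᶜ, F A) / ((n - k).choose k : ℝ))^2)]
    have h := kneser_bound (V := Fin n) k hk (by simpa using hn) F hf
    simp only [Fintype.card_fin] at h
    simp only [div_pow, ← sum_div]
    rw [div_le_iff₀ (by positivity), div_mul_eq_mul_div, div_mul_eq_mul_div,
      le_div_iff₀ (by positivity)]
    linarith

def base (n k m : ℕ) (h : m * k ≤ n) (j : Fin m) : KS n k :=
  ⟨univ.map ⟨fun i : Fin k => (⟨j.1 * k + i.1, by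
      have : (j.1 + 1) * k ≤ m * k := Nat.mul_le_mul_right k j.2
      have := i.2
      rw [add_mul] at *
      omega⟩ : Fin n), fun a b hab => by
        simp only [Fin.mk.injEq] at hab
        exact Fin.ext (by omega)⟩, by simp⟩

lemma base_disj (n k m : ℕ) (h : m * k ≤ n) (j j' : Fin m) (hj : j ≠ j') :
    Disjoint (base n k m h j).1 (base n k m h j').1 := by
  rw [disjoint_left]
  intro x hx hx'
  simp only [base, mem_map, mem_univ, true_and, Function.Embedding.coeFn_mk] at hx hx'
  obtain ⟨a, rfl⟩ := hx
  obtain ⟨b, hb⟩ := hx'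
  have hb := congrArg Fin.val hb
  change j'.1 * k + b.1 = j.1 * k + a.1 at hb
  apply hj
  have ha := a.2
  have hb2 := b.2
  have h1 : (j.1 * k + a.1) / k = j.1 := by
    rw [mul_comm, Nat.mul_add_div (by omega), Nat.div_eq_of_lt ha, add_zero]
  have h2 : (j'.1 * k + b.1) / k = j'.1 := by
    rw [mul_comm, Nat.mul_add_div (by omega), Nat.div_eq_of_lt hb2, add_zero]
  exact Fin.ext (by rw [← h1, ← h2, hb])

lemma main_matching (l s m : ℕ) (n k : Fin l → ℕ) (hk : ∀ i, 0 < k i) (hs : 0 < s)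
    (hm : 6 * s ≤ m) (hmk : ∀ i, m * k i ≤ n i)
    (S : Fin s → Finset (∀ i, KS (n i) (k i)))
    (hS : ∀ t, (6 * s - 1 : ℝ) * ∏ i, ((n i).choose (k i) : ℝ) ≤ m * (S t).card) :
    ∃ e : Fin s → (∀ i, KS (n i) (k i)), (∀ t, e t ∈ S t) ∧
      ∀ t t', t ≠ t' → ∀ i, Disjoint (e t i).1 (e t' i).1 := by
  have hm1 : (6:ℝ) ≤ m := by exact_mod_cast (by omega : 6 ≤ m)
  have hne : ∀ i, Nonempty (KS (n i) (k i)) := fun i =>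
    ⟨base _ _ m (hmk i) ⟨0, by omega⟩⟩
  have hmix : Mix (fun x y : (∀ i, KS (n i) (k i)) => ∏ i, kw (n i) (k i) (x i) (y i))
      (1 / ((m:ℝ) - 1)) := by
    refine Mix.pi l _ (fun i => kw (n i) (k i)) _ fun i => ?_
    have hki : (0:ℝ) < k i := by exact_mod_cast hk i
    have hmki : (m:ℝ) * k i ≤ n i := by exact_mod_cast hmk i
    refine (kw_mix (n i) (k i) (hk i) ?_).mono ?_ ?_
    · have := hmk i; nlinarith
    · apply div_nonneg <;> nlinarith
    · rw [div_le_div_iff₀ (by nlinarith) (by linarith)]; nlinarith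
  set b : Fin m → (∀ i, KS (n i) (k i)) := fun j i => base (n i) (k i) m (hmk i) j with hb
  have hcard : (Fintype.card (∀ i, KS (n i) (k i)) : ℝ) = ∏ i, ((n i).choose (k i) : ℝ) := by
    rw [Fintype.card_pi]; push_cast
    refine prod_congr rfl fun i _ => ?_
    rw [Fintype.card_finset_len, Fintype.card_fin]
  have H := choose_matching (Ω := ∀ i, Equiv.Perm (Fin (n i))) m s hs hm
    (fun g j => g • b j) hmix ?_ ?_ S (by rw [hcard]; exact hS)
  · obtain ⟨g, τ, hτ, hmem⟩ := H
    refine ⟨fun t => g • b (τ t), hmem, fun t t' htt i => ?_⟩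
    change Disjoint ((g • b (τ t)) i).1 ((g • b (τ t')) i).1
    rw [Pi.smul_apply', Pi.smul_apply', KS.smul_val, KS.smul_val, disjoint_map]
    exact base_disj _ _ _ _ _ _ (fun h => htt (hτ h))
  · intro j φ
    refine orbit_avg (b j) univ (fun z => ⟨fun _ => ?_, fun _ => mem_univ _⟩) φ
    have : ∀ i, ∃ g : Equiv.Perm (Fin (n i)), g • b j i = z i := fun i => by
      obtain ⟨g, hg, -⟩ := exists_perm (b j i).1 ∅ (z i).1 ∅ (by rw [(b j i).2, (z i).2]) rfl
        (disjoint_empty_right _) (disjoint_empty_right _)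
      exact ⟨g, Subtype.ext hg⟩
    choose g hg using this
    exact ⟨g, funext hg⟩
  · intro j j' φ hjj
    set D : ℝ := ∏ i, ((n i - k i).choose (k i) : ℝ) with hD
    have hD0 : D ≠ 0 := by
      refine prod_ne_zero_iff.2 fun i _ => ?_
      have : k i ≤ n i - k i := by
        have := hmk i
        have : 2 * k i ≤ m * k i := Nat.mul_le_mul_right _ (by omega)
        omega
      exact_mod_cast (Nat.choose_pos this).ne'
    set Z : Finset ((∀ i, KS (n i) (k i)) × (∀ i, KS (n i) (k i))) :=
      univ.filter fun p => ∀ i, Disjoint (p.1 i).1 (p.2 i).1 with hZ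
    have hw : ∀ x y : (∀ i, KS (n i) (k i)), D * ∏ i, kw (n i) (k i) (x i) (y i)
        = if (x, y) ∈ Z then 1 else 0 := by
      intro x y
      rw [hD, ← prod_mul_distrib]
      simp only [hZ, mem_filter, mem_univ, true_and]
      split_ifs with h
      · refine prod_eq_one fun i _ => ?_
        have := prod_ne_zero_iff.1 hD0 i (mem_univ i)
        simp only [kw, if_pos (h i)]
        field_simp
      · push Not at h
        obtain ⟨i, hi⟩ := h
        refine prod_eq_zero (mem_univ i) ?_
        simp [kw, if_neg hi]
    have hsumZ : ∀ ψ : (∀ i, KS (n i) (k i)) → (∀ i, KS (n i) (k i)) → ℝ,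
        ∑ p ∈ Z, ψ p.1 p.2 = D * ∑ x, ∑ y, (∏ i, kw (n i) (k i) (x i) (y i)) * ψ x y := by
      intro ψ
      have : ∑ p ∈ Z, ψ p.1 p.2 = ∑ p, if p ∈ Z then ψ p.1 p.2 else 0 := by
        rw [sum_ite_mem, univ_inter]
      rw [this, Fintype.sum_prod_type, mul_sum]
      refine sum_congr rfl fun x _ => ?_
      rw [mul_sum]
      refine sum_congr rfl fun y _ => ?_
      rw [← mul_assoc, hw]; split_ifs <;> simp
    have hZc : (Z.card : ℝ) = D * Fintype.card (∀ i, KS (n i) (k i)) := by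
      have := hsumZ (fun _ _ => 1)
      simp only [sum_const, nsmul_eq_mul, mul_one] at this
      rw [this]
      simp only [hmix.row, sum_const, card_univ, nsmul_eq_mul, mul_one]
    have horb := orbit_avg (G := ∀ i, Equiv.Perm (Fin (n i))) (b j, b j') Z ?_
      (fun p => φ p.1 * φ p.2)
    · rw [hsumZ (fun x y => φ x * φ y), hZc] at horb
      refine mul_left_cancel₀ hD0 ?_
      simp only [mul_assoc, Prod.smul_fst, Prod.smul_snd] at horb ⊢
      linarith
    · rintro ⟨x, y⟩
      simp only [hZ, mem_filter, mem_univ, true_and]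
      constructor
      · intro h
        have : ∀ i, ∃ g : Equiv.Perm (Fin (n i)), g • b j i = x i ∧ g • b j' i = y i := fun i => by
          obtain ⟨g, hg, hg'⟩ := exists_perm (b j i).1 (b j' i).1 (x i).1 (y i).1
            (by rw [(b j i).2, (x i).2]) (by rw [(b j' i).2, (y i).2])
            (base_disj _ _ _ _ _ _ hjj) (h i)
          exact ⟨g, Subtype.ext hg, Subtype.ext hg'⟩
        choose g hg hg' using this
        exact ⟨g, Prod.ext (funext hg) (funext hg')⟩
      · rintro ⟨g, hg⟩ i
        have h1 := congrArg Prod.fst hg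
        have h2 := congrArg Prod.snd hg
        simp only [Prod.smul_fst, Prod.smul_snd] at h1 h2
        rw [← h1, ← h2, Pi.smul_apply', Pi.smul_apply', KS.smul_val, KS.smul_val, disjoint_map]
        exact base_disj _ _ _ _ _ _ hjj

end RM

theorem stmt10 {α : Type*} [DecidableEq α] (ℓ s : ℕ) (hl : 2 ≤ ℓ) (hs : 0 < s)
    (n k : Fin ℓ → ℕ) (hk : ∀ i, 0 < k i)
    (hratio0 : 3 * s * k ⟨0, by omega⟩ ≤ n ⟨0, by omega⟩)
    (hsorted : ∀ i j : Fin ℓ, i ≤ j → n i * k j ≤ n j * k i)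
    (V : Fin ℓ → Finset α)
    (hV : ∀ i j, i ≠ j → Disjoint (V i) (V j))
    (hVcard : ∀ i, (V i).card = n i)
    (F : Fin s → Finset (Finset α))
    (hF : ∀ t, ∀ A ∈ F t, A ⊆ Finset.univ.biUnion V ∧ ∀ i, (A ∩ V i).card = k i)
    (hrainbow : ¬ ∃ e : Fin s → Finset α, (∀ t, e t ∈ F t) ∧
      ∀ t t', t ≠ t' → Disjoint (e t) (e t')) :
    ∃ t : Fin s, ((F t).card : ℝ) <
      6 * (s : ℝ) * (k ⟨0, by omega⟩ : ℝ) / (n ⟨0, by omega⟩ : ℝ) *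
        ∏ j, ((n j).choose (k j) : ℝ) := by
  by_contra hcon
  push Not at hcon
  apply hrainbow
  set z : Fin ℓ := ⟨0, by omega⟩ with hz
  set N : ℝ := ∏ j, ((n j).choose (k j) : ℝ) with hN
  have hkz := hk z
  have hnz : 0 < n z := by
    have : 0 < 3 * s * k z := by positivity
    omega
  have hkn : ∀ i, k i ≤ n i := by
    intro i
    have h1 := hsorted z i (Fin.mk_le_of_le_val (Nat.zero_le _))
    have h2 : k z ≤ n z := by nlinarith
    have h3 : k z * k i ≤ n z * k i := Nat.mul_le_mul_right _ h2
    exact Nat.le_of_mul_le_mul_right (by linarith : k i * k z ≤ n i * k z) hkz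
  have hN0 : 0 < N := Finset.prod_pos fun i _ => by exact_mod_cast Nat.choose_pos (hkn i)
  -- the embeddings
  let em : ∀ i, Fin (n i) ↪ α := fun i =>
    ((V i).equivFinOfCardEq (hVcard i)).symm.toEmbedding.trans (Function.Embedding.subtype _)
  have hem : ∀ i v, em i v ∈ V i := fun i v => (((V i).equivFinOfCardEq (hVcard i)).symm v).2
  have hsurj : ∀ i, ∀ a ∈ V i, ∃ v, em i v = a := fun i a ha =>
    ⟨(V i).equivFinOfCardEq (hVcard i) ⟨a, ha⟩, by simp [em]⟩
  let E : (∀ i, RM.KS (n i) (k i)) → Finset α := fun x =>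
    Finset.univ.biUnion fun i => (x i).1.map (em i)
  have hEsurj : ∀ t, ∀ A ∈ F t, ∃ x, E x = A := by
    intro t A hA
    obtain ⟨h1, h2⟩ := hF t A hA
    have hB : ∀ i, (Finset.univ.filter fun v => em i v ∈ A).map (em i) = A ∩ V i := by
      intro i
      ext a
      simp only [Finset.mem_map, Finset.mem_filter, Finset.mem_univ, true_and, Finset.mem_inter]
      constructor
      · rintro ⟨v, hv, rfl⟩; exact ⟨hv, hem i v⟩
      · rintro ⟨ha, hv⟩
        obtain ⟨v, rfl⟩ := hsurj i a hv
        exact ⟨v, ha, rfl⟩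
    refine ⟨fun i => ⟨Finset.univ.filter fun v => em i v ∈ A, ?_⟩, ?_⟩
    · rw [← Finset.card_map (em i), hB, h2]
    · simp only [E, hB]
      rw [← Finset.inter_biUnion]
      exact Finset.inter_eq_left.2 h1
  let S : Fin s → Finset (∀ i, RM.KS (n i) (k i)) := fun t => Finset.univ.filter fun x => E x ∈ F t
  have hScard : ∀ t, (F t).card ≤ (S t).card := by
    intro t
    refine Finset.card_le_card_of_surjOn E ?_
    intro A hA
    obtain ⟨x, hx⟩ := hEsurj t A hA
    refine ⟨x, ?_, hx⟩
    simp only [S, Finset.coe_filter, Finset.mem_univ, true_and, Set.mem_ofPred_eq, hx]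
    exact hA
  have hSle : ∀ t, ((S t).card : ℝ) ≤ N := by
    intro t
    have h1 : (S t).card ≤ Fintype.card (∀ i, RM.KS (n i) (k i)) := Finset.card_le_univ _
    rw [Fintype.card_pi] at h1
    simp only [Fintype.card_finset_len, Fintype.card_fin] at h1
    rw [hN]
    exact_mod_cast h1
  have hkr : (0:ℝ) < k z := by exact_mod_cast hkz
  have hnr : (0:ℝ) < n z := by exact_mod_cast hnz
  have h6 : 6 * s * k z ≤ n z := by
    have h1 := hcon ⟨0, hs⟩
    have h2 : (((F ⟨0, hs⟩).card : ℕ) : ℝ) ≤ (S ⟨0, hs⟩).card := by exact_mod_cast hScard _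
    have h3 := h1.trans (h2.trans (hSle _))
    have h4 : 6 * (s:ℝ) * k z / n z ≤ 1 := by
      refine le_of_mul_le_mul_right ?_ hN0
      rw [one_mul]; exact h3
    rw [div_le_one hnr] at h4
    exact_mod_cast h4
  set m := n z / k z with hm
  have hm6 : 6 * s ≤ m := (Nat.le_div_iff_mul_le hkz).2 h6
  have hmkz : m * k z ≤ n z := Nat.div_mul_le_self _ _
  have hmlt : n z < (m + 1) * k z := by
    rw [mul_comm]; exact Nat.lt_mul_div_succ _ hkz
  have hmk : ∀ i, m * k i ≤ n i := by
    intro i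
    have h1 := hsorted z i (Fin.mk_le_of_le_val (Nat.zero_le _))
    refine Nat.le_of_mul_le_mul_right (c := k z) ?_ hkz
    calc m * k i * k z = (m * k z) * k i := by ring
      _ ≤ n z * k i := Nat.mul_le_mul_right _ hmkz
      _ ≤ _ := h1
  obtain ⟨e, he, hd⟩ := RM.main_matching ℓ s m n k hk hs hm6 hmk S (by
    intro t
    have h1 := hcon t
    have h2 : (((F t).card : ℕ) : ℝ) ≤ (S t).card := by exact_mod_cast hScard t
    have h3 := h1.trans h2
    have hmr : (n z : ℝ) < (m + 1) * k z := by exact_mod_cast hmlt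
    have hm6r : 6 * (s:ℝ) ≤ m := by exact_mod_cast hm6
    have h5 : (6 * s - 1 : ℝ) ≤ m * (6 * (s:ℝ) * k z / n z) := by
      rw [← mul_div_assoc, le_div_iff₀ hnr]
      have hs1 : (1:ℝ) ≤ s := by exact_mod_cast hs
      calc (6 * s - 1 : ℝ) * n z ≤ (6 * s - 1) * ((m + 1) * k z) :=
            mul_le_mul_of_nonneg_left hmr.le (by linarith)
        _ ≤ _ := by nlinarith
    calc _ ≤ m * (6 * (s:ℝ) * k z / n z) * N := mul_le_mul_of_nonneg_right h5 hN0.le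
      _ = m * (6 * (s:ℝ) * k z / n z * N) := by ring
      _ ≤ _ := mul_le_mul_of_nonneg_left h3 (by positivity))
  refine ⟨fun t => E (e t), fun t => (Finset.mem_filter.1 (he t)).2, fun t t' htt => ?_⟩
  rw [Finset.disjoint_left]
  intro a ha ha'
  simp only [E, Finset.mem_biUnion, Finset.mem_univ, true_and, Finset.mem_map] at ha ha'
  obtain ⟨i, v, hv, rfl⟩ := ha
  obtain ⟨i', v', hv', hvv⟩ := ha'
  have hii : i = i' := by
    by_contra h
    exact Finset.disjoint_left.1 (hV i i' h) (hem i v) (hvv ▸ hem i' v')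
  subst hii
  have := (em i).injective hvv
  subst this
  exact Finset.disjoint_left.1 (hd t t' htt i) hv hv'
end

section
/- Let $\ell, s, n_1, \dots, n_\ell, k_1, \dots, k_\ell$ be positive integers with $n_i \geq 8\ell^2 k_i^2 s$ for all $i$. Let $\mathcal{F}_1, \dots, \mathcal{F}_s \subseteq \sqcup_{i=1}^\ell \binom{V_i}{k_i}$ with $|V_i| = n_i$. If $\mathcal{F}_1, \dots, \mathcal{F}_s$ are rainbow matching free, then there exists $t \in [s]$ such that $|\mathcal{F}_t| \leq \prod_{i=1}^\ell \binom{n_i}{k_i} - \min_{x_1 + \dots + x_\ell = s-1} \prod_{i=1}^\ell \binom{n_i - x_i}{k_i}$, the minimum over nonnegative integers summing to $s-1$. -/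
namespace RainbowAux

open Finset

/-- The number of members of `F` containing `v`. -/
def deg {α : Type*} [DecidableEq α] (F : Finset (Finset α)) (v : α) : ℕ :=
  (F.filter (fun A => v ∈ A)).card

/-- The families `F t`, `t ∈ T`, have a rainbow matching. -/
def Rainbow {α ι : Type*} (T : Finset ι) (F : ι → Finset (Finset α)) : Prop :=
  ∃ e : ι → Finset α, (∀ t ∈ T, e t ∈ F t) ∧
    ∀ t ∈ T, ∀ t' ∈ T, t ≠ t' → Disjoint (e t) (e t')

variable {α ι : Type*} [DecidableEq α] [DecidableEq ι]

lemma exists_disj (F : Finset (Finset α)) (U : Finset α)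
    (h : ∑ u ∈ U, (deg F u : ℝ) < F.card) : ∃ A ∈ F, Disjoint A U := by
  by_contra hcon
  push Not at hcon
  have hsub : F ⊆ U.biUnion (fun u => F.filter (fun A => u ∈ A)) := by
    intro A hA
    obtain ⟨u, hu1, hu2⟩ := Finset.not_disjoint_iff.mp (hcon A hA)
    exact Finset.mem_biUnion.mpr ⟨u, hu2, Finset.mem_filter.mpr ⟨hA, hu1⟩⟩
  have h1 : F.card ≤ ∑ u ∈ U, deg F u :=
    (Finset.card_le_card hsub).trans Finset.card_biUnion_le
  have h2 : (F.card : ℝ) ≤ ∑ u ∈ U, (deg F u : ℝ) := by exact_mod_cast h1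
  linarith

lemma sum_biUnion_bound {ι : Type*} (T : Finset ι) (e : ι → Finset α) (p : α → ℝ) (σ : ℝ)
    (he : ∀ t ∈ T, ∑ v ∈ e t, p v ≤ σ)
    (hd : ∀ t ∈ T, ∀ t' ∈ T, t ≠ t' → Disjoint (e t) (e t')) :
    ∑ u ∈ T.biUnion e, p u ≤ T.card * σ := by
  rw [Finset.sum_biUnion (fun t ht t' ht' hne => hd t ht t' ht' hne)]
  calc _ ≤ ∑ t ∈ T, σ := Finset.sum_le_sum he
    _ = _ := by simp

/-- Closing step when a vertex of large degree is available. -/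
lemma ext_one (𝒜 : Finset (Finset α)) (p : α → ℝ) (hp : ∀ v, 0 ≤ p v)
    (N σ : ℝ) (hN : 0 ≤ N)
    (hsp : ∀ S : Finset α, ((𝒜.filter (fun A => S ⊆ A)).card : ℝ) ≤ N * ∏ v ∈ S, p v)
    (hσ : ∀ A ∈ 𝒜, ∑ v ∈ A, p v ≤ σ)
    (F : Finset (Finset α)) (hF : F ⊆ 𝒜) (S : Finset α) (hS : ∀ A ∈ F, S ⊆ A)
    (T : Finset ι) (e : ι → Finset α) (he : ∀ t ∈ T, e t ∈ 𝒜)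
    (hd : ∀ t ∈ T, ∀ t' ∈ T, t ≠ t' → Disjoint (e t) (e t'))
    (v : α) (hvS : v ∉ S) (heS : ∀ t ∈ T, Disjoint (e t) S) (hev : ∀ t ∈ T, v ∉ e t)
    (hdeg : T.card * σ * (∏ u ∈ S, p u) * p v * N < deg F v) :
    ∃ A ∈ F, Disjoint A (T.biUnion e) := by
  have key : ∑ u ∈ T.biUnion e, (deg (F.filter (fun A => v ∈ A)) u : ℝ)
      < (F.filter (fun A => v ∈ A)).card := by
    refine lt_of_le_of_lt ?_ hdeg
    calc _ ≤ ∑ u ∈ T.biUnion e, (N * ((∏ x ∈ S, p x) * p v)) * p u := by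
          apply Finset.sum_le_sum
          intro u hu
          obtain ⟨t, ht, hut⟩ := Finset.mem_biUnion.mp hu
          have huS : u ∉ S := fun h => Finset.disjoint_left.mp (heS t ht) hut h
          have huv : u ≠ v := fun h => hev t ht (h ▸ hut)
          have h1 := hsp (insert u (insert v S))
          rw [Finset.prod_insert (by simp [huS, huv]), Finset.prod_insert hvS] at h1
          have h2 : deg (F.filter (fun A => v ∈ A)) u ≤
              (𝒜.filter (fun A => insert u (insert v S) ⊆ A)).card := by
            apply Finset.card_le_card
            intro A hA
            simp only [Finset.mem_filter] at hA ⊢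
            refine ⟨hF hA.1.1, ?_⟩
            intro x hx
            simp only [Finset.mem_insert] at hx
            rcases hx with rfl | rfl | hx
            · exact hA.2
            · exact hA.1.2
            · exact hS A hA.1.1 hx
          have h3 : (deg (F.filter (fun A => v ∈ A)) u : ℝ) ≤
              (𝒜.filter (fun A => insert u (insert v S) ⊆ A)).card := by exact_mod_cast h2
          calc _ ≤ _ := h3.trans h1
            _ = _ := by ring
      _ = (N * ((∏ x ∈ S, p x) * p v)) * ∑ u ∈ T.biUnion e, p u := by rw [Finset.mul_sum]
      _ ≤ (N * ((∏ x ∈ S, p x) * p v)) * (T.card * σ) := by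
          apply mul_le_mul_of_nonneg_left
          · exact sum_biUnion_bound T e p σ (fun t ht => hσ _ (he t ht)) hd
          · exact mul_nonneg hN (mul_nonneg (Finset.prod_nonneg fun x _ => hp x) (hp v))
      _ = _ := by ring
  obtain ⟨A, hA, hA2⟩ := exists_disj _ _ key
  exact ⟨A, (Finset.mem_filter.mp hA).1, hA2⟩

/-- A rainbow matching of all but one family extends, given a disjoint member. -/
lemma rainbow_insert (T : Finset ι) (F : ι → Finset (Finset α)) (t : ι) (ht : t ∉ T)
    (e : ι → Finset α) (he : ∀ j ∈ T, e j ∈ F j)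
    (hd : ∀ j ∈ T, ∀ j' ∈ T, j ≠ j' → Disjoint (e j) (e j'))
    (A : Finset α) (hA : A ∈ F t) (hAd : Disjoint A (T.biUnion e)) :
    Rainbow (insert t T) F := by
  rw [Finset.disjoint_biUnion_right] at hAd
  have hne : ∀ j ∈ T, j ≠ t := fun j hj h => ht (h ▸ hj)
  refine ⟨Function.update e t A, ?_, ?_⟩
  · intro j hj
    rcases Finset.mem_insert.mp hj with rfl | hj
    · simpa using hA
    · rw [Function.update_of_ne (hne j hj)]; exact he j hj
  · intro j hj j' hj' hjj
    rcases Finset.mem_insert.mp hj with rfl | hj1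
    · rcases Finset.mem_insert.mp hj' with rfl | hj'
      · exact absurd rfl hjj
      · rw [Function.update_of_ne (hne j' hj'), Function.update_self]; exact hAd j' hj'
    · rcases Finset.mem_insert.mp hj' with rfl | hj'
      · rw [Function.update_of_ne (hne j hj1), Function.update_self]; exact (hAd j hj1).symm
      · rw [Function.update_of_ne (hne j hj1), Function.update_of_ne (hne j' hj')]
        exact hd j hj1 j' hj' hjj

/-- The low degree case. -/
lemma caseB [Nonempty α] (𝒜 : Finset (Finset α)) (p : α → ℝ) (hp : ∀ v, 0 ≤ p v)
    (N σ P : ℝ) (hN : 0 ≤ N) (hσ0 : 0 ≤ σ) (hP0 : 0 ≤ P) (hP : ∀ v, p v ≤ P)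
    (hσ : ∀ A ∈ 𝒜, ∑ v ∈ A, p v ≤ σ)
    (T : Finset ι) (S : ι → Finset α) (F : ι → Finset (Finset α))
    (hF : ∀ t ∈ T, F t ⊆ 𝒜)
    (hdis : ∀ t ∈ T, ∀ t' ∈ T, t ≠ t' → ∀ A ∈ F t, Disjoint A (S t'))
    (hdeg : ∀ t ∈ T, ∀ v, v ∉ S t →
      (deg (F t) v : ℝ) ≤ T.card * σ * (∏ u ∈ S t, p u) * p v * N)
    (hbig : ∀ t ∈ T, 3 * T.card * (T.card - 1) * σ * P * (∏ u ∈ S t, p u) * N < (F t).card)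
    (hL : ∀ R ⊆ T, ∀ w : ι → α, (∀ t ∈ R, ∀ t' ∈ R, w t = w t' → t = t') →
      (∀ t ∈ R, w t ∉ S t ∧
        2 * T.card * P * (∏ u ∈ S t, p u) * p (w t) * N < deg (F t) (w t)) → Rainbow R F) :
    Rainbow T F := by
  classical
  let good : Finset ι → Prop := fun R => ∃ w : ι → α,
    (∀ t ∈ R, ∀ t' ∈ R, w t = w t' → t = t') ∧
    (∀ t ∈ R, w t ∉ S t ∧ 2 * T.card * P * (∏ u ∈ S t, p u) * p (w t) * N < deg (F t) (w t))
  have hgood0 : good ∅ := ⟨fun _ => Classical.arbitrary α, by simp, by simp⟩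
  obtain ⟨R, hR, hmax⟩ := Finset.exists_max_image (T.powerset.filter good) Finset.card
    ⟨∅, by simp [hgood0]⟩
  simp only [Finset.mem_filter, Finset.mem_powerset] at hR hmax
  obtain ⟨hRT, w, hw1, hw2⟩ := hR
  obtain ⟨e0, he0, hd0⟩ := hL R hRT w hw1 hw2
  -- low degrees outside
  have hlow : ∀ j ∈ T, j ∉ R → ∀ u, u ∉ S j → u ∉ R.image w →
      (deg (F j) u : ℝ) ≤ 2 * T.card * P * (∏ u ∈ S j, p u) * p u * N := by
    intro j hj hjR u hu huw
    by_contra hcon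
    push Not at hcon
    have hne : ∀ i ∈ R, i ≠ j := fun i hi h => hjR (h ▸ hi)
    have hnw : ∀ i ∈ R, w i ≠ u := fun i hi h => huw (Finset.mem_image.mpr ⟨i, hi, h⟩)
    have hg : good (insert j R) := by
      refine ⟨Function.update w j u, ?_, ?_⟩
      · intro t ht t' ht' h
        rcases Finset.mem_insert.mp ht with rfl | ht1
        · rcases Finset.mem_insert.mp ht' with rfl | ht'
          · rfl
          · rw [Function.update_self, Function.update_of_ne (hne _ ht')] at h
            exact absurd h.symm (hnw _ ht')
        · rcases Finset.mem_insert.mp ht' with rfl | ht'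
          · rw [Function.update_self, Function.update_of_ne (hne _ ht1)] at h
            exact absurd h (hnw _ ht1)
          · rw [Function.update_of_ne (hne _ ht1), Function.update_of_ne (hne _ ht')] at h
            exact hw1 t ht1 t' ht' h
      · intro t ht
        rcases Finset.mem_insert.mp ht with rfl | ht
        · rw [Function.update_self]; exact ⟨hu, hcon⟩
        · rw [Function.update_of_ne (hne _ ht)]; exact hw2 t ht
    have := hmax (insert j R) ⟨Finset.insert_subset hj hRT, hg⟩
    rw [Finset.card_insert_of_notMem hjR] at this
    omega
  have hgreedy : ∀ Q : Finset ι, Q ⊆ T \ R → Rainbow (Q ∪ R) F := by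
    intro Q
    induction Q using Finset.induction_on with
    | empty => intro _; simpa using ⟨e0, he0, hd0⟩
    | insert a Q haQ ih =>
      intro hsub
      obtain ⟨e, he, hd⟩ := ih ((Finset.subset_insert a Q).trans hsub)
      have ha := hsub (Finset.mem_insert_self a Q)
      rw [Finset.mem_sdiff] at ha
      obtain ⟨haT, haR⟩ := ha
      have haU : a ∉ Q ∪ R := by simp [haQ, haR]
      have hUT : Q ∪ R ⊆ T := Finset.union_subset
        (((Finset.subset_insert a Q).trans hsub).trans Finset.sdiff_subset) hRT
      have hcard : (Q ∪ R).card + 1 ≤ T.card := by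
        rw [← Finset.card_insert_of_notMem haU]
        exact Finset.card_le_card (Finset.insert_subset haT hUT)
      have hcardR : R.card ≤ (Q ∪ R).card := Finset.card_le_card Finset.subset_union_right
      have hc1 : ((Q ∪ R).card : ℝ) ≤ T.card - 1 := by
        have : (((Q ∪ R).card + 1 : ℕ) : ℝ) ≤ T.card := by exact_mod_cast hcard
        push_cast at this; linarith
      have hc2 : (R.card : ℝ) ≤ T.card - 1 := le_trans (by exact_mod_cast hcardR) hc1
      set q := ∏ u ∈ S a, p u with hq
      have hq0 : 0 ≤ q := Finset.prod_nonneg fun x _ => hp x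
      set U := (Q ∪ R).biUnion e with hU
      have hUS : ∀ u ∈ U, u ∉ S a := by
        intro u hu huS
        obtain ⟨t, ht, hut⟩ := Finset.mem_biUnion.mp hu
        have hta : t ≠ a := fun h => haU (h ▸ ht)
        exact Finset.disjoint_left.mp (hdis t (hUT ht) a haT hta _ (he t ht)) hut huS
      have hsum : ∑ u ∈ U, p u ≤ (T.card - 1) * σ :=
        (sum_biUnion_bound (Q ∪ R) e p σ
          (fun t ht => hσ _ (hF t (hUT ht) (he t ht))) hd).trans
          (mul_le_mul_of_nonneg_right hc1 hσ0)
      have hT0 : (0 : ℝ) ≤ T.card := Nat.cast_nonneg _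
      have hsmall : ∑ u ∈ U, (deg (F a) u : ℝ) < (F a).card := by
        refine lt_of_le_of_lt ?_ (hbig a haT)
        rw [← Finset.sum_filter_add_sum_filter_not U (fun u => u ∈ R.image w)]
        have p1 : ∑ u ∈ U.filter (fun u => u ∈ R.image w), (deg (F a) u : ℝ)
            ≤ (T.card - 1) * (T.card * σ * q * P * N) := by
          calc _ ≤ ∑ u ∈ U.filter (fun u => u ∈ R.image w), T.card * σ * q * P * N := by
                apply Finset.sum_le_sum
                intro u hu
                refine (hdeg a haT u (hUS u (Finset.mem_filter.mp hu).1)).trans ?_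
                have := hP u
                gcongr
            _ = (U.filter (fun u => u ∈ R.image w)).card * (T.card * σ * q * P * N) := by simp
            _ ≤ _ := by
                apply mul_le_mul_of_nonneg_right _ (by positivity)
                refine le_trans ?_ hc2
                have : (U.filter (fun u => u ∈ R.image w)).card ≤ R.card := by
                  refine le_trans (Finset.card_le_card ?_) (Finset.card_image_le (f := w))
                  intro u hu
                  exact (Finset.mem_filter.mp hu).2
                exact_mod_cast this
        have p2 : ∑ u ∈ U.filter (fun u => ¬ u ∈ R.image w), (deg (F a) u : ℝ)
            ≤ (2 * T.card * P * q * N) * ((T.card - 1) * σ) := by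
          calc _ ≤ ∑ u ∈ U.filter (fun u => ¬ u ∈ R.image w), (2 * T.card * P * q * N) * p u := by
                apply Finset.sum_le_sum
                intro u hu
                rw [Finset.mem_filter] at hu
                refine (hlow a haT haR u (hUS u hu.1) hu.2).trans (le_of_eq ?_)
                ring
            _ ≤ ∑ u ∈ U, (2 * T.card * P * q * N) * p u := by
                apply Finset.sum_le_sum_of_subset_of_nonneg (Finset.filter_subset _ _)
                intro u _ _
                have := hp u
                positivity
            _ = (2 * T.card * P * q * N) * ∑ u ∈ U, p u := by rw [Finset.mul_sum]
            _ ≤ _ := mul_le_mul_of_nonneg_left hsum (by positivity)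
        calc _ ≤ _ := add_le_add p1 p2
          _ = _ := by ring
      obtain ⟨A, hA, hAd⟩ := exists_disj _ _ hsmall
      have := rainbow_insert (Q ∪ R) F a haU e he hd A hA hAd
      rwa [Finset.insert_union]
  have := hgreedy (T \ R) subset_rfl
  rwa [Finset.sdiff_union_of_subset hRT] at this

/-- Passing to links at the distinct vertices `w t`. -/
lemma link_step (𝒜 : Finset (Finset α)) (p : α → ℝ) (hp : ∀ v, 0 ≤ p v)
    (N P : ℝ) (hN : 0 ≤ N) (hP0 : 0 ≤ P) (hP : ∀ v, p v ≤ P)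
    (hsp : ∀ S : Finset α, ((𝒜.filter (fun A => S ⊆ A)).card : ℝ) ≤ N * ∏ v ∈ S, p v)
    (T : Finset ι) (S : ι → Finset α) (F : ι → Finset (Finset α))
    (hF : ∀ t ∈ T, F t ⊆ 𝒜) (hS : ∀ t ∈ T, ∀ A ∈ F t, S t ⊆ A)
    (hdis : ∀ t ∈ T, ∀ t' ∈ T, t ≠ t' → ∀ A ∈ F t, Disjoint A (S t'))
    (R : Finset ι) (hR : R ⊆ T) (w : ι → α)
    (hw1 : ∀ t ∈ R, ∀ t' ∈ R, w t = w t' → t = t')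
    (hw2 : ∀ t ∈ R, w t ∉ S t ∧
        2 * T.card * P * (∏ u ∈ S t, p u) * p (w t) * N < deg (F t) (w t))
    (hL : ∀ F' : ι → Finset (Finset α), (∀ t ∈ R, F' t ⊆ 𝒜) →
      (∀ t ∈ R, ∀ A ∈ F' t, insert (w t) (S t) ⊆ A) →
      (∀ t ∈ R, ∀ t' ∈ R, t ≠ t' → ∀ A ∈ F' t, Disjoint A (insert (w t') (S t'))) →
      (∀ t ∈ R, R.card * P * (∏ u ∈ insert (w t) (S t), p u) * N < (F' t).card) →
      Rainbow R F') : Rainbow R F := by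
  classical
  let F' : ι → Finset (Finset α) := fun t =>
    (F t).filter (fun A => w t ∈ A ∧ ∀ t' ∈ R, t' ≠ t → w t' ∉ A)
  have hsub : ∀ t, F' t ⊆ F t := fun t => Finset.filter_subset _ _
  suffices hRF : Rainbow R F' by
    obtain ⟨e, he, hd⟩ := hRF
    exact ⟨e, fun t ht => hsub t (he t ht), hd⟩
  refine hL F' (fun t ht => (hsub t).trans (hF t (hR ht))) ?_ ?_ ?_
  · intro t ht A hA
    have hA' := Finset.mem_filter.mp hA
    exact Finset.insert_subset hA'.2.1 (hS t (hR ht) A hA'.1)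
  · intro t ht t' ht' hne A hA
    have hA' := Finset.mem_filter.mp hA
    rw [Finset.disjoint_insert_right]
    exact ⟨hA'.2.2 t' ht' hne.symm, hdis t (hR ht) t' (hR ht') hne A hA'.1⟩
  · intro t ht
    obtain ⟨hwS, hwd⟩ := hw2 t ht
    rw [Finset.prod_insert hwS]
    set q := ∏ u ∈ S t, p u with hq
    have hq0 : 0 ≤ q := Finset.prod_nonneg fun x _ => hp x
    have hpw := hp (w t)
    have hRT : (R.card : ℝ) ≤ T.card := by exact_mod_cast Finset.card_le_card hR
    -- bound the lost members
    have hcov : (F t).filter (fun A => w t ∈ A) ⊆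
        F' t ∪ (R.erase t).biUnion
          (fun t' => 𝒜.filter (fun A => insert (w t') (insert (w t) (S t)) ⊆ A)) := by
      intro A hA
      rw [Finset.mem_filter] at hA
      by_cases hbad : ∀ t' ∈ R, t' ≠ t → w t' ∉ A
      · exact Finset.mem_union_left _ (Finset.mem_filter.mpr ⟨hA.1, hA.2, hbad⟩)
      · push Not at hbad
        obtain ⟨t', ht', hne, hwt'⟩ := hbad
        apply Finset.mem_union_right
        rw [Finset.mem_biUnion]
        refine ⟨t', Finset.mem_erase.mpr ⟨hne, ht'⟩, Finset.mem_filter.mpr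
          ⟨hF t (hR ht) hA.1, ?_⟩⟩
        exact Finset.insert_subset hwt' (Finset.insert_subset hA.2 (hS t (hR ht) A hA.1))
    have hc : deg (F t) (w t) ≤ (F' t).card + ∑ t' ∈ R.erase t,
        (𝒜.filter (fun A => insert (w t') (insert (w t) (S t)) ⊆ A)).card :=
      (Finset.card_le_card hcov).trans ((Finset.card_union_le _ _).trans
        (Nat.add_le_add_left Finset.card_biUnion_le _))
    have hc' : (deg (F t) (w t) : ℝ) ≤ (F' t).card + ∑ t' ∈ R.erase t,
        ((𝒜.filter (fun A => insert (w t') (insert (w t) (S t)) ⊆ A)).card : ℝ) := by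
      exact_mod_cast hc
    have hs : ∑ t' ∈ R.erase t,
        ((𝒜.filter (fun A => insert (w t') (insert (w t) (S t)) ⊆ A)).card : ℝ)
        ≤ T.card * (N * (P * (p (w t) * q))) := by
      calc _ ≤ ∑ t' ∈ R.erase t, N * (P * (p (w t) * q)) := by
            apply Finset.sum_le_sum
            intro t' ht'
            rw [Finset.mem_erase] at ht'
            by_cases hin : w t' ∈ S t
            · exfalso
              have hdpos : 0 < deg (F t') (w t') := by
                have h2 := (hw2 t' ht'.2).2
                have : (0 : ℝ) < deg (F t') (w t') := lt_of_le_of_lt (by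
                  have := hp (w t')
                  have : 0 ≤ ∏ u ∈ S t', p u := Finset.prod_nonneg fun x _ => hp x
                  positivity) h2
                exact_mod_cast this
              obtain ⟨A, hA⟩ := Finset.card_pos.mp hdpos
              rw [Finset.mem_filter] at hA
              exact Finset.disjoint_left.mp
                (hdis t' (hR ht'.2) t (hR ht) ht'.1 A hA.1) hA.2 hin
            have h1 := hsp (insert (w t') (insert (w t) (S t)))
            have hne : w t' ≠ w t := fun h => ht'.1 (hw1 t' ht'.2 t ht h)
            rw [Finset.prod_insert (by simp [hne, hin]), Finset.prod_insert hwS] at h1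
            refine h1.trans ?_
            have := hP (w t')
            gcongr
        _ = (R.erase t).card * (N * (P * (p (w t) * q))) := by simp
        _ ≤ _ := by
            apply mul_le_mul_of_nonneg_right _ (by positivity)
            refine le_trans ?_ hRT
            exact_mod_cast Finset.card_le_card (Finset.erase_subset t R)
    have hfin : R.card * P * (p (w t) * q) * N ≤ T.card * (N * (P * (p (w t) * q))) := by
      calc _ = R.card * (N * (P * (p (w t) * q))) := by ring
        _ ≤ _ := mul_le_mul_of_nonneg_right hRT (by positivity)
    have hx : 2 * T.card * P * q * p (w t) * N = 2 * (T.card * (N * (P * (p (w t) * q)))) := by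
      ring
    linarith

/-- Rainbow matchings in spread families, with stems. -/
lemma spread_rainbow [Nonempty α] (𝒜 : Finset (Finset α)) (p : α → ℝ) (hp : ∀ v, 0 ≤ p v)
    (N σ P : ℝ) (hN : 0 ≤ N) (hσ0 : 0 ≤ σ) (hP0 : 0 ≤ P) (hP : ∀ v, p v ≤ P)
    (hsp : ∀ S : Finset α, ((𝒜.filter (fun A => S ⊆ A)).card : ℝ) ≤ N * ∏ v ∈ S, p v)
    (hσ : ∀ A ∈ 𝒜, ∑ v ∈ A, p v ≤ σ) (K : ℕ) (hK : ∀ A ∈ 𝒜, A.card ≤ K) (m : ℕ) :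
    ∀ (T : Finset ι) (S : ι → Finset α) (F : ι → Finset (Finset α)),
    ∑ t ∈ T, (K + 1 - (S t).card) = m →
    (∀ t ∈ T, F t ⊆ 𝒜) → (∀ t ∈ T, ∀ A ∈ F t, S t ⊆ A) →
    (∀ t ∈ T, ∀ t' ∈ T, t ≠ t' → ∀ A ∈ F t, Disjoint A (S t')) →
    3 * T.card * σ ≤ 1 →
    (∀ t ∈ T, T.card * P * (∏ u ∈ S t, p u) * N < (F t).card) →
    Rainbow T F := by
  classical
  induction m using Nat.strong_induction_on with
  | _ m ih =>
  intro T S F hm hF hS hdis hTσ hbig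
  have hq : ∀ t, 0 ≤ ∏ u ∈ S t, p u := fun t => Finset.prod_nonneg fun x _ => hp x
  have hScard : ∀ t ∈ T, (S t).card ≤ K := by
    intro t ht
    have : (0 : ℝ) < (F t).card := lt_of_le_of_lt (by have := hq t; positivity) (hbig t ht)
    obtain ⟨A, hA⟩ := Finset.card_pos.mp (by exact_mod_cast this)
    exact (Finset.card_le_card (hS t ht A hA)).trans (hK A (hF t ht hA))
  by_cases hA : ∃ t ∈ T, ∃ v, v ∉ S t ∧
      T.card * σ * (∏ u ∈ S t, p u) * p v * N < deg (F t) v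
  · obtain ⟨t, ht, v, hvS, hdeg⟩ := hA
    have hpv := hp v
    have hcard : ((T.erase t).card : ℝ) = T.card - 1 := by
      rw [Finset.card_erase_of_mem ht, Nat.cast_sub (Finset.card_pos.mpr ⟨t, ht⟩)]; simp
    have hTc : ((T.erase t).card : ℝ) ≤ T.card := by linarith
    have hsum : ∑ j ∈ T.erase t, (K + 1 - (S j).card) < m := by
      rw [← hm, ← Finset.add_sum_erase T _ ht]
      have := hScard t ht
      omega
    have hvnot : ∀ j ∈ T, j ≠ t → v ∉ S j := by
      intro j hj hjt hvj
      have : (0 : ℝ) < deg (F t) v :=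
        lt_of_le_of_lt (by have := hq t; positivity) hdeg
      obtain ⟨A, hA⟩ := Finset.card_pos.mp (show 0 < deg (F t) v by exact_mod_cast this)
      rw [Finset.mem_filter] at hA
      exact Finset.disjoint_left.mp (hdis t ht j hj hjt.symm A hA.1) hA.2 hvj
    obtain ⟨e, he, hd⟩ := ih _ hsum (T.erase t) S (fun j => (F j).filter (fun A => v ∉ A)) rfl
      (fun j hj => (Finset.filter_subset _ _).trans (hF j (Finset.mem_of_mem_erase hj)))
      (fun j hj A hA => hS j (Finset.mem_of_mem_erase hj) A (Finset.mem_filter.mp hA).1)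
      (fun j hj j' hj' hne A hA => hdis j (Finset.mem_of_mem_erase hj) j'
        (Finset.mem_of_mem_erase hj') hne A (Finset.mem_filter.mp hA).1)
      (le_trans (by gcongr) hTσ)
      (by
        intro j hj
        rw [Finset.mem_erase] at hj
        have h1 := hbig j hj.2
        have h2 : ((F j).filter (fun A => v ∈ A)).card + ((F j).filter (fun A => v ∉ A)).card
          = (F j).card := Finset.card_filter_add_card_filter_not _
        have h3 := hsp (insert v (S j))
        rw [Finset.prod_insert (hvnot j hj.2 hj.1)] at h3
        have h4 : ((F j).filter (fun A => v ∈ A)).card ≤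
            (𝒜.filter (fun A => insert v (S j) ⊆ A)).card := by
          apply Finset.card_le_card
          intro A hA
          rw [Finset.mem_filter] at hA ⊢
          exact ⟨hF j hj.2 hA.1, Finset.insert_subset hA.2 (hS j hj.2 A hA.1)⟩
        have h2' : (((F j).filter (fun A => v ∈ A)).card : ℝ)
          + ((F j).filter (fun A => v ∉ A)).card = (F j).card := by exact_mod_cast h2
        have h4' : (((F j).filter (fun A => v ∈ A)).card : ℝ) ≤
            (𝒜.filter (fun A => insert v (S j) ⊆ A)).card := by exact_mod_cast h4
        have h5 : N * (p v * ∏ u ∈ S j, p u) ≤ N * (P * ∏ u ∈ S j, p u) := by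
          have := hP v
          have := hq j
          gcongr
        rw [hcard]
        have h6 : (T.card - 1) * P * (∏ u ∈ S j, p u) * N
          = T.card * P * (∏ u ∈ S j, p u) * N - N * (P * ∏ u ∈ S j, p u) := by ring
        linarith)
    have he' : ∀ j ∈ T.erase t, e j ∈ F j ∧ v ∉ e j := fun j hj =>
      Finset.mem_filter.mp (he j hj)
    obtain ⟨A, hA, hAd⟩ := ext_one 𝒜 p hp N σ hN hsp hσ (F t) (hF t ht) (S t) (hS t ht)
      (T.erase t) e (fun j hj => hF j (Finset.mem_of_mem_erase hj) (he' j hj).1) hd v hvS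
      (fun j hj => hdis j (Finset.mem_of_mem_erase hj) t ht (Finset.ne_of_mem_erase hj) _
        (he' j hj).1)
      (fun j hj => (he' j hj).2)
      (lt_of_le_of_lt (by have := hq t; gcongr) hdeg)
    have := rainbow_insert (T.erase t) F t (Finset.notMem_erase t T) e
      (fun j hj => (he' j hj).1) hd A hA hAd
    rwa [Finset.insert_erase ht] at this
  · push Not at hA
    apply caseB 𝒜 p hp N σ P hN hσ0 hP0 hP hσ T S F hF hdis hA
    · intro t ht
      refine lt_of_le_of_lt ?_ (hbig t ht)
      have h1 : (0 : ℝ) ≤ T.card * P * (∏ u ∈ S t, p u) * N := by have := hq t; positivity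
      have h2 : 3 * (T.card - 1) * σ ≤ 1 := by nlinarith
      calc _ = (3 * (T.card - 1) * σ) * (T.card * P * (∏ u ∈ S t, p u) * N) := by ring
        _ ≤ 1 * (T.card * P * (∏ u ∈ S t, p u) * N) := mul_le_mul_of_nonneg_right h2 h1
        _ = _ := one_mul _
    · intro R hR w hw1 hw2
      rcases R.eq_empty_or_nonempty with rfl | hRne
      · exact ⟨fun _ => ∅, by simp, by simp⟩
      apply link_step 𝒜 p hp N P hN hP0 hP hsp T S F hF hS hdis R hR w hw1 hw2
      intro F' h1 h2 h3 h4
      refine ih _ ?_ R (fun t => insert (w t) (S t)) F' rfl h1 h2 h3 ?_ h4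
      · rw [← hm]
        refine lt_of_lt_of_le (Finset.sum_lt_sum_of_nonempty hRne ?_)
          (Finset.sum_le_sum_of_subset hR)
        intro t ht
        have := hScard t (hR ht)
        rw [Finset.card_insert_of_notMem (hw2 t ht).1]
        omega
      · refine le_trans ?_ hTσ
        have : (R.card : ℝ) ≤ T.card := by exact_mod_cast Finset.card_le_card hR
        gcongr

lemma choose_link (n k a : ℕ) (hk : k ≤ n) (ha : a ≤ k) (hn : 0 < n) :
    ((n - a).choose (k - a) : ℝ) ≤ n.choose k * ((k : ℝ) / n) ^ a := by
  induction a with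
  | zero => simp
  | succ a ih =>
    have ih := ih (by omega)
    obtain ⟨m, hm⟩ : ∃ m, n - a = m + 1 := ⟨n - a - 1, by omega⟩
    obtain ⟨j, hj⟩ : ∃ j, k - a = j + 1 := ⟨k - a - 1, by omega⟩
    have e1 : n - (a + 1) = m := by omega
    have e2 : k - (a + 1) = j := by omega
    rw [e1, e2]
    rw [hm, hj] at ih
    have h := Nat.add_one_mul_choose_eq m j
    have h' : ((m : ℝ) + 1) * m.choose j = (m + 1).choose (j + 1) * (j + 1) := by
      exact_mod_cast h
    have hn' : (0 : ℝ) < n := by exact_mod_cast hn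
    have hr : ((j : ℝ) + 1) / (m + 1) ≤ k / n := by
      rw [div_le_div_iff₀ (by positivity) hn']
      have hnm : (n : ℝ) = m + 1 + a := by
        have : n = m + 1 + a := by omega
        exact_mod_cast this
      have hkj : (k : ℝ) = j + 1 + a := by
        have : k = j + 1 + a := by omega
        exact_mod_cast this
      have hjm : (j : ℝ) ≤ m := by
        have : j ≤ m := by omega
        exact_mod_cast this
      rw [hnm, hkj]
      have : (0 : ℝ) ≤ a := Nat.cast_nonneg _
      nlinarith
    have hm0 : (0 : ℝ) < (m : ℝ) + 1 := by positivity
    calc (m.choose j : ℝ) = (m + 1).choose (j + 1) * (((j : ℝ) + 1) / (m + 1)) := by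
          field_simp; linarith
      _ ≤ (n.choose k * ((k : ℝ) / n) ^ a) * (k / n) := by gcongr
      _ = _ := by ring

lemma choose_del (n k m : ℕ) (hm : m + k ≤ n) (hn : 0 < n) (hk : 0 < k) :
    ((n - m).choose k : ℝ) ≤ n.choose k * (1 - (k : ℝ) / n) ^ m := by
  induction m with
  | zero => simp
  | succ m ih =>
    have ih := ih (by omega)
    obtain ⟨r, hr⟩ : ∃ r, n - m = r + 1 := ⟨n - m - 1, by omega⟩
    have e1 : n - (m + 1) = r := by omega
    rw [e1]
    rw [hr] at ih
    have h := Nat.choose_mul_succ_eq r k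
    have hkr : k ≤ r + 1 := by omega
    have h' : (r.choose k : ℝ) * (r + 1) = (r + 1).choose k * (r + 1 - k) := by
      have := congrArg (Nat.cast : ℕ → ℝ) h
      push_cast [Nat.cast_sub hkr] at this
      exact this
    have hn' : (0 : ℝ) < n := by exact_mod_cast hn
    have hr0 : (0 : ℝ) < (r : ℝ) + 1 := by positivity
    have hrn : (r : ℝ) + 1 ≤ n := by
      have : r + 1 ≤ n := by omega
      exact_mod_cast this
    have hkr' : (k : ℝ) ≤ r + 1 := by exact_mod_cast hkr
    have h1 : (k : ℝ) / n ≤ k / (r + 1) := by gcongr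
    have h2 : (k : ℝ) / (r + 1) ≤ 1 := by rw [div_le_one hr0]; exact hkr'
    calc (r.choose k : ℝ) = (r + 1).choose k * (1 - (k : ℝ) / (r + 1)) := by
          field_simp; linarith
      _ ≤ (n.choose k * (1 - (k : ℝ) / n) ^ m) * (1 - k / n) := by
          apply mul_le_mul ih (by linarith) (by linarith)
          have : (0 : ℝ) ≤ 1 - k / n := by linarith
          positivity
      _ = _ := by ring

lemma spread_single (W S : Finset α) (k : ℕ) (hk : k ≤ W.card) (hW : 0 < W.card) (hS : S ⊆ W) :
    (((W.powersetCard k).filter (fun B => S ⊆ B)).card : ℝ)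
      ≤ W.card.choose k * ((k : ℝ) / W.card) ^ S.card := by
  by_cases hSk : S.card ≤ k
  · refine le_trans ?_ (choose_link W.card k S.card hk hSk hW)
    have : ((W.powersetCard k).filter (fun B => S ⊆ B)).card
        ≤ ((W \ S).powersetCard (k - S.card)).card := by
      apply Finset.card_le_card_of_injOn (fun B => B \ S)
      · intro B hB
        simp only [Finset.coe_filter, Finset.mem_powersetCard, Set.mem_ofPred_eq] at hB
        simp only [Finset.mem_coe,
          Finset.mem_powersetCard]
        refine ⟨Finset.sdiff_subset_sdiff hB.1.1 subset_rfl, ?_⟩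
        rw [Finset.card_sdiff_of_subset hB.2, hB.1.2]
      · intro B hB C hC h
        simp only [Finset.coe_filter, Finset.mem_powersetCard, Set.mem_ofPred_eq] at hB hC
        simp only at h
        rw [← Finset.sdiff_union_of_subset hB.2, ← Finset.sdiff_union_of_subset hC.2, h]
    rw [Finset.card_powersetCard, Finset.card_sdiff_of_subset hS] at this
    exact_mod_cast this
  · have : (W.powersetCard k).filter (fun B => S ⊆ B) = ∅ := by
      rw [Finset.filter_eq_empty_iff]
      intro B hB hSB
      have := Finset.card_le_card hSB
      rw [(Finset.mem_powersetCard.mp hB).2] at this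
      exact hSk this
    rw [this]
    simp only [Finset.card_empty, Nat.cast_zero]
    positivity

/-- The direct product of the families `V i` choose `k i`. -/
def prodFam {ℓ : ℕ} (V : Fin ℓ → Finset α) (k : Fin ℓ → ℕ) : Finset (Finset α) :=
  ((Finset.univ.biUnion V).powerset).filter (fun A => ∀ i, (A ∩ V i).card = k i)

/-- The weight of a vertex. -/
noncomputable def wt {ℓ : ℕ} (V : Fin ℓ → Finset α) (k n : Fin ℓ → ℕ) (v : α) : ℝ :=
  ∑ i, if v ∈ V i then (k i : ℝ) / n i else 0

lemma wt_eq {ℓ : ℕ} (V : Fin ℓ → Finset α) (k n : Fin ℓ → ℕ)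
    (hV : ∀ i j, i ≠ j → Disjoint (V i) (V j)) (v : α) (i : Fin ℓ) (hv : v ∈ V i) :
    wt V k n v = (k i : ℝ) / n i := by
  unfold wt
  rw [Finset.sum_eq_single i]
  · simp [hv]
  · intro j _ hj
    rw [if_neg]
    exact fun h => Finset.disjoint_left.mp (hV j i hj) h hv
  · simp

lemma wt_nonneg {ℓ : ℕ} (V : Fin ℓ → Finset α) (k n : Fin ℓ → ℕ) (v : α) :
    0 ≤ wt V k n v := by
  apply Finset.sum_nonneg
  intro i _
  split_ifs <;> positivity

lemma wt_sum {ℓ : ℕ} (V : Fin ℓ → Finset α) (k n : Fin ℓ → ℕ) (A : Finset α)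
    (hA : A ∈ prodFam V k) : ∑ v ∈ A, wt V k n v = ∑ i, (k i : ℝ) * (k i / n i) := by
  unfold wt
  rw [Finset.sum_comm]
  apply Finset.sum_congr rfl
  intro i _
  rw [← Finset.sum_filter, Finset.filter_mem_eq_inter, Finset.sum_const,
    (Finset.mem_filter.mp hA).2 i, nsmul_eq_mul]

lemma prod_spread {ℓ : ℕ} (V : Fin ℓ → Finset α) (k n : Fin ℓ → ℕ)
    (hV : ∀ i j, i ≠ j → Disjoint (V i) (V j)) (hc : ∀ i, (V i).card = n i)
    (hkn : ∀ i, k i ≤ n i) (hn : ∀ i, 0 < n i) (S : Finset α) :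
    (((prodFam V k).filter (fun A => S ⊆ A)).card : ℝ)
      ≤ (∏ i, ((n i).choose (k i) : ℝ)) * ∏ v ∈ S, wt V k n v := by
  classical
  by_cases hS : S ⊆ Finset.univ.biUnion V
  · have h1 : ((prodFam V k).filter (fun A => S ⊆ A)).card ≤
        (Fintype.piFinset (fun i => ((V i).powersetCard (k i)).filter
          (fun B => S ∩ V i ⊆ B))).card := by
      apply Finset.card_le_card_of_injOn (fun A i => A ∩ V i)
      · intro A hA
        simp only [prodFam, Finset.coe_filter, Finset.mem_filter, Finset.mem_powerset,
          Set.mem_ofPred_eq] at hA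
        simp only [Finset.mem_coe, Fintype.mem_piFinset, Finset.mem_filter,
          Finset.mem_powersetCard]
        exact fun i => ⟨⟨Finset.inter_subset_right, hA.1.2 i⟩,
          Finset.inter_subset_inter_right hA.2⟩
      · intro A hA B hB h
        simp only [prodFam, Finset.coe_filter, Finset.mem_filter, Finset.mem_powerset,
          Set.mem_ofPred_eq] at hA hB
        have hh : ∀ i, A ∩ V i = B ∩ V i := fun i => congrFun h i
        ext x
        constructor
        · intro hx
          obtain ⟨i, _, hi⟩ := Finset.mem_biUnion.mp (hA.1.1 hx)
          have : x ∈ A ∩ V i := Finset.mem_inter.mpr ⟨hx, hi⟩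
          rw [hh i] at this
          exact (Finset.mem_inter.mp this).1
        · intro hx
          obtain ⟨i, _, hi⟩ := Finset.mem_biUnion.mp (hB.1.1 hx)
          have : x ∈ B ∩ V i := Finset.mem_inter.mpr ⟨hx, hi⟩
          rw [← hh i] at this
          exact (Finset.mem_inter.mp this).1
    rw [Fintype.card_piFinset] at h1
    have h2 : ∏ v ∈ S, wt V k n v = ∏ i, ((k i : ℝ) / n i) ^ (S ∩ V i).card := by
      have hSe : S = Finset.univ.biUnion (fun i => S ∩ V i) := by
        rw [← Finset.inter_biUnion, Finset.inter_eq_left.mpr hS]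
      conv_lhs => rw [hSe]
      rw [Finset.prod_biUnion]
      · apply Finset.prod_congr rfl
        intro i _
        rw [Finset.prod_congr rfl (fun v hv => wt_eq V k n hV v i (Finset.mem_inter.mp hv).2)]
        rw [Finset.prod_const]
      · intro i _ j _ hij
        exact (hV i j hij).mono Finset.inter_subset_right Finset.inter_subset_right
    rw [h2, ← Finset.prod_mul_distrib]
    have h1' : (((prodFam V k).filter (fun A => S ⊆ A)).card : ℝ) ≤
        ∏ i, ((((V i).powersetCard (k i)).filter (fun B => S ∩ V i ⊆ B)).card : ℝ) := by
      exact_mod_cast h1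
    refine h1'.trans (Finset.prod_le_prod (fun i _ => by positivity) ?_)
    intro i _
    have := spread_single (V i) (S ∩ V i) (k i) (by rw [hc]; exact hkn i)
      (by rw [hc]; exact hn i) Finset.inter_subset_right
    rwa [hc] at this
  · have : (prodFam V k).filter (fun A => S ⊆ A) = ∅ := by
      rw [Finset.filter_eq_empty_iff]
      intro A hA hSA
      exact hS (hSA.trans (Finset.mem_powerset.mp (Finset.mem_filter.mp hA).1))
    rw [this]
    simp only [Finset.card_empty, Nat.cast_zero]
    exact mul_nonneg (Finset.prod_nonneg fun i _ => by positivity)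
      (Finset.prod_nonneg fun v _ => wt_nonneg V k n v)

lemma pow_bound (P : ℝ) (h0 : 0 ≤ P) (h1 : P ≤ 1) (m : ℕ) (hm : m * P ≤ 1) :
    (1 - P) ^ m ≤ 1 - 3 / 8 * (m * P) := by
  have hb : 1 + (m : ℝ) * P ≤ (1 + P) ^ m := one_add_mul_le_pow (by linarith) m
  have hx : 0 ≤ (m : ℝ) * P := by positivity
  have h2 : (1 - P) ^ m * (1 + P) ^ m ≤ 1 := by
    rw [← mul_pow]
    apply pow_le_one₀ <;> nlinarith
  have h3 : 0 ≤ (1 - P) ^ m := pow_nonneg (by linarith) m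
  have h4 : (1 - P) ^ m * (1 + m * P) ≤ 1 := le_trans (by gcongr) h2
  have h5 : 1 ≤ (1 - 3 / 8 * (m * P)) * (1 + m * P) := by nlinarith
  have h6 : (0 : ℝ) < 1 + m * P := by linarith
  exact le_of_mul_le_mul_right (h4.trans h5) h6

lemma main_aux [Nonempty α] {ℓ : ℕ} (hl : 0 < ℓ) (k : Fin ℓ → ℕ) (hk : ∀ i, 0 < k i) (s : ℕ) :
    ∀ (T : Finset ι), T.card = s → ∀ (n : Fin ℓ → ℕ) (V : Fin ℓ → Finset α)
      (F : ι → Finset (Finset α)),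
      (∀ i, 8 * ℓ ^ 2 * (k i) ^ 2 * s ≤ n i) →
      (∀ i j, i ≠ j → Disjoint (V i) (V j)) → (∀ i, (V i).card = n i) →
      (∀ t ∈ T, F t ⊆ prodFam V k) →
      (∀ t ∈ T, ∀ x : Fin ℓ → ℕ, ∑ i, x i + 1 = s →
        ∏ i, (n i).choose (k i) < (F t).card + ∏ i, (n i - x i).choose (k i)) →
      Rainbow T F := by
  classical
  induction s with
  | zero =>
    intro T hT n V F _ _ _ _ _
    rw [Finset.card_eq_zero] at hT
    subst hT
    exact ⟨fun _ => ∅, by simp, by simp⟩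
  | succ m ih =>
    intro T hT n V F hn hV hc hF hbig
    have hl2 : 1 ≤ ℓ ^ 2 := Nat.one_le_pow _ _ hl
    have hnk : ∀ i, 8 * (k i * (m + 1)) ≤ n i := by
      intro i
      refine le_trans ?_ (hn i)
      have h1 := hk i
      calc 8 * (k i * (m + 1)) = 8 * 1 * (k i) * (m + 1) := by ring
        _ ≤ 8 * ℓ ^ 2 * (k i) ^ 2 * (m + 1) := by
          gcongr
          nlinarith
    have hkm : ∀ i, k i + m ≤ k i * (m + 1) := by
      intro i; have := hk i; nlinarith
    have hkn : ∀ i, k i ≤ n i := fun i => by have := hnk i; have := hkm i; omega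
    have hn0 : ∀ i, 0 < n i := fun i => lt_of_lt_of_le (hk i) (hkn i)
    have hn0' : ∀ i, (0 : ℝ) < n i := fun i => by exact_mod_cast hn0 i
    set p := wt V k n with hpdef
    have hp : ∀ v, 0 ≤ p v := wt_nonneg V k n
    set N : ℝ := ∏ i, ((n i).choose (k i) : ℝ) with hNdef
    have hN : 0 ≤ N := Finset.prod_nonneg fun i _ => by positivity
    have hsp := prod_spread V k n hV hc hkn hn0
    set σ : ℝ := 1 / (8 * (m + 1)) with hσdef
    have hσ0 : 0 ≤ σ := by positivity
    have hσ : ∀ A ∈ prodFam V k, ∑ v ∈ A, p v ≤ σ := by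
      intro A hA
      rw [hpdef, wt_sum V k n A hA]
      have hl' : (1 : ℝ) ≤ ℓ := by exact_mod_cast hl
      calc _ ≤ ∑ i : Fin ℓ, 1 / (8 * (ℓ : ℝ) ^ 2 * (m + 1)) := by
            apply Finset.sum_le_sum
            intro i _
            rw [← mul_div_assoc, div_le_div_iff₀ (hn0' i) (by positivity)]
            have h := hn i
            have h' : 8 * (ℓ : ℝ) ^ 2 * (k i) ^ 2 * (m + 1) ≤ n i := by exact_mod_cast h
            calc _ = 8 * (ℓ : ℝ) ^ 2 * (k i) ^ 2 * (m + 1) := by ring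
              _ ≤ _ := by linarith
        _ = ℓ * (1 / (8 * (ℓ : ℝ) ^ 2 * (m + 1))) := by simp
        _ = 1 / (ℓ * (8 * (m + 1))) := by field_simp
        _ ≤ 1 / (1 * (8 * (m + 1))) := by gcongr
        _ = _ := by rw [one_mul]
    haveI : Nonempty (Fin ℓ) := ⟨⟨0, hl⟩⟩
    obtain ⟨i0, _, hi0⟩ := Finset.exists_max_image (Finset.univ : Finset (Fin ℓ))
      (fun i => (k i : ℝ) / n i) Finset.univ_nonempty
    set P : ℝ := (k i0 : ℝ) / n i0 with hPdef
    have hP0 : 0 ≤ P := by positivity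
    have hP : ∀ v, p v ≤ P := by
      intro v
      by_cases hv : ∃ i, v ∈ V i
      · obtain ⟨i, hi⟩ := hv
        rw [hpdef, wt_eq V k n hV v i hi]
        exact hi0 i (Finset.mem_univ i)
      · push Not at hv
        rw [hpdef]
        unfold wt
        simpa [hv] using hP0
    have hTr : (T.card : ℝ) = m + 1 := by rw [hT]; push_cast; ring
    by_cases hA : ∃ t ∈ T, ∃ v, T.card * σ * p v * N < deg (F t) v
    · obtain ⟨t, ht, v, hdeg⟩ := hA
      have hpv := hp v
      have hdpos : (0 : ℝ) < deg (F t) v := lt_of_le_of_lt (by positivity) hdeg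
      obtain ⟨i, hi⟩ : ∃ i, v ∈ V i := by
        obtain ⟨A, hA⟩ := Finset.card_pos.mp (show 0 < deg (F t) v by exact_mod_cast hdpos)
        rw [Finset.mem_filter] at hA
        have h1 := hF t ht hA.1
        obtain ⟨i, _, hi⟩ := Finset.mem_biUnion.mp
          (Finset.mem_powerset.mp (Finset.mem_filter.mp h1).1 hA.2)
        exact ⟨i, hi⟩
      have hvj : ∀ j, j ≠ i → v ∉ V j := fun j hj h =>
        Finset.disjoint_left.mp (hV j i hj) h hi
      have hcard : (T.erase t).card = m := by rw [Finset.card_erase_of_mem ht, hT]; rfl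
      have hpvi : p v = k i / n i := wt_eq V k n hV v i hi
      have hN' : (∏ j, ((Function.update n i (n i - 1) j).choose (k j) : ℝ)) = N - p v * N := by
        rw [hNdef, ← Finset.mul_prod_erase Finset.univ _ (Finset.mem_univ i),
          ← Finset.mul_prod_erase Finset.univ _ (Finset.mem_univ i), Function.update_self]
        have hcg : ∏ j ∈ Finset.univ.erase i,
            ((Function.update n i (n i - 1) j).choose (k j) : ℝ)
            = ∏ j ∈ Finset.univ.erase i, ((n j).choose (k j) : ℝ) := by
          apply Finset.prod_congr rfl
          intro j hj
          rw [Function.update_of_ne (Finset.ne_of_mem_erase hj)]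
        rw [hcg, hpvi]
        have hch : ((n i - 1).choose (k i) : ℝ) = (1 - k i / n i) * (n i).choose (k i) := by
          obtain ⟨r, hr⟩ : ∃ r, n i = r + 1 := ⟨n i - 1, by have := hn0 i; omega⟩
          have h := congrArg (Nat.cast : ℕ → ℝ) (Nat.choose_mul_succ_eq r (k i))
          have hkr : k i ≤ r + 1 := hr ▸ hkn i
          push_cast [Nat.cast_sub hkr] at h
          rw [hr, Nat.add_sub_cancel]
          push_cast
          have : (0 : ℝ) < (r : ℝ) + 1 := by positivity
          field_simp
          linarith
        rw [hch]
        ring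
      obtain ⟨e, he, hd⟩ := ih (T.erase t) hcard (Function.update n i (n i - 1))
        (fun j => (V j).erase v) (fun j => (F j).filter (fun A => v ∉ A))
        (by
          intro j
          have h := hn j
          have h1 : 8 * ℓ ^ 2 * (k j) ^ 2 * (m + 1)
            = 8 * ℓ ^ 2 * (k j) ^ 2 * m + 8 * ℓ ^ 2 * (k j) ^ 2 := by ring
          have h2 : 0 < 8 * ℓ ^ 2 * (k j) ^ 2 := by have := hk j; positivity
          by_cases hj : j = i
          · subst hj
            rw [Function.update_self]; omega
          · rw [Function.update_of_ne hj]; omega)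
        (fun a b hab => (hV a b hab).mono (Finset.erase_subset _ _) (Finset.erase_subset _ _))
        (by
          intro j
          by_cases hj : j = i
          · subst hj
            rw [Function.update_self, Finset.card_erase_of_mem hi, hc]
          · rw [Function.update_of_ne hj, Finset.erase_eq_of_notMem (hvj j hj), hc])
        (by
          intro j hj A hA
          rw [Finset.mem_filter] at hA
          have h := Finset.mem_filter.mp (hF j (Finset.mem_of_mem_erase hj) hA.1)
          refine Finset.mem_filter.mpr ⟨Finset.mem_powerset.mpr ?_, ?_⟩
          · intro x hx
            obtain ⟨a, ha, hxa⟩ := Finset.mem_biUnion.mp (Finset.mem_powerset.mp h.1 hx)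
            exact Finset.mem_biUnion.mpr ⟨a, ha, Finset.mem_erase.mpr
              ⟨fun hxv => hA.2 (hxv ▸ hx), hxa⟩⟩
          · intro a
            rw [← h.2 a]
            congr 1
            ext x
            simp only [Finset.mem_inter, Finset.mem_erase]
            constructor
            · exact fun hx => ⟨hx.1, hx.2.2⟩
            · exact fun hx => ⟨hx.1, fun hxv => hA.2 (hxv ▸ hx.1), hx.2⟩)
        (by
          intro j hj x hx
          have hjT := Finset.mem_of_mem_erase hj
          have h1 := hbig j hjT (fun a => x a + if a = i then 1 else 0)
            (by rw [Finset.sum_add_distrib]; simp; omega)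
          have h2 : ((F j).filter (fun A => v ∈ A)).card + ((F j).filter (fun A => v ∉ A)).card
            = (F j).card := Finset.card_filter_add_card_filter_not _
          have h3 := hsp {v}
          rw [Finset.prod_singleton] at h3
          have h4 : ((F j).filter (fun A => v ∈ A)).card ≤
              ((prodFam V k).filter (fun A => {v} ⊆ A)).card := by
            apply Finset.card_le_card
            intro A hA
            rw [Finset.mem_filter] at hA ⊢
            exact ⟨hF j hjT hA.1, Finset.singleton_subset_iff.mpr hA.2⟩
          have h5 : ∏ a, (n a - (x a + if a = i then 1 else 0)).choose (k a)
              = ∏ a, (Function.update n i (n i - 1) a - x a).choose (k a) := by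
            apply Finset.prod_congr rfl
            intro a _
            congr 1
            by_cases ha : a = i
            · subst ha
              rw [Function.update_self, if_pos rfl]; omega
            · rw [Function.update_of_ne ha, if_neg ha]; rfl
          rw [h5] at h1
          have h1' : N < (F j).card
              + ((∏ a, (Function.update n i (n i - 1) a - x a).choose (k a) : ℕ) : ℝ) := by
            rw [hNdef]; exact_mod_cast h1
          have h2' : (((F j).filter (fun A => v ∈ A)).card : ℝ)
            + ((F j).filter (fun A => v ∉ A)).card = (F j).card := by exact_mod_cast h2
          have h4' : (((F j).filter (fun A => v ∈ A)).card : ℝ) ≤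
              ((prodFam V k).filter (fun A => {v} ⊆ A)).card := by exact_mod_cast h4
          have hgoal : ((∏ a, (Function.update n i (n i - 1) a).choose (k a) : ℕ) : ℝ)
              < (((F j).filter (fun A => v ∉ A)).card : ℝ)
              + ((∏ a, (Function.update n i (n i - 1) a - x a).choose (k a) : ℕ) : ℝ) := by
            have : ((∏ a, (Function.update n i (n i - 1) a).choose (k a) : ℕ) : ℝ)
              = N - p v * N := by rw [← hN']; push_cast; rfl
            rw [this]
            have h3' : (((prodFam V k).filter (fun A => {v} ⊆ A)).card : ℝ) ≤ N * p v := h3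
            linarith
          exact_mod_cast hgoal)
      have he' : ∀ j ∈ T.erase t, e j ∈ F j ∧ v ∉ e j := fun j hj =>
        Finset.mem_filter.mp (he j hj)
      obtain ⟨A, hA, hAd⟩ := ext_one (prodFam V k) p hp N σ hN hsp hσ (F t) (hF t ht) ∅
        (fun A _ => Finset.empty_subset A)
        (T.erase t) e (fun j hj => hF j (Finset.mem_of_mem_erase hj) (he' j hj).1) hd v
        (Finset.notMem_empty v) (fun j hj => Finset.disjoint_empty_right _)
        (fun j hj => (he' j hj).2)
        (lt_of_le_of_lt (by
          rw [Finset.prod_empty, mul_one]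
          have : ((T.erase t).card : ℝ) ≤ T.card := by
            exact_mod_cast Finset.card_le_card (Finset.erase_subset t T)
          gcongr) hdeg)
      have := rainbow_insert (T.erase t) F t (Finset.notMem_erase t T) e
        (fun j hj => (he' j hj).1) hd A hA hAd
      rwa [Finset.insert_erase ht] at this
    · push Not at hA
      have hσm : ((m : ℝ) + 1) * σ = 1 / 8 := by rw [hσdef]; field_simp
      apply caseB (prodFam V k) p hp N σ P hN hσ0 hP0 hP hσ T (fun _ => ∅) F hF
      · intro t _ t' _ _ A _
        exact Finset.disjoint_empty_right A
      · intro t ht v _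
        rw [Finset.prod_empty, mul_one]
        exact hA t ht v
      · intro t ht
        rw [Finset.prod_empty, mul_one, hTr]
        have h1 := hbig t ht (fun a => if a = i0 then m else 0) (by simp)
        have h1' : N < (F t).card
            + ∏ a, (((n a - if a = i0 then m else 0).choose (k a) : ℕ) : ℝ) := by
          rw [hNdef]; exact_mod_cast h1
        have hi0n := hnk i0
        have hi0m := hkm i0
        have h2 : ∏ a, (((n a - if a = i0 then m else 0).choose (k a) : ℕ) : ℝ)
            ≤ N * (1 - P) ^ m := by
          rw [hNdef, ← Finset.mul_prod_erase Finset.univ _ (Finset.mem_univ i0),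
            ← Finset.mul_prod_erase Finset.univ _ (Finset.mem_univ i0), if_pos rfl]
          have hcg : ∏ a ∈ Finset.univ.erase i0,
              (((n a - if a = i0 then m else 0).choose (k a) : ℕ) : ℝ)
              = ∏ a ∈ Finset.univ.erase i0, ((n a).choose (k a) : ℝ) := by
            apply Finset.prod_congr rfl
            intro a ha
            rw [if_neg (Finset.ne_of_mem_erase ha), Nat.sub_zero]
          rw [hcg]
          have h3 := choose_del (n i0) (k i0) m (by omega) (hn0 i0) (hk i0)
          have h4 : 0 ≤ ∏ a ∈ Finset.univ.erase i0, ((n a).choose (k a) : ℝ) :=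
            Finset.prod_nonneg fun a _ => by positivity
          calc _ ≤ _ := mul_le_mul_of_nonneg_right h3 h4
            _ = _ := by rw [hPdef]; ring
        have hP1 : P ≤ 1 := by
          rw [hPdef, div_le_one (hn0' i0)]; exact_mod_cast hkn i0
        have hmP : m * P ≤ 1 := by
          rw [hPdef, ← mul_div_assoc, div_le_one (hn0' i0)]
          have : m * k i0 ≤ n i0 := by nlinarith
          exact_mod_cast this
        have h3 := mul_le_mul_of_nonneg_left (pow_bound P hP0 hP1 m hmP) hN
        calc 3 * ((m : ℝ) + 1) * (m + 1 - 1) * σ * P * N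
            = 3 * (((m : ℝ) + 1) * σ) * m * P * N := by ring
          _ = N - N * (1 - 3 / 8 * (m * P)) := by rw [hσm]; ring
          _ < _ := by linarith
      · intro R hR w hw1 hw2
        apply link_step (prodFam V k) p hp N P hN hP0 hP hsp T (fun _ => ∅) F hF
          (fun t _ A _ => Finset.empty_subset A)
          (fun t _ t' _ _ A _ => Finset.disjoint_empty_right A) R hR w hw1 hw2
        intro F' h1 h2 h3 h4
        refine spread_rainbow (prodFam V k) p hp N σ P hN hσ0 hP0 hP hsp hσ
          (Finset.univ.biUnion V).card ?_ _ R (fun t => insert (w t) ∅) F' rfl h1 h2 h3 ?_ h4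
        · intro A hA
          exact Finset.card_le_card (Finset.mem_powerset.mp (Finset.mem_filter.mp hA).1)
        · have : (R.card : ℝ) ≤ m + 1 := by
            rw [← hTr]; exact_mod_cast Finset.card_le_card hR
          nlinarith

end RainbowAux

theorem stmt13 {α : Type*} [DecidableEq α] (ℓ s : ℕ) (hl : 0 < ℓ) (hs : 0 < s)
    (n k : Fin ℓ → ℕ) (hk : ∀ i, 0 < k i)
    (hn : ∀ i, 8 * ℓ ^ 2 * (k i) ^ 2 * s ≤ n i)
    (V : Fin ℓ → Finset α)
    (hV : ∀ i j, i ≠ j → Disjoint (V i) (V j))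
    (hVcard : ∀ i, (V i).card = n i)
    (F : Fin s → Finset (Finset α))
    (hF : ∀ t, ∀ A ∈ F t, A ⊆ Finset.univ.biUnion V ∧ ∀ i, (A ∩ V i).card = k i)
    (hrainbow : ¬ ∃ e : Fin s → Finset α, (∀ t, e t ∈ F t) ∧
      ∀ t t', t ≠ t' → Disjoint (e t) (e t')) :
    ∃ t : Fin s, (F t).card ≤ ∏ i, (n i).choose (k i)
      - sInf {v : ℕ | ∃ x : Fin ℓ → ℕ, (∑ i, x i = s - 1) ∧
          v = ∏ i, (n i - x i).choose (k i)} := by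
  by_contra hcon
  push Not at hcon
  apply hrainbow
  have hne : Nonempty α := by
    have h1 := hn ⟨0, hl⟩
    have h2 : 0 < 8 * ℓ ^ 2 * (k ⟨0, hl⟩) ^ 2 * s := by have := hk ⟨0, hl⟩; positivity
    have h3 := hVcard ⟨0, hl⟩
    obtain ⟨x, _⟩ := Finset.card_pos.mp (show 0 < (V ⟨0, hl⟩).card by omega)
    exact ⟨x⟩
  obtain ⟨e, he, hd⟩ := RainbowAux.main_aux hl k hk s (Finset.univ : Finset (Fin s)) (by simp)
    n V F hn hV hVcard
    (fun t _ A hA => Finset.mem_filter.mpr ⟨Finset.mem_powerset.mpr (hF t A hA).1, (hF t A hA).2⟩)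
    (by
      intro t _ x hx
      have h1 := hcon t
      have h2 : sInf {v : ℕ | ∃ x : Fin ℓ → ℕ, (∑ i, x i = s - 1) ∧
          v = ∏ i, (n i - x i).choose (k i)} ≤ ∏ i, (n i - x i).choose (k i) :=
        Nat.sInf_le ⟨x, by omega, rfl⟩
      omega)
  exact ⟨e, fun t => he t (Finset.mem_univ t),
    fun t t' h => hd t (Finset.mem_univ t) t' (Finset.mem_univ t') h⟩
end

section
/- Suppose $\mathcal{F} \subseteq \sqcup_{i=1}^\ell \binom{V_i}{k_i}$ is an intersecting family (every two members share a common element) with $|V_i| = n_i$ and $2 \leq n_1/k_1 \leq n_2/k_2 \leq \dots \leq n_\ell/k_\ell$. Then $|\mathcal{F}| \leq \frac{k_1}{n_1} \prod_{i=1}^\ell \binom{n_i}{k_i}$. -/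
open Finset
lemma avg_aux {G X : Type*} [Group G] [Fintype G] [Fintype X] [DecidableEq X] [MulAction G X]
    (htr : ∀ x y : X, ∃ g : G, g • x = y) (F : Finset X) (n k : ℕ) (B : Fin n → X)
    (h : ∀ g : G, #{t | g • B t ∈ F} ≤ k) : n * #F ≤ k * Fintype.card X := by
  have hc : ∀ x y : X, #{g : G | g • x ∈ F} = #{g : G | g • y ∈ F} := by
    intro x y
    obtain ⟨τ, rfl⟩ := htr x y
    refine Finset.card_bij' (fun g _ => g * τ⁻¹) (fun g _ => g * τ) ?_ ?_ ?_ ?_ <;>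
      simp [mul_smul]
  have h1 : ∀ y : X, Fintype.card X * #{g : G | g • y ∈ F} = Fintype.card G * #F := by
    intro y
    have e1 : ∑ x : X, #{g : G | g • x ∈ F} = Fintype.card X * #{g : G | g • y ∈ F} := by
      rw [Finset.sum_congr rfl (fun x _ => hc x y)]; simp
    have e2 : ∑ g : G, #{x : X | g • x ∈ F} = Fintype.card G * #F := by
      have : ∀ g : G, #{x : X | g • x ∈ F} = #F := by
        intro g
        refine Finset.card_bij' (fun x _ => g • x) (fun x _ => g⁻¹ • x) ?_ ?_ ?_ ?_ <;> simp
      simp [this]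
    rw [← e1, ← e2]
    simp only [Finset.card_filter]
    exact Finset.sum_comm
  have h2 : ∑ t : Fin n, #{g : G | g • B t ∈ F} ≤ Fintype.card G * k := by
    have : ∑ t : Fin n, #{g : G | g • B t ∈ F} = ∑ g : G, #{t | g • B t ∈ F} := by
      simp only [Finset.card_filter]
      exact Finset.sum_comm
    rw [this]
    calc _ ≤ ∑ g : G, k := Finset.sum_le_sum (fun g _ => h g)
      _ = _ := by simp
  have h3 : Fintype.card X * ∑ t : Fin n, #{g : G | g • B t ∈ F} = n * (Fintype.card G * #F) := by
    rw [Finset.mul_sum, Finset.sum_congr rfl (fun t _ => h1 (B t))]; simp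
  have h4 : Fintype.card G * (n * #F) ≤ Fintype.card G * (k * Fintype.card X) := by
    calc _ = Fintype.card X * ∑ t : Fin n, #{g : G | g • B t ∈ F} := by rw [h3]; ring
      _ ≤ Fintype.card X * (Fintype.card G * k) := Nat.mul_le_mul_left _ h2
      _ = _ := by ring
  exact Nat.le_of_mul_le_mul_left h4 Fintype.card_pos

lemma katona_aux {n k : ℕ} (hk : 0 < k) (h2 : 2 * k ≤ n) (S : Finset (Fin n))
    (hS : ∀ s ∈ S, ∀ t ∈ S, k ≤ t.val - s.val → n - k < t.val - s.val) : #S ≤ k := by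
  rcases S.eq_empty_or_nonempty with rfl | hne
  · simp
  obtain ⟨m, hm, hmin⟩ : ∃ m ∈ S, ∀ t ∈ S, m ≤ t := ⟨S.min' hne, S.min'_mem hne, fun t ht => S.min'_le t ht⟩
  have : #S ≤ #(range k) := by
    refine Finset.card_le_card_of_injOn
      (fun t => if t.val - m.val < k then t.val - m.val else t.val - m.val - (n - k)) ?_ ?_
    · intro t ht
      have := hS m hm t ht
      have := t.2
      simp only [Finset.coe_range, Set.mem_Iio]
      split_ifs <;> omega
    · intro s hs t ht hst
      have a1 := hS m hm t ht
      have a2 := hS m hm s hs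
      have a3 := hS s hs t ht
      have a4 := hS t ht s hs
      have a5 : m.val ≤ t.val := hmin t ht
      have a6 : m.val ≤ s.val := hmin s hs
      have := s.2
      have := t.2
      apply Fin.ext
      dsimp only at hst
      split_ifs at hst <;> omega
  simpa using this

/-- The cyclic arc of length `k` starting at `s`. -/
def arcAux (m k s : ℕ) : Finset (Fin m) := {x | ∃ j < k, x.val = (s + j) % m}

lemma arcAux_card {m k s : ℕ} (h : k ≤ m) (hm : 0 < m) : #(arcAux m k s) = k := by
  have : arcAux m k s = (range k).image (fun j => (⟨(s + j) % m, Nat.mod_lt _ hm⟩ : Fin m)) := by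
    ext x
    simp only [arcAux, mem_filter, mem_univ, true_and, mem_image, mem_range, Fin.ext_iff]
    simp only [eq_comm]
  rw [this, Finset.card_image_of_injOn, card_range]
  intro a ha b hb hab
  simp only [coe_range, Set.mem_Iio] at ha hb
  have h1 : (s + a) ≡ (s + b) [MOD m] := congrArg Fin.val hab
  have h2 := Nat.ModEq.add_left_cancel' s h1
  exact Nat.ModEq.eq_of_lt_of_lt h2 (by omega) (by omega)

lemma arcAux_disj {m k s t : ℕ} (h1 : s + k ≤ t) (h2 : t + k ≤ s + m) :
    Disjoint (arcAux m k s) (arcAux m k t) := by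
  rw [Finset.disjoint_left]
  intro x hx hy
  simp only [arcAux, mem_filter, mem_univ, true_and] at hx hy
  obtain ⟨a, ha, hxa⟩ := hx
  obtain ⟨b, hb, hxb⟩ := hy
  have h3 : s + a ≡ t + b [MOD m] := by rw [Nat.ModEq, ← hxa, ← hxb]
  have h4 := (Nat.modEq_iff_dvd' (by omega)).1 h3
  have := Nat.le_of_dvd (by omega) h4
  omega

lemma floor_aux {n1 k1 m k s t : ℕ} (hn : 0 < n1) (hr : n1 * k ≤ m * k1)
    (h1 : s + k1 ≤ t) (h2 : t + k1 ≤ s + n1) :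
    s * m / n1 + k ≤ t * m / n1 ∧ t * m / n1 + k ≤ s * m / n1 + m := by
  constructor
  · rw [← Nat.add_mul_div_left _ _ hn]
    apply Nat.div_le_div_right
    nlinarith
  · rw [← Nat.add_mul_div_left _ _ hn, ← Nat.add_mul_div_left _ _ hn]
    apply Nat.div_le_div_right
    nlinarith
theorem stmt15 {α : Type*} [DecidableEq α] (ℓ : ℕ) (hl : 0 < ℓ)
    (n k : Fin ℓ → ℕ) (hk : ∀ i, 0 < k i)
    (hratio0 : 2 * k ⟨0, hl⟩ ≤ n ⟨0, hl⟩)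
    (hsorted : ∀ i j : Fin ℓ, i ≤ j → n i * k j ≤ n j * k i)
    (V : Fin ℓ → Finset α)
    (hV : ∀ i j, i ≠ j → Disjoint (V i) (V j))
    (hVcard : ∀ i, (V i).card = n i)
    (F : Finset (Finset α))
    (hF : ∀ A ∈ F, A ⊆ Finset.univ.biUnion V ∧ ∀ i, (A ∩ V i).card = k i)
    (hint : ∀ A ∈ F, ∀ B ∈ F, (A ∩ B).Nonempty) :
    (F.card : ℝ) ≤ (k ⟨0, hl⟩ : ℝ) / (n ⟨0, hl⟩ : ℝ) *
      ∏ i, ((n i).choose (k i) : ℝ) := by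
  classical
  have hn0 : 0 < n ⟨0, hl⟩ := by have := hk ⟨0, hl⟩; omega
  have hr : ∀ i, n ⟨0, hl⟩ * k i ≤ n i * k ⟨0, hl⟩ := fun i =>
    hsorted ⟨0, hl⟩ i (Nat.zero_le _)
  have hkn : ∀ i, k i ≤ n i := by
    intro i
    have h1 := hr i
    have h2 := hk ⟨0, hl⟩
    by_contra hlt
    push Not at hlt
    nlinarith
  have hni : ∀ i, 0 < n i := fun i => lt_of_lt_of_le (hk i) (hkn i)
  let e : ∀ i, Fin (n i) ≃ {x // x ∈ V i} := fun i =>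
    (finCongr (hVcard i).symm).trans (V i).equivFin.symm
  let X := ∀ i, Set.powersetCard {x // x ∈ V i} (k i)
  let G := ∀ i, Equiv.Perm {x // x ∈ V i}
  let _ : MulAction G X := Pi.mulAction'
  let _ : Fintype X := Fintype.ofFinite X
  let φ : X → Finset α := fun x => univ.biUnion fun i => (x i).1.map (Function.Embedding.subtype _)
  let F' : Finset X := univ.filter fun x => φ x ∈ F
  have hFF' : #F ≤ #F' := by
    have : F ⊆ F'.image φ := by
      intro A hA
      obtain ⟨hA1, hA2⟩ := hF A hA
      let x : X := fun i => ⟨A.subtype (· ∈ V i), by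
        change #(A.subtype (· ∈ V i)) = k i
        rw [Finset.card_subtype, ← hA2 i, Finset.filter_mem_eq_inter]⟩
      have hx : φ x = A := by
        ext a
        simp only [φ, x, mem_biUnion, mem_univ, true_and, mem_map, mem_subtype]
        constructor
        · rintro ⟨i, b, hb, rfl⟩
          exact hb
        · intro ha
          obtain ⟨i, -, hi⟩ := mem_biUnion.1 (hA1 ha)
          exact ⟨i, ⟨a, hi⟩, ha, rfl⟩
      rw [mem_image]
      exact ⟨x, by simp [F', hx, hA], hx⟩
    exact (card_le_card this).trans card_image_le
  have hint' : ∀ x ∈ F', ∀ y ∈ F', ∃ i, ¬ Disjoint (x i).1 (y i).1 := by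
    intro x hx y hy
    obtain ⟨a, ha⟩ := hint _ (mem_filter.1 hx).2 _ (mem_filter.1 hy).2
    simp only [φ, mem_inter, mem_biUnion, mem_univ, true_and, mem_map] at ha
    obtain ⟨⟨i, b, hb, rfl⟩, ⟨j, c, hc, hcb⟩⟩ := ha
    have hij : i = j := by
      by_contra hij
      refine Finset.disjoint_left.1 (hV i j hij) b.2 ?_
      change b.1 ∈ V j
      have : c.1 = b.1 := hcb
      rw [← this]; exact c.2
    subst hij
    have : c = b := Subtype.ext hcb
    subst this
    exact ⟨i, fun h => Finset.disjoint_left.1 h hb hc⟩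
  let B : Fin (n ⟨0, hl⟩) → X := fun t i =>
    ⟨(arcAux (n i) (k i) (t.val * n i / n ⟨0, hl⟩)).map (e i).toEmbedding, by
      change #_ = k i
      rw [card_map, arcAux_card (hkn i) (hni i)]⟩
  have htr : ∀ x y : X, ∃ g : G, g • x = y := by
    intro x y
    have : ∀ i, ∃ g : Equiv.Perm {x // x ∈ V i}, g • x i = y i := fun i =>
      Set.powersetCard.isPretransitive.exists_smul_eq (x i) (y i)
    choose g hg using this
    exact ⟨g, funext hg⟩
  have key := avg_aux (G := G) htr F' (n ⟨0, hl⟩) (k ⟨0, hl⟩) B (by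
    intro g
    apply katona_aux (hk _) hratio0
    intro s hs t ht hst
    by_contra hcon
    obtain ⟨i, hi⟩ := hint' _ (mem_filter.1 hs).2 _ (mem_filter.1 ht).2
    apply hi
    have hk0 := hk ⟨0, hl⟩
    obtain ⟨f1, f2⟩ := floor_aux (s := s.val) (t := t.val) hn0 (hr i) (by omega) (by omega)
    have hd := arcAux_disj f1 f2
    have hd2 : Disjoint (B s i).1 (B t i).1 := (Finset.disjoint_map _).2 hd
    change Disjoint ((B s i).1.image (g i • ·)) ((B t i).1.image (g i • ·))
    exact (Finset.disjoint_image (MulAction.injective (g i))).2 hd2)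
  have hX : Fintype.card X = ∏ i, (n i).choose (k i) := by
    rw [← Nat.card_eq_fintype_card, Nat.card_pi]
    refine Finset.prod_congr rfl fun i _ => ?_
    rw [Set.powersetCard.card]
    simp [hVcard]
  rw [hX] at key
  have key2 : n ⟨0, hl⟩ * #F ≤ k ⟨0, hl⟩ * ∏ i, (n i).choose (k i) :=
    (Nat.mul_le_mul_left _ hFF').trans key
  have key3 : (n ⟨0, hl⟩ : ℝ) * (#F : ℝ) ≤ k ⟨0, hl⟩ * ∏ i, ((n i).choose (k i) : ℝ) := by
    exact_mod_cast key2
  have hp : (0 : ℝ) < n ⟨0, hl⟩ := by exact_mod_cast hn0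
  rw [div_mul_eq_mul_div, le_div_iff₀ hp]
  linarith
end
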